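/- arXiv:1910.01322 — 2 statements merged into one kernel-verified Lean document; each statement's English description precedes it below -/
import Mathlib

section
/- For all integers r and k with k ≥ 2r+13 ≥ 18 there exists an integer N_{k,r} such that for every n > N_{k,r}: any connected n-vertex r-uniform hypergraph with no Berge-path of length k that has exactly C(⌊(k-1)/2⌋, r-1)·(n − ⌊(k-1)/2⌋) + C(⌊(k-1)/2⌋, r) + [k even]·C(⌊(k-1)/2⌋, r-2) hyperedges is isomorphic to the hypergraph H_{n,k}. -/
open scoped Classical

/-- A Berge-path of length `t` in the hypergraph `H` (a family of hyperedges):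
an alternating sequence of `t+1` distinct vertices and `t` distinct hyperedges
`v₁, e₁, …, e_t, v_{t+1}` with `vᵢ, vᵢ₊₁ ∈ eᵢ`. -/
structure BergePath {V : Type*} (H : Finset (Finset V)) (t : ℕ) where
  verts : Fin (t + 1) → V
  edges : Fin t → Finset V
  verts_inj : Function.Injective verts
  edges_inj : Function.Injective edges
  edges_mem : ∀ i, edges i ∈ H
  fst_mem : ∀ i : Fin t, verts i.castSucc ∈ edges i
  snd_mem : ∀ i : Fin t, verts i.succ ∈ edges i

/-- A Berge-cycle of length `t` in the hypergraph `H`: `t` distinct vertices and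
`t` distinct hyperedges with `vᵢ, vᵢ₊₁ ∈ eᵢ`, indices mod `t`. -/
structure BergeCycle {V : Type*} (H : Finset (Finset V)) (t : ℕ) where
  verts : Fin t → V
  edges : Fin t → Finset V
  verts_inj : Function.Injective verts
  edges_inj : Function.Injective edges
  edges_mem : ∀ i, edges i ∈ H
  fst_mem : ∀ i, verts i ∈ edges i
  snd_mem : ∀ i : Fin t, verts ⟨(i.val + 1) % t, Nat.mod_lt _ i.pos⟩ ∈ edges i

/-- `u` and `v` are joined by a Berge-path of `H`. -/
def BergeReachable {V : Type*} (H : Finset (Finset V)) (u v : V) : Prop :=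
  ∃ t, ∃ P : BergePath H t, P.verts 0 = u ∧ P.verts (Fin.last t) = v

/-- A hypergraph on the vertex type `V` is connected if any two vertices are joined
by a Berge-path. -/
def HConnected {V : Type*} (H : Finset (Finset V)) : Prop :=
  ∀ u v : V, u ≠ v → BergeReachable H u v

/-- The degree of a vertex: the number of hyperedges containing it. -/
noncomputable def hdeg {V : Type*} (H : Finset (Finset V)) (v : V) : ℕ :=
  (H.filter (fun e => v ∈ e)).card

/-- The vertex neighborhood of `v` in `H`. -/
noncomputable def nbhd {V : Type*} [Fintype V] (H : Finset (Finset V)) (v : V) : Finset V :=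
  Finset.univ.filter (fun u => u ≠ v ∧ ∃ e ∈ H, v ∈ e ∧ u ∈ e)

/-- The sub-hypergraph induced by a set `S` of vertices: all hyperedges lying inside `S`. -/
noncomputable def restrictTo {V : Type*} (H : Finset (Finset V)) (S : Finset V) :
    Finset (Finset V) :=
  H.filter (fun e => e ⊆ S)

/-- `DelProcess H D S T` : starting from the vertex set `S`, the vertex set `T` can be
reached by repeatedly deleting a vertex whose degree in the current induced
sub-hypergraph is less than `D` (together with all hyperedges containing it). -/
inductive DelProcess {V : Type*} (H : Finset (Finset V)) (D : ℕ) :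
    Finset V → Finset V → Prop
  | refl (S : Finset V) : DelProcess H D S S
  | step (S T : Finset V) (v : V) (hv : v ∈ S)
      (hd : hdeg (restrictTo H S) v < D)
      (h : DelProcess H D (S.erase v) T) : DelProcess H D S T

/-- The edge family of `H_{n,k}` for odd `k`, on vertex set `S` with kernel `A`:
all `r`-subsets of `S` having at most one vertex outside `A`. -/
noncomputable def HnkFamilyOdd {V : Type*} (r : ℕ) (S A : Finset V) : Finset (Finset V) :=
  S.powerset.filter (fun s => s.card = r ∧ (s \ A).card ≤ 1)

/-- The edge family of `H_{n,k}` for even `k`: additionally all `r`-subsets consisting of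
`b1`, `b2` and `r-2` vertices of `A`. -/
noncomputable def HnkFamilyEven {V : Type*} (r : ℕ) (S A : Finset V) (b1 b2 : V) :
    Finset (Finset V) :=
  S.powerset.filter (fun s => s.card = r ∧ ((s \ A).card ≤ 1 ∨ s \ A = {b1, b2}))

/-- `H` is (a copy of) the extremal hypergraph `H_{m,k}` on the vertex set `S`
(where `m = |S|`). Note that `⌊(k-1)/2⌋` equals `(k-1)/2` in ℕ for odd `k`,
and `(k-2)/2` for even `k`. -/
def IsHnkOn {V : Type*} (r k : ℕ) (S : Finset V) (H : Finset (Finset V)) : Prop :=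
  ∃ A ⊆ S, A.card = (k - 1) / 2 ∧
    ((Odd k ∧ H = HnkFamilyOdd r S A) ∨
     (Even k ∧ ∃ b1 ∈ S \ A, ∃ b2 ∈ S \ A, b1 ≠ b2 ∧ H = HnkFamilyEven r S A b1 b2))

/-- The extremal number of hyperedges:
`C(⌊(k-1)/2⌋, r-1)·(n − ⌊(k-1)/2⌋) + C(⌊(k-1)/2⌋, r) + [2 ∣ k]·C(⌊(k-1)/2⌋, r-2)`. -/
def extremalCount (r k n : ℕ) : ℕ :=
  ((k - 1) / 2).choose (r - 1) * (n - (k - 1) / 2) + ((k - 1) / 2).choose r +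
    (if 2 ∣ k then ((k - 1) / 2).choose (r - 2) else 0)

/-- The threshold `N_{k,r}`. -/
def Nkr (r k : ℕ) : ℕ :=
  (r * (k - 1)).choose r + ((k - 1) / 2).choose (r - 1) * ((k - 1) / 2)
    - ((k - 1) / 2).choose r - (if 2 ∣ k then ((k - 1) / 2).choose (r - 2) else 0)
    + r * (k - 1)

section Graph

variable {N : Type*}

/-- A (simple) path of a relation, recorded as the list of its nodes. -/
structure IsPathList (adj : N → N → Prop) (l : List N) : Prop where
  chain : l.IsChain adj
  nodup : l.Nodup

theorem IsPathList.reverse {adj : N → N → Prop} (hs : ∀ ⦃x y⦄, adj x y → adj y x) {l : List N}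
    (h : IsPathList adj l) : IsPathList adj l.reverse :=
  ⟨List.isChain_reverse.2 (h.chain.imp fun _ _ hab => hs hab), List.nodup_reverse.2 h.nodup⟩

theorem IsPathList.append {adj : N → N → Prop} {l₁ l₂ : List N}
    (h₁ : IsPathList adj l₁) (h₂ : IsPathList adj l₂)
    (h : ∀ x ∈ l₁.getLast?, ∀ y ∈ l₂.head?, adj x y) (hd : ∀ x ∈ l₁, x ∉ l₂) :
    IsPathList adj (l₁ ++ l₂) :=
  ⟨h₁.chain.append h₂.chain h, List.nodup_append'.2 ⟨h₁.nodup, h₂.nodup, fun x hx hy => hd x hx hy⟩⟩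

theorem IsPathList.left_of_append {adj : N → N → Prop} {l₁ l₂ : List N}
    (h : IsPathList adj (l₁ ++ l₂)) : IsPathList adj l₁ :=
  ⟨h.chain.left_of_append, h.nodup.of_append_left⟩

theorem IsPathList.right_of_append {adj : N → N → Prop} {l₁ l₂ : List N}
    (h : IsPathList adj (l₁ ++ l₂)) : IsPathList adj l₂ :=
  ⟨h.chain.right_of_append, h.nodup.of_append_right⟩

/-- The list `l` is a path from `a` to `b`. -/
structure IsPathFromTo (adj : N → N → Prop) (a b : N) (l : List N) : Prop
    extends IsPathList adj l where
  head : l.head? = some a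
  last : l.getLast? = some b

theorem IsPathFromTo.reverse {adj : N → N → Prop} (hs : ∀ ⦃x y⦄, adj x y → adj y x) {a b : N}
    {l : List N}
    (h : IsPathFromTo adj a b l) : IsPathFromTo adj b a l.reverse :=
  ⟨h.toIsPathList.reverse hs, by simp [h.last], by simp [h.head]⟩

theorem IsPathFromTo.append {adj : N → N → Prop} {a b c d : N} {l₁ l₂ : List N}
    (h₁ : IsPathFromTo adj a b l₁) (h₂ : IsPathFromTo adj c d l₂)
    (h : adj b c) (hd : ∀ x ∈ l₁, x ∉ l₂) :
    IsPathFromTo adj a d (l₁ ++ l₂) := by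
  refine ⟨h₁.toIsPathList.append h₂.toIsPathList ?_ hd, ?_, ?_⟩
  · simp [h₁.last, h₂.head, h]
  · simp [h₁.head]
  · simp [h₂.last]

theorem IsPathFromTo.singleton (adj : N → N → Prop) (a : N) : IsPathFromTo adj a a [a] :=
  ⟨⟨List.isChain_singleton a, List.nodup_singleton a⟩, rfl, rfl⟩

theorem IsPathFromTo.mono {adj adj' : N → N → Prop} (hm : ∀ x y, adj x y → adj' x y) {a b : N}
    {l : List N} (h : IsPathFromTo adj a b l) : IsPathFromTo adj' a b l :=
  ⟨⟨h.chain.imp hm, h.nodup⟩, h.head, h.last⟩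

theorem IsPathFromTo.head_mem {adj : N → N → Prop} {a b : N} {l : List N}
    (h : IsPathFromTo adj a b l) : a ∈ l := List.mem_of_head? h.head

theorem IsPathFromTo.last_mem {adj : N → N → Prop} {a b : N} {l : List N}
    (h : IsPathFromTo adj a b l) : b ∈ l := List.mem_of_getLast? h.last

theorem IsPathFromTo.eq_cons {adj : N → N → Prop} {a b : N} {l : List N}
    (h : IsPathFromTo adj a b l) : ∃ t, l = a :: t := by
  have := h.head
  cases l with
  | nil => simp at this
  | cons x t => simp at this; exact ⟨t, by rw [this]⟩

theorem IsPathFromTo.eq_concat {adj : N → N → Prop} {a b : N} {l : List N}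
    (h : IsPathFromTo adj a b l) : ∃ t, l = t ++ [b] := by
  exact ⟨_, (List.dropLast_append_getLast? b h.last).symm⟩

/-- Reachability inside the node set `R`. -/
def ConnIn (adj : N → N → Prop) (R : Finset N) : N → N → Prop :=
  Relation.ReflTransGen fun a b => adj a b ∧ a ∈ R ∧ b ∈ R

theorem ConnIn.symm {adj : N → N → Prop} (hs : ∀ ⦃x y⦄, adj x y → adj y x) {R : Finset N} {a b : N}
    (h : ConnIn adj R a b) : ConnIn adj R b a := by
  induction h with
  | refl => exact .refl
  | tail _ h ih => exact .head ⟨hs h.1, h.2.2, h.2.1⟩ ih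

theorem ConnIn.exists_path {adj : N → N → Prop} {R : Finset N} {a b : N} (ha : a ∈ R)
    (h : ConnIn adj R a b) :
    ∃ l, IsPathFromTo adj a b l ∧ ∀ x ∈ l, x ∈ R := by
  induction h using Relation.ReflTransGen.head_induction_on with
  | refl => exact ⟨[b], .singleton _ _, by simpa using ha⟩
  | @head a c hac _ ih =>
    obtain ⟨l, hl, hR⟩ := ih hac.2.2
    by_cases hal : a ∈ l
    · obtain ⟨s, t, rfl⟩ := List.append_of_mem hal
      refine ⟨a :: t, ⟨hl.toIsPathList.right_of_append, rfl, ?_⟩, fun x hx => hR x (by simp_all)⟩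
      have := hl.last
      simpa using this
    · refine ⟨[a] ++ l, (IsPathFromTo.singleton adj a).append hl hac.1 (by simpa using hal), ?_⟩
      simpa using ⟨ha, hR⟩

/-- The component of `u` in the graph induced on `R`. -/
noncomputable def compOf (adj : N → N → Prop) (R : Finset N) (u : N) : Finset N :=
  R.filter (ConnIn adj R u)

/-- The components of the graph induced on `R`. -/
noncomputable def comps (adj : N → N → Prop) (R : Finset N) : Finset (Finset N) :=
  R.image (compOf adj R)

theorem mem_compOf {adj : N → N → Prop} {R : Finset N} {u v : N} :
    v ∈ compOf adj R u ↔ v ∈ R ∧ ConnIn adj R u v := by simp [compOf]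

theorem compOf_eq {adj : N → N → Prop} (hs : ∀ ⦃x y⦄, adj x y → adj y x) {R : Finset N} {u v : N}
    (h : v ∈ compOf adj R u) : compOf adj R v = compOf adj R u := by
  ext w
  simp only [mem_compOf] at *
  exact ⟨fun hw => ⟨hw.1, h.2.trans hw.2⟩, fun hw => ⟨hw.1, (h.2.symm hs).trans hw.2⟩⟩

theorem eq_compOf_of_mem_comps {adj : N → N → Prop} (hs : ∀ ⦃x y⦄, adj x y → adj y x)
    {R C : Finset N}
    (hC : C ∈ comps adj R) {v : N} (hv : v ∈ C) : C = compOf adj R v := by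
  obtain ⟨u, _, rfl⟩ := Finset.mem_image.1 hC
  exact (compOf_eq hs hv).symm

theorem comps_subset {adj : N → N → Prop} {R C : Finset N}
    (hC : C ∈ comps adj R) : C ⊆ R := by
  obtain ⟨u, _, rfl⟩ := Finset.mem_image.1 hC
  exact Finset.filter_subset _ _

theorem comps_nonempty {adj : N → N → Prop} {R C : Finset N}
    (hC : C ∈ comps adj R) : C.Nonempty := by
  obtain ⟨u, hu, rfl⟩ := Finset.mem_image.1 hC
  exact ⟨u, mem_compOf.2 ⟨hu, .refl⟩⟩

theorem comps_closed {adj : N → N → Prop} {R C : Finset N}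
    (hC : C ∈ comps adj R) {v w : N} (hv : v ∈ C) (hw : w ∈ R) (h : adj v w) : w ∈ C := by
  obtain ⟨u, hu, rfl⟩ := Finset.mem_image.1 hC
  obtain ⟨hv, huv⟩ := mem_compOf.1 hv
  exact mem_compOf.2 ⟨hw, huv.tail ⟨h, hv, hw⟩⟩

theorem comps_connIn {adj : N → N → Prop} (hs : ∀ ⦃x y⦄, adj x y → adj y x) {R C : Finset N}
    (hC : C ∈ comps adj R) {v w : N} (hv : v ∈ C) (hw : w ∈ C) : ConnIn adj C v w := by
  have hCv := eq_compOf_of_mem_comps hs hC hv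
  have hw' : ConnIn adj R v w := by rw [hCv] at hw; exact (mem_compOf.1 hw).2
  clear hw
  suffices h : ConnIn adj C v w ∧ w ∈ C from h.1
  induction hw' with
  | refl => exact ⟨.refl, hv⟩
  | tail _ h ih =>
    have := comps_closed hC ih.2 h.2.2 h.1
    exact ⟨ih.1.tail ⟨h.1, ih.2, this⟩, this⟩

theorem comps_disjoint {adj : N → N → Prop} (hs : ∀ ⦃x y⦄, adj x y → adj y x) {R C C' : Finset N}
    (hC : C ∈ comps adj R) (hC' : C' ∈ comps adj R) (hne : C ≠ C') : Disjoint C C' := by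
  rw [Finset.disjoint_left]
  intro v hv hv'
  exact hne ((eq_compOf_of_mem_comps hs hC hv).trans (eq_compOf_of_mem_comps hs hC' hv').symm)

theorem exists_large_comp {adj : N → N → Prop} {R C : Finset N} {T m : ℕ}
    (hT : (comps adj R).card ≤ T) (hCR : C ⊆ R) (hC : T * m < C.card) :
    ∃ C' ∈ comps adj R, m < (C ∩ C').card := by
  obtain ⟨C', hC', hm⟩ := Finset.exists_lt_card_fiber_of_mul_lt_card_of_maps_to
    (f := compOf adj R) (s := C) (t := comps adj R) (n := m)
    (fun v hv => Finset.mem_image_of_mem _ (hCR hv))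
    ((Nat.mul_le_mul_right m hT).trans_lt hC)
  refine ⟨C', hC', hm.trans_le (Finset.card_le_card fun v hv => ?_)⟩
  obtain ⟨hvC, rfl⟩ := Finset.mem_filter.1 hv
  exact Finset.mem_inter.2 ⟨hvC, mem_compOf.2 ⟨hCR hvC, .refl⟩⟩

/-- The size that forces a separator in `exists_separator`. -/
def separatorBound (T : ℕ) : ℕ → ℕ
  | 0 => 1
  | j + 1 => T * separatorBound T j + 2

theorem separator_step {adj : N → N → Prop} (hs : ∀ ⦃x y⦄, adj x y → adj y x) {L T : ℕ}
    {R : Finset N}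
    (hL : ∀ l, IsPathList adj l → (∀ x ∈ l, x ∈ R) → l.length ≤ L) (j : ℕ) :
    ∀ (l : List N) (C : Finset N), l.length + j = L → C ∈ comps adj (R \ l.toFinset) →
      separatorBound T j ≤ C.card → (∃ w ∈ C, IsPathList adj (w :: l)) → (∀ x ∈ l, x ∈ R) →
      ∃ X ⊆ R, X.card ≤ L ∧ T ≤ (comps adj (R \ X)).card := by
  induction j with
  | zero =>
    rintro l C hlen hC - ⟨w, hw, hwl⟩ hlR
    have := hL _ hwl (by
      have := comps_subset hC hw
      simp at this
      simpa using ⟨this.1, hlR⟩)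
    simp at this; omega
  | succ j ih =>
    rintro l C hlen hC hcard ⟨w, hw, hwl⟩ hlR
    have hwR := comps_subset hC hw
    simp only [Finset.mem_sdiff, List.mem_toFinset] at hwR
    have hlR' : ∀ x ∈ w :: l, x ∈ R := by simpa using ⟨hwR.1, hlR⟩
    by_cases hT : T ≤ (comps adj (R \ (w :: l).toFinset)).card
    · refine ⟨_, fun x hx => hlR' x (List.mem_toFinset.1 hx), ?_, hT⟩
      exact (List.toFinset_card_le _).trans (hL _ hwl hlR')
    obtain ⟨C', hC', hm⟩ := exists_large_comp (C := C.erase w) (m := separatorBound T j)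
      (le_of_not_ge hT) (by
        intro x hx
        have h1 := comps_subset hC (Finset.mem_of_mem_erase hx)
        simp only [Finset.mem_sdiff, List.mem_toFinset, List.mem_cons] at h1 ⊢
        exact ⟨h1.1, by rintro (rfl | h); exacts [by simp at hx, h1.2 h]⟩) (by
        rw [Finset.card_erase_of_mem hw]
        simp only [separatorBound] at hcard
        omega)
    have hC'R := comps_subset hC'
    refine ih (w :: l) C' (by simp; omega) hC'
      (hm.le.trans (Finset.card_le_card Finset.inter_subset_right)) ?_ hlR'
    by_contra hno
    push Not at hno
    obtain ⟨c, hc⟩ := Finset.card_pos.1 ((Nat.zero_le _).trans_lt hm)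
    obtain ⟨hcC, hcC'⟩ := Finset.mem_inter.1 hc
    have hcw : ConnIn adj C c w := comps_connIn hs hC (Finset.mem_of_mem_erase hcC) hw
    have hstay : ∀ x, ConnIn adj C c x → x ∈ C' := by
      intro x hx
      induction hx with
      | refl => exact hcC'
      | @tail x z _ h ih' =>
        by_cases hz : z = w
        · subst hz
          have hxR := hC'R ih'
          simp only [Finset.mem_sdiff, List.mem_toFinset] at hxR
          exact absurd ⟨List.IsChain.cons_cons h.1 hwl.chain,
            List.nodup_cons.2 ⟨hxR.2, hwl.nodup⟩⟩ (hno x ih')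
        · refine comps_closed hC' ih' ?_ h.1
          have := comps_subset hC h.2.2
          simp only [Finset.mem_sdiff, List.mem_toFinset, List.mem_cons] at this ⊢
          exact ⟨this.1, by tauto⟩
    have := hC'R (hstay w hcw)
    simp at this

/-- A large graph all of whose paths are short is split into many components by deleting
a bounded number of nodes. -/
theorem exists_separator {adj : N → N → Prop} (hs : ∀ ⦃x y⦄, adj x y → adj y x) {L T : ℕ}
    {R : Finset N}
    (hL : ∀ l, IsPathList adj l → (∀ x ∈ l, x ∈ R) → l.length ≤ L)
    (hR : separatorBound T (L + 1) ≤ R.card) :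
    ∃ X ⊆ R, X.card ≤ L ∧ T ≤ (comps adj (R \ X)).card := by
  by_cases hT : T ≤ (comps adj R).card
  · exact ⟨∅, by simp, by simp, by simpa using hT⟩
  obtain ⟨C', hC', hm⟩ := exists_large_comp (C := R) (m := separatorBound T L)
    (le_of_not_ge hT) (Finset.Subset.refl _) (by simp only [separatorBound] at hR; omega)
  obtain ⟨w, hw⟩ := comps_nonempty hC'
  exact separator_step hs hL L [] C' (by simp) (by simpa using hC')
    (hm.le.trans (Finset.card_le_card Finset.inter_subset_right))
    ⟨w, hw, (IsPathFromTo.singleton adj w).toIsPathList⟩ (by simp)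

/-- A path between two sets that meets each of them only in one end. -/
theorem exists_path_between {adj : N → N → Prop} {P Q : N → Prop} {a b : N} {l : List N}
    (hl : IsPathFromTo adj a b l) (ha : P a) (hb : Q b) :
    ∃ a' b' l', IsPathFromTo adj a' b' l' ∧ P a' ∧ Q b' ∧ (∀ x ∈ l'.tail, ¬ P x) ∧
      (∀ x ∈ l'.dropLast, ¬ Q x) := by
  induction hn : l.length using Nat.strong_induction_on generalizing a b l with
  | _ n ih =>
    subst hn
    by_cases h1 : ∃ x ∈ l.tail, P x
    · obtain ⟨x, hx, hPx⟩ := h1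
      obtain ⟨t, rfl⟩ := hl.eq_cons
      obtain ⟨s, t', rfl⟩ := List.append_of_mem (by simpa using hx)
      rw [← List.cons_append] at hl
      refine ih _ (by simp) (l := x :: t') ⟨hl.toIsPathList.right_of_append, rfl, ?_⟩ hPx hb rfl
      have := hl.last
      rwa [List.getLast?_append_of_ne_nil _ (by simp)] at this
    by_cases h2 : ∃ x ∈ l.dropLast, Q x
    · obtain ⟨x, hx, hQx⟩ := h2
      obtain ⟨t, rfl⟩ := hl.eq_concat
      obtain ⟨s, t', rfl⟩ := List.append_of_mem (by simpa using hx)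
      have hl' : IsPathFromTo adj a b ((s ++ [x]) ++ (t' ++ [b])) := by simpa using hl
      exact ih _ (by simp) (l := s ++ [x]) ⟨hl'.toIsPathList.left_of_append, by
        have := hl'.head; cases s <;> simpa using this, by simp⟩ ha hQx rfl
    push Not at h1 h2
    exact ⟨a, b, l, hl, ha, hb, h1, h2⟩

end Graph

section Incidence

variable {V : Type*}

/-- Nodes of the incidence graph: vertices and potential hyperedges. -/
abbrev Node (V : Type*) := V ⊕ Finset V

/-- The incidence graph of a hypergraph. -/
def Inc (H : Finset (Finset V)) : Node V → Node V → Prop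
  | .inl v, .inr e => e ∈ H ∧ v ∈ e
  | .inr e, .inl v => e ∈ H ∧ v ∈ e
  | _, _ => False

@[simp] theorem inc_inl_inr {H : Finset (Finset V)} {v : V} {e : Finset V} :
    Inc H (.inl v) (.inr e) ↔ e ∈ H ∧ v ∈ e := Iff.rfl

@[simp] theorem inc_inr_inl {H : Finset (Finset V)} {v : V} {e : Finset V} :
    Inc H (.inr e) (.inl v) ↔ e ∈ H ∧ v ∈ e := Iff.rfl

@[simp] theorem not_inc_inl_inl {H : Finset (Finset V)} {v w : V} :
    ¬ Inc H (.inl v) (.inl w) := id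

@[simp] theorem not_inc_inr_inr {H : Finset (Finset V)} {e f : Finset V} :
    ¬ Inc H (.inr e) (.inr f) := id

theorem inc_symm (H : Finset (Finset V)) : ∀ ⦃x y : Node V⦄, Inc H x y → Inc H y x := by
  rintro (v | e) (w | f) h <;> exact h

theorem Inc.mono
    {H H' : Finset (Finset V)} (hH : H ⊆ H') : ∀ x y : Node V, Inc H x y → Inc H' x y := by
  rintro (v | e) (w | f) h
  · exact h
  · exact ⟨hH h.1, h.2⟩
  · exact ⟨hH h.1, h.2⟩
  · exact h

theorem chain_parity {H : Finset (Finset V)} {l : List (Node V)} (hl : l.IsChain (Inc H)) {v : V}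
    (hv : l.head? = some (.inl v)) (i : ℕ) (hi : i < l.length) :
    (i % 2 = 0 → ∃ w, l[i] = .inl w) ∧ (i % 2 = 1 → ∃ e, l[i] = .inr e) := by
  induction i with
  | zero =>
    refine ⟨fun _ => ⟨v, ?_⟩, by simp⟩
    cases l with
    | nil => simp at hi
    | cons a t => simpa using hv
  | succ i ih =>
    have ih := ih (by omega)
    have hadj := List.isChain_iff_getElem.1 hl i hi
    constructor
    · intro h
      obtain ⟨e, he⟩ := ih.2 (by omega)
      rw [he] at hadj
      cases hx : l[i + 1] with
      | inl w => exact ⟨w, rfl⟩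
      | inr f => simp [hx] at hadj
    · intro h
      obtain ⟨e, he⟩ := ih.1 (by omega)
      rw [he] at hadj
      cases hx : l[i + 1] with
      | inr w => exact ⟨w, rfl⟩
      | inl f => simp [hx] at hadj

theorem chain_last_parity {H : Finset (Finset V)} {l : List (Node V)} (hl : l.IsChain (Inc H))
    {v w : V} (hv : l.head? = some (.inl v)) (hw : l.getLast? = some (.inl w)) :
    l.length % 2 = 1 := by
  have h0 : 0 < l.length := List.length_pos_of_ne_nil (by rintro rfl; simp at hv)
  by_contra h
  obtain ⟨e, he⟩ := (chain_parity hl hv (l.length - 1) (by omega)).2 (by omega)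
  rw [List.getLast?_eq_getElem?, List.getElem?_eq_getElem (by omega), he] at hw
  simp at hw

/-- A long path of the incidence graph starting at a vertex gives a long Berge-path. -/
theorem exists_bergePath {H : Finset (Finset V)} {l : List (Node V)} (hl : IsPathList (Inc H) l)
    {v : V} (hv : l.head? = some (.inl v)) {k : ℕ} (hk : 2 * k + 1 ≤ l.length) :
    Nonempty (BergePath H k) := by
  have hpar := chain_parity hl.chain hv
  choose f hf using fun (i : Fin (k + 1)) => (hpar (2 * i) (by omega)).1 (by omega)
  choose g hg using fun (i : Fin k) => (hpar (2 * i + 1) (by omega)).2 (by omega)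
  have hadj := fun i hi => List.isChain_iff_getElem.1 hl.chain i hi
  have h1 : ∀ i : Fin k, g i ∈ H ∧ f i.castSucc ∈ g i := by
    intro i
    have := hadj (2 * i) (by omega)
    have h2 := hf i.castSucc
    simp only [Fin.val_castSucc] at h2
    rwa [h2, hg] at this
  have h2 : ∀ i : Fin k, g i ∈ H ∧ f i.succ ∈ g i := by
    intro i
    have := hadj (2 * i + 1) (by omega)
    have h2 := hf i.succ
    simp only [Fin.val_succ] at h2
    rw [hg] at this
    simp only [show 2 * (i : ℕ) + 1 + 1 = 2 * (i + 1) by ring, h2] at this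
    exact this
  refine ⟨⟨f, g, fun i j hij => ?_, fun i j hij => ?_, fun i => (h1 i).1, fun i => (h1 i).2,
    fun i => (h2 i).2⟩⟩
  · have := hl.nodup.getElem_inj_iff (i := 2 * i) (j := 2 * j) (hi := by omega) (hj := by omega)
    rw [hf, hf, hij] at this
    have := this.1 rfl
    omega
  · have := hl.nodup.getElem_inj_iff (i := 2 * i + 1) (j := 2 * j + 1)
      (hi := by omega) (hj := by omega)
    rw [hg, hg, hij] at this
    have := this.1 rfl
    omega

theorem path_length_le_of_head {H : Finset (Finset V)} {k : ℕ} (hH : IsEmpty (BergePath H k))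
    {l : List (Node V)} (hl : IsPathList (Inc H) l) {v : V} (hv : l.head? = some (.inl v)) :
    l.length ≤ 2 * k := by
  by_contra h
  exact (exists_bergePath hl hv (by omega)).elim hH.false

theorem path_length_le {H : Finset (Finset V)} {k : ℕ} (hH : IsEmpty (BergePath H k))
    {l : List (Node V)} (hl : IsPathList (Inc H) l) : l.length ≤ 2 * k + 1 := by
  match l with
  | [] => simp
  | .inl v :: t => exact (path_length_le_of_head hH hl rfl).trans (by omega)
  | [.inr e] => simp
  | .inr e :: .inl v :: t =>
    have := path_length_le_of_head hH
      (IsPathList.right_of_append (l₁ := [Sum.inr e]) (l₂ := Sum.inl v :: t) hl) rfl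
    simpa using this
  | .inr e :: .inr f :: t => simpa using hl.chain

theorem exists_path_of_hConnected [Fintype V] {H : Finset (Finset V)} (hH : HConnected H)
    (u v : V) : ∃ l, IsPathFromTo (Inc H) (.inl u) (.inl v) l := by
  by_cases huv : u = v
  · subst huv
    exact ⟨_, .singleton _ _⟩
  obtain ⟨t, P, hu, hv⟩ := hH u v huv
  have key : ∀ i : Fin (t + 1), ConnIn (Inc H) Finset.univ (.inl u) (.inl (P.verts i)) := by
    intro i
    induction i using Fin.induction with
    | zero => rw [hu]; exact .refl
    | succ i ih =>
      have h₁ : Inc H (.inl (P.verts i.castSucc)) (.inr (P.edges i)) := ⟨P.edges_mem i, P.fst_mem i⟩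
      have h₂ : Inc H (.inr (P.edges i)) (.inl (P.verts i.succ)) := ⟨P.edges_mem i, P.snd_mem i⟩
      exact (ih.tail ⟨h₁, Finset.mem_univ _, Finset.mem_univ _⟩).tail
        ⟨h₂, Finset.mem_univ _, Finset.mem_univ _⟩
  have := key (Fin.last t)
  rw [hv] at this
  obtain ⟨l, hl, _⟩ := this.exists_path (Finset.mem_univ _)
  exact ⟨l, hl⟩

end Incidence

section Counting

theorem le_choose {n j : ℕ} (h1 : 1 ≤ j) (h2 : j + 1 ≤ n) : n ≤ n.choose j := by
  induction n generalizing j with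
  | zero => omega
  | succ n ih =>
    obtain ⟨j, rfl⟩ : ∃ i, j = i + 1 := ⟨j - 1, by omega⟩
    rw [Nat.choose_succ_succ, Nat.succ_eq_add_one]
    rcases Nat.eq_or_lt_of_le h2 with h | h
    · have : n = j + 1 := by omega
      subst this
      simp
    · have := ih h1 (by omega)
      have : 0 < n.choose j := Nat.choose_pos (by omega)
      omega

theorem two_mul_le_choose {n j : ℕ} (h1 : 2 ≤ j) (h2 : j + 2 ≤ n) :
    2 * (n - 1) ≤ n.choose j := by
  obtain ⟨j, rfl⟩ : ∃ i, j = i + 1 := ⟨j - 1, by omega⟩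
  obtain ⟨n, rfl⟩ : ∃ i, n = i + 1 := ⟨n - 1, by omega⟩
  rw [Nat.choose_succ_succ, Nat.succ_eq_add_one]
  have := le_choose (n := n) (j := j) (by omega) (by omega)
  have := le_choose (n := n) (j := j + 1) (by omega) (by omega)
  omega

theorem choose_pred_add {a r : ℕ} (hr : 3 ≤ r) (ha : r + 6 ≤ a) :
    a.choose (r - 1) = (a - 1).choose (r - 1) + (a - 1).choose (r - 2) := by
  obtain ⟨a, rfl⟩ : ∃ i, a = i + 1 := ⟨a - 1, by omega⟩
  obtain ⟨r, rfl⟩ : ∃ i, r = i + 2 := ⟨r - 2, by omega⟩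
  rw [show r + 2 - 1 = r + 1 by omega, Nat.choose_succ_succ, Nat.add_comm]
  simp

theorem eight_le_choose {a r : ℕ} (hr : 3 ≤ r) (ha : r + 6 ≤ a) :
    8 ≤ (a - 1).choose (r - 2) :=
  le_trans (by omega) (le_choose (n := a - 1) (j := r - 2) (by omega) (by omega))

theorem add_two_le_choose {a r : ℕ} (hr : 4 ≤ r) (ha : r + 6 ≤ a) :
    a + 2 ≤ (a - 1).choose (r - 2) :=
  le_trans (by omega) (two_mul_le_choose (n := a - 1) (j := r - 2) (by omega) (by omega))

theorem choose_sub_add_le {a r m q : ℕ} (hr : 3 ≤ r) (ha : r + 6 ≤ a) (hm : m ≤ a - 1)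
    (hq : q ≤ m) : (m - q).choose (r - 1) + q ≤ (a - 1).choose (r - 1) := by
  rcases Nat.eq_zero_or_pos q with rfl | hq0
  · simpa using Nat.choose_le_choose _ hm
  rcases Nat.eq_or_lt_of_le (hq.trans hm) with h | h
  · have : m - q = 0 := by omega
    rw [this, Nat.choose_eq_zero_of_lt (by omega), h]
    have := le_choose (n := a - 1) (j := r - 1) (by omega) (by omega)
    omega
  · have h1 : (m - q).choose (r - 1) ≤ (a - 2).choose (r - 1) := Nat.choose_le_choose _ (by omega)
    have h2 := le_choose (n := a - 2) (j := r - 2) (by omega) (by omega)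
    have h3 : (a - 1).choose (r - 1) = (a - 2).choose (r - 2) + (a - 2).choose (r - 1) := by
      obtain ⟨b, rfl⟩ : ∃ i, a = i + 2 := ⟨a - 2, by omega⟩
      obtain ⟨s, rfl⟩ : ∃ i, r = i + 2 := ⟨r - 2, by omega⟩
      exact Nat.choose_succ_succ _ _
    omega

theorem choose_le_add_mul {a r l : ℕ} (hr : 3 ≤ r) (hl : l + 1 ≤ a) :
    a.choose r ≤ (a - l).choose r + l * (a - 1).choose (r - 1) := by
  induction l with
  | zero => simp
  | succ l ih =>
    have h1 := ih (by omega)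
    have h2 : (a - l).choose r = (a - (l + 1)).choose (r - 1) + (a - (l + 1)).choose r := by
      obtain ⟨b, hb⟩ : ∃ i, a - l = i + 1 := ⟨a - l - 1, by omega⟩
      obtain ⟨s, rfl⟩ : ∃ i, r = i + 1 := ⟨r - 1, by omega⟩
      rw [hb, show a - (l + 1) = b by omega]
      exact Nat.choose_succ_succ _ _
    have h3 : (a - (l + 1)).choose (r - 1) ≤ (a - 1).choose (r - 1) :=
      Nat.choose_le_choose _ (by omega)
    rw [Nat.succ_mul]
    omega

theorem choose_lt_of_two_le {a r l : ℕ} (hr : 3 ≤ r) (ha : r + 6 ≤ a) (hl : 2 ≤ l) (hla : l ≤ a) :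
    (a + 1).choose r < (a + 1 - l).choose r + (a.choose (r - 1) - 1) * l := by
  have h1 := choose_le_add_mul (l := l - 1) hr (show l - 1 + 1 ≤ a by omega)
  have h2 : (a + 1).choose r = a.choose (r - 1) + a.choose r := by
    obtain ⟨s, rfl⟩ : ∃ i, r = i + 1 := ⟨r - 1, by omega⟩
    exact Nat.choose_succ_succ _ _
  have h3 := choose_pred_add hr ha
  have h4 := eight_le_choose hr ha
  rw [show a - (l - 1) = a + 1 - l by omega] at h1
  obtain ⟨l, rfl⟩ : ∃ i, l = i + 2 := ⟨l - 2, by omega⟩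
  rw [show l + 2 - 1 = l + 1 by omega] at h1
  obtain ⟨c, hc⟩ : ∃ c, (a - 1).choose (r - 2) = c + 8 := ⟨_, (Nat.sub_add_cancel h4).symm⟩
  rw [hc] at h3
  have h5 : a.choose (r - 1) - 1 = (a - 1).choose (r - 1) + c + 7 := by omega
  rw [h2, h5, h3]
  nlinarith

variable {V : Type*}

/-- Counting sets through a vertex `x` inside `insert x Z`. -/
theorem card_le_choose_of_mem {F : Finset (Finset V)} {r : ℕ} {x : V} {Z : Finset V}
    (hF : ∀ e ∈ F, e.card = r ∧ x ∈ e ∧ e.erase x ⊆ Z) : F.card ≤ Z.card.choose (r - 1) := by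
  rw [← Finset.card_powersetCard]
  refine Finset.card_le_card_of_injOn (fun e => e.erase x) (fun e he => ?_) fun e he f hf h => ?_
  · obtain ⟨h1, h2, h3⟩ := hF e he
    simp [Finset.mem_powersetCard, h3, Finset.card_erase_of_mem h2, h1]
  · rw [← Finset.insert_erase (hF e he).2.1, ← Finset.insert_erase (hF f hf).2.1]
    exact congrArg _ h

/-- Counting `r`-subsets of `Z` not inside `Z₀`. -/
theorem card_add_choose_le {F : Finset (Finset V)} {r : ℕ} {Z Z₀ : Finset V} (hZ : Z₀ ⊆ Z)
    (hF : ∀ e ∈ F, e.card = r ∧ e ⊆ Z ∧ ¬ e ⊆ Z₀) :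
    F.card + Z₀.card.choose r ≤ Z.card.choose r := by
  rw [← Finset.card_powersetCard, ← Finset.card_powersetCard, ← Finset.card_union_of_disjoint]
  · refine Finset.card_le_card (Finset.union_subset (fun e he => ?_) ?_)
    · exact Finset.mem_powersetCard.2 ⟨(hF e he).2.1, (hF e he).1⟩
    · exact Finset.powersetCard_mono hZ
  · rw [Finset.disjoint_left]
    exact fun e he h => (hF e he).2.2 (Finset.mem_powersetCard.1 h).1

end Counting

section PathCard

variable {V : Type*}

theorem IsPathList.card_toLeft {H : Finset (Finset V)} : ∀ {l : List (Node V)} {y x : V},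
    IsPathFromTo (Inc H) (.inl y) (.inl x) l →
    l.toFinset.toLeft.card = l.toFinset.toRight.card + 1
  | [], _, _, h => by simpa using h.head
  | [.inl v], _, _, _ => by
    rw [List.toFinset_cons, Finset.toLeft_insert_inl, Finset.toRight_insert_inl]
    rfl
  | [.inr e], _, _, h => by simpa using h.head
  | .inr e :: _ :: _, _, _, h => by simpa using h.head
  | .inl v :: .inl w :: _, _, _, h => by simpa using h.chain
  | [.inl v, .inr e], _, _, h => by simpa using h.last
  | .inl v :: .inr e :: .inr f :: _, _, _, h => by simpa using h.chain
  | .inl v :: .inr e :: .inl w :: t, y, x, h => by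
    have h' : IsPathFromTo (Inc H) (.inl w) (.inl x) (.inl w :: t) :=
      ⟨⟨(List.isChain_cons_cons.1 (List.isChain_cons_cons.1 h.chain).2).2, by
        have := h.nodup; simp at this ⊢; tauto⟩, rfl, by have := h.last; simpa using this⟩
    have ih := IsPathList.card_toLeft h'
    have hn := h.nodup
    have e1 : (Sum.inl v :: Sum.inr e :: Sum.inl w :: t : List (Node V)).toFinset.toLeft =
        insert v (Sum.inl w :: t : List (Node V)).toFinset.toLeft := by
      ext u; simp
    have e2 : (Sum.inl v :: Sum.inr e :: Sum.inl w :: t : List (Node V)).toFinset.toRight =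
        insert e (Sum.inl w :: t : List (Node V)).toFinset.toRight := by
      ext u; simp
    rw [e1, e2, Finset.card_insert_of_notMem, Finset.card_insert_of_notMem, ih]
    · simp at hn ⊢; tauto
    · simp at hn ⊢; tauto

theorem IsPathFromTo.card_verts {H : Finset (Finset V)} {l : List (Node V)} {y x : V} {m : ℕ}
    (h : IsPathFromTo (Inc H) (.inl y) (.inl x) l) (hm : l.length = 2 * m + 1) :
    l.toFinset.toLeft.card = m + 1 ∧ l.toFinset.toRight.card = m := by
  have h1 := IsPathList.card_toLeft h
  have h2 := Finset.card_toLeft_add_card_toRight (u := l.toFinset)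
  rw [List.toFinset_card_of_nodup h.nodup] at h2
  omega

theorem IsPathFromTo.exists_length {H : Finset (Finset V)} {l : List (Node V)} {y x : V}
    (h : IsPathFromTo (Inc H) (.inl y) (.inl x) l) : ∃ m, l.length = 2 * m + 1 := by
  have := chain_last_parity h.chain h.head h.last
  exact ⟨l.length / 2, by omega⟩

/-- The neighbours of a hyperedge in a path between vertices. -/
theorem IsPathFromTo.edge_nbrs {H : Finset (Finset V)} {l : List (Node V)} {y x : V}
    (h : IsPathFromTo (Inc H) (.inl y) (.inl x) l) {e : Finset V} (he : .inr e ∈ l) :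
    ∃ (l₁ l₂ : List (Node V)) (u w : V), l = l₁ ++ .inl u :: .inr e :: .inl w :: l₂ ∧
      u ∈ e ∧ w ∈ e := by
  obtain ⟨s, t, rfl⟩ := List.append_of_mem he
  rcases List.eq_nil_or_concat s with rfl | ⟨l₁, u, rfl⟩
  · simpa using h.head
  cases t with
  | nil => have := h.last; simp at this
  | cons w l₂ =>
    have hc := h.chain
    simp only [List.concat_eq_append, List.append_assoc, List.cons_append, List.nil_append] at hc
    have hc := hc.right_of_append
    simp only [List.isChain_cons_cons] at hc
    cases u with
    | inr f => simp at hc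
    | inl u =>
      cases w with
      | inr f => simp at hc
      | inl w =>
        simp only [inc_inl_inr, inc_inr_inl] at hc
        exact ⟨l₁, l₂, u, w, by simp, hc.1.2, hc.2.1.2⟩

/-- Every vertex of a path other than the first is preceded by a hyperedge and a vertex. -/
theorem IsPathFromTo.pred_nbrs {H : Finset (Finset V)} {l : List (Node V)} {y x w : V}
    (h : IsPathFromTo (Inc H) (.inl y) (.inl x) l) (hw : .inl w ∈ l) (hwy : w ≠ y) :
    ∃ (l₁ l₂ : List (Node V)) (u : V) (e : Finset V),
      l = l₁ ++ .inl u :: .inr e :: .inl w :: l₂ := by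
  obtain ⟨s, t, rfl⟩ := List.append_of_mem hw
  rcases List.eq_nil_or_concat s with rfl | ⟨s, e, rfl⟩
  · have := h.head; simp at this; exact absurd this hwy
  have hc := h.chain
  simp only [List.concat_eq_append, List.append_assoc, List.cons_append, List.nil_append] at hc
  have hc' := hc.right_of_append
  simp only [List.isChain_cons_cons] at hc'
  cases e with
  | inl f => simp at hc'
  | inr e =>
    rcases List.eq_nil_or_concat s with rfl | ⟨s, u', rfl⟩
    · have := h.head; simp at this
    cases u' with
    | inl u' => exact ⟨s, t, u', e, by simp⟩
    | inr f =>
      simp only [List.concat_eq_append, List.append_assoc, List.cons_append, List.nil_append] at hc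
      have hc'' := hc.right_of_append
      simp at hc''

end PathCard

section Cluster

variable {V : Type*}

/-- Every nonempty set of vertices of `S` is touched by more than `(D - 1)|W|` hyperedges. -/
def DenseOn (H : Finset (Finset V)) (S : Finset V) (D : ℕ) : Prop :=
  ∀ W ⊆ S, W.Nonempty → (D - 1) * W.card < (H.filter fun e => ∃ w ∈ W, w ∈ e).card

theorem DenseOn.le_degree {H : Finset (Finset V)} {S : Finset V} {D : ℕ} (h : DenseOn H S D)
    {v : V} (hv : v ∈ S) : D ≤ (H.filter fun e => v ∈ e).card := by
  have := h {v} (by simpa using hv) (by simp)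
  simp at this
  omega

/-- A component of the incidence graph of `H` after deleting the vertex set `X`, no hyperedge
of which has been deleted. -/
structure IsCluster (H : Finset (Finset V)) (S X : Finset V) (K : Finset (Node V)) : Prop where
  conn : ∀ x ∈ K, ∀ y ∈ K, ConnIn (Inc H) K x y
  edge_mem : ∀ e, .inr e ∈ K → e ∈ H
  vert_mem : ∀ v, .inl v ∈ K → v ∈ S ∧ v ∉ X
  star : ∀ v e, .inl v ∈ K → e ∈ H → v ∈ e → .inr e ∈ K
  edge_sub : ∀ e v, .inr e ∈ K → v ∈ e → .inl v ∈ K ∨ v ∈ X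
  exists_vert : ∀ e, .inr e ∈ K → ∃ v ∈ e, .inl v ∈ K
  nonempty : ∃ v, .inl v ∈ K

/-- Apart from few hyperedges, those of `K` meet the outside of `K` only inside `Y \ Q`. -/
structure CoreBound (K : Finset (Node V)) (Y Q : Finset V) (F : Finset (Finset V)) : Prop where
  sub : Q ⊆ Y
  card_le : F.card ≤ Q.card
  edge_sub : ∀ e, .inr e ∈ K → e ∉ F → ∀ v ∈ e, .inl v ∈ K ∨ v ∈ Y \ Q

/-- A path between vertices inside `K` that avoids the hyperedge `f`. -/
structure KPath (H : Finset (Finset V)) (K : Finset (Node V)) (f : Finset V) (y x : V)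
    (l : List (Node V)) : Prop extends IsPathFromTo (Inc H) (.inl y) (.inl x) l where
  inK : ∀ n ∈ l, n ∈ K
  avoid : .inr f ∉ l

/-- A path of `KPath` of maximum length `m`. -/
structure LongestKPath (H : Finset (Finset V)) (K : Finset (Node V)) (f : Finset V) (y x : V)
    (l : List (Node V)) (m : ℕ) : Prop extends KPath H K f y x l where
  len : l.length = 2 * m + 1
  longest : ∀ x' l', KPath H K f y x' l' → l'.length ≤ 2 * m + 1

theorem exists_longestKPath {H : Finset (Finset V)} {K : Finset (Node V)} (f : Finset V) {y : V}
    (hy : .inl y ∈ K) : ∃ x l m, LongestKPath H K f y x l m := by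
  have hne : ∃ j, ∃ x l, KPath H K f y x l ∧ l.length = j :=
    ⟨1, y, [.inl y], ⟨.singleton _ _, by simpa using hy, by simp⟩, rfl⟩
  have hb : ∀ j, (∃ x l, KPath H K f y x l ∧ l.length = j) → j ≤ K.card := by
    rintro j ⟨x, l, hl, rfl⟩
    rw [← List.toFinset_card_of_nodup hl.nodup]
    exact Finset.card_le_card fun n hn => hl.inK n (by simpa using hn)
  obtain ⟨x, l, hl, hlen⟩ := Nat.findGreatest_spec (P := fun j => ∃ x l, KPath H K f y x l ∧
    l.length = j) (hb _ hne.choose_spec) hne.choose_spec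
  obtain ⟨m, hm⟩ := hl.exists_length
  refine ⟨x, l, m, hl, hm, fun x' l' hl' => ?_⟩
  rw [← hm, hlen]
  exact Nat.le_findGreatest (hb _ ⟨x', l', hl', rfl⟩) ⟨x', l', hl', rfl⟩

variable {H : Finset (Finset V)} {S X : Finset V} {K : Finset (Node V)} {f : Finset V} {y x : V}
  {l : List (Node V)} {m : ℕ}

theorem LongestKPath.mem_of_edge (hl : LongestKPath H K f y x l m) (hK : IsCluster H S X K)
    {g : Finset V} (hg : g ∈ H) (hxg : x ∈ g) (hgl : .inr g ∉ l) (hgf : g ≠ f) {w : V}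
    (hw : w ∈ g) (hwK : .inl w ∈ K) : .inl w ∈ l := by
  by_contra hwl
  have hgK : .inr g ∈ K := hK.star x g (hl.inK _ hl.last_mem) hg hxg
  have h1 : IsPathFromTo (Inc H) (.inr g) (.inl w) [.inr g, .inl w] :=
    ⟨⟨by simp [hg, hw], by simp⟩, rfl, rfl⟩
  have h2 := hl.toIsPathFromTo.append h1 ⟨hg, hxg⟩ (by
    intro n hn hn'
    simp at hn'
    rcases hn' with rfl | rfl
    exacts [hgl hn, hwl hn])
  have := hl.longest w _ ⟨h2, by
    intro n hn
    simp at hn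
    rcases hn with h | rfl | rfl
    exacts [hl.inK _ h, hgK, hwK], by
    simp [hl.avoid, Ne.symm hgf]⟩
  have := hl.len
  simp at *
  omega

/-- Rotating a longest path at its end. -/
theorem LongestKPath.rotate (hl : LongestKPath H K f y x l m) (hK : IsCluster H S X K)
    {l₁ l₂ : List (Node V)} {u w : V} {e : Finset V}
    (hd : l = l₁ ++ .inl u :: .inr e :: .inl w :: l₂)
    {g : Finset V} (hg : g ∈ H) (hug : u ∈ g) (hxg : x ∈ g) (hgl : .inr g ∉ l) (hgf : g ≠ f) :
    ∃ l', LongestKPath H K f y w l' m ∧ (∀ v, .inl v ∈ l' ↔ .inl v ∈ l) ∧ .inr e ∉ l' ∧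
      ∀ e', .inr e' ∈ l' → e' = g ∨ .inr e' ∈ l := by
  have hgK : .inr g ∈ K := hK.star x g (hl.inK _ hl.last_mem) hg hxg
  have hp : IsPathFromTo (Inc H) (.inl y) (.inl x)
      ((l₁ ++ [.inl u]) ++ ([.inr e] ++ (.inl w :: l₂))) := by
    simpa [hd] using hl.toIsPathFromTo
  have hnd := hp.nodup
  have h1 : IsPathFromTo (Inc H) (.inl y) (.inl u) (l₁ ++ [.inl u]) :=
    ⟨hp.toIsPathList.left_of_append, by
      have := hp.head; cases l₁ <;> simpa using this, by simp⟩
  have h2 : IsPathFromTo (Inc H) (.inl w) (.inl x) (.inl w :: l₂) :=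
    ⟨hp.toIsPathList.right_of_append.right_of_append, rfl, by
      have := hp.last; simpa using this⟩
  have h3 := h2.reverse (inc_symm H)
  have hgl' : .inr g ∉ l₁ ∧ g ≠ e ∧ .inr g ∉ l₂ := by
    rw [hd] at hgl
    simpa using hgl
  have hug' : Inc H (.inl u) (.inr g) := ⟨hg, hug⟩
  have hxg' : Inc H (.inr g) (.inl x) := ⟨hg, hxg⟩
  have h4 := (h1.append (IsPathFromTo.singleton _ (.inr g)) hug' (by
    intro n hn hn'
    simp at hn'
    subst hn'
    simp at hn
    exact hgl'.1 hn)).append h3 hxg' (by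
      intro n hn hn'
      rw [List.append_assoc] at hn
      simp only [List.mem_reverse, List.mem_append] at hn hn'
      rw [List.nodup_append'] at hnd
      rcases hn with h | h | h
      · exact hnd.2.2 (List.mem_append_left _ h) (List.mem_append_right _ hn')
      · exact hnd.2.2 (List.mem_append_right _ h) (List.mem_append_right _ hn')
      · simp at h
        subst h
        simp at hn'
        exact hgl'.2.2 hn')
  refine ⟨_, ⟨⟨h4, ?_, ?_⟩, ?_, hl.longest⟩, ?_, ?_, ?_⟩
  · intro n hn
    simp only [List.mem_append, List.mem_reverse, List.mem_singleton] at hn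
    rcases hn with ((h | h) | rfl) | h
    · exact hl.inK n (by rw [hd]; simp [h])
    · exact hl.inK n (by rw [hd]; simp [h])
    · exact hgK
    · exact hl.inK n (by rw [hd]; simp at h ⊢; tauto)
  · have := hl.avoid
    rw [hd] at this
    simp at this ⊢
    exact ⟨this.1, Ne.symm hgf, this.2.2⟩
  · have := hl.len
    rw [hd] at this
    simp at this ⊢
    omega
  · intro v
    rw [hd]
    simp
    tauto
  · simp at hnd ⊢
    have h5 := List.nodup_append'.1 hnd
    simp at h5
    refine ⟨fun h => ?_, Ne.symm hgl'.2.1, h5.2.1.2.1⟩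
    exact h5.2.2.2.1 h
  · intro e'
    rw [hd]
    simp
    tauto

end Cluster

section LemmaL

variable {V : Type*}

instance : LawfulBEq (Node V) where
  eq_of_beq {a b} h := by
    cases a <;> cases b <;> first | exact congrArg _ (eq_of_beq h) | cases h
  rfl {a} := by
    cases a
    · exact beq_self_eq_true (_ : V)
    · exact beq_self_eq_true (_ : Finset V)

theorem List.Nodup.getElem?_idxOf_add_one {α : Type*} [BEq α] [LawfulBEq α] {l₁ l₂ : List α}
    {n n' : α}
    (h : (l₁ ++ n :: n' :: l₂).Nodup) :
    (l₁ ++ n :: n' :: l₂)[(l₁ ++ n :: n' :: l₂).idxOf n + 1]? = some n' := by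
  have hn : n ∉ l₁ := by
    intro hn
    exact (List.nodup_append'.1 h).2.2 hn (by simp)
  rw [List.idxOf_append_of_notMem hn]
  simp

theorem List.Nodup.getElem?_idxOf_sub_one {α : Type*} [BEq α] [LawfulBEq α] {l₁ l₂ : List α}
    {n n' : α}
    (h : (l₁ ++ n :: n' :: l₂).Nodup) :
    (l₁ ++ n :: n' :: l₂)[(l₁ ++ n :: n' :: l₂).idxOf n' - 1]? = some n := by
  have hn : n' ∉ l₁ ++ [n] := by
    intro hn
    rw [show l₁ ++ n :: n' :: l₂ = (l₁ ++ [n]) ++ (n' :: l₂) by simp] at h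
    exact (List.nodup_append'.1 h).2.2 hn (by simp)
  rw [show l₁ ++ n :: n' :: l₂ = (l₁ ++ [n]) ++ (n' :: l₂) by simp,
    List.idxOf_append_of_notMem hn]
  simp

variable {H : Finset (Finset V)} {S X Y Q : Finset V} {F : Finset (Finset V)}
  {K : Finset (Node V)} {f : Finset V} {y x : V} {l : List (Node V)} {m r a : ℕ}

/-- In a `3`-uniform hypergraph few hyperedges of a path through `x` leave the path or
contain `v`. -/
theorem card_edges_through_le (hl : IsPathFromTo (Inc H) (.inl y) (.inl x) l) (v : V)
    {B : Finset (Finset V)}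
    (hB : ∀ e ∈ B, e.card = 3 ∧ .inr e ∈ l ∧ x ∈ e ∧ ∃ w ∈ e, w ≠ x ∧ (.inl w ∈ l → w = v)) :
    B.card ≤ 4 := by
  have hinj : Function.Injective fun e : Finset V => some (Sum.inr e : Node V) := by
    intro e e' h
    simpa using h
  rw [← Finset.card_image_of_injective B hinj]
  refine (Finset.card_le_card (t := {l[l.idxOf (.inl v) + 1]?, l[l.idxOf (.inl v) - 1]?,
    l[l.idxOf (.inl x) + 1]?, l[l.idxOf (.inl x) - 1]?}) ?_).trans Finset.card_le_four
  intro o ho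
  obtain ⟨e, he, rfl⟩ := Finset.mem_image.1 ho
  obtain ⟨hcard, hel, hxe, w', hw'e, hw'x, hw'v⟩ := hB e he
  obtain ⟨l₁, l₂, u, w, rfl, hu, hw⟩ := hl.edge_nbrs hel
  have hn := hl.nodup
  have huw : u ≠ w := by
    rintro rfl
    rw [List.nodup_append'] at hn
    simp at hn
  have hP := List.Nodup.getElem?_idxOf_add_one hn
  have hS := List.Nodup.getElem?_idxOf_sub_one (l₁ := l₁ ++ [.inl u]) (n := .inr e)
    (n' := .inl w) (l₂ := l₂) (by simpa using hn)
  simp only [List.append_assoc, List.cons_append, List.nil_append] at hS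
  simp only [Finset.mem_insert, Finset.mem_singleton]
  by_cases hux : u = x
  · subst hux; rw [hP]; simp
  by_cases hwx : w = x
  · subst hwx; rw [hS]; simp
  have hw'uw : w' = u ∨ w' = w := by
    by_contra hcon
    push Not at hcon
    have : ({x, u, w, w'} : Finset V) ⊆ e := by
      intro z hz
      simp at hz
      rcases hz with rfl | rfl | rfl | rfl <;> assumption
    have := Finset.card_le_card this
    rw [Finset.card_insert_of_notMem, Finset.card_insert_of_notMem, Finset.card_insert_of_notMem]
      at this
    · simp at this; omega
    · simp [hcon.2.symm]
    · simp [huw, hcon.1.symm]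
    · simp [Ne.symm hux, Ne.symm hwx, hw'x.symm]
  rcases hw'uw with rfl | rfl
  · have : w' = v := hw'v (by simp)
    subst this; rw [hP]; simp
  · have : w' = v := hw'v (by simp)
    subst this; rw [hS]; simp

theorem LongestKPath.exists_edge (hr : 3 ≤ r) (ha : r + 6 ≤ a) (hu : ∀ e ∈ H, e.card = r)
    (hD : DenseOn H S (a.choose (r - 1))) (hK : IsCluster H S X K) (hF : CoreBound K Y Q F)
    (hl : LongestKPath H K f y x l m) (hma : m + Y.card ≤ a) {v : V} (hv : .inl v ∈ l)
    (hvx : v ≠ x) : ∃ g ∈ H, .inr g ∉ l ∧ g ≠ f ∧ v ∈ g ∧ x ∈ g := by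
  by_contra hcon
  push Not at hcon
  set P := l.toFinset.toLeft with hP
  have hmP : ∀ w, w ∈ P ↔ .inl w ∈ l := by simp [hP]
  have hPc : P.card = m + 1 ∧ l.toFinset.toRight.card = m := hl.card_verts hl.len
  set Z := (P.erase x).erase v ∪ (Y \ Q) with hZ
  have hZc : Z.card ≤ (m - 1 + Y.card) - Q.card := by
    refine (Finset.card_union_le _ _).trans ?_
    rw [Finset.card_erase_of_mem (by simp [hmP, hv, hvx]),
      Finset.card_erase_of_mem (by simp [hmP, hl.last_mem]), hPc.1, Finset.card_sdiff_of_subset hF.sub]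
    have := Finset.card_le_card hF.sub
    omega
  have hm1 : 1 ≤ m := by
    have : 1 < P.card := Finset.one_lt_card.2 ⟨v, by simp [hmP, hv], x, by simp [hmP, hl.last_mem], hvx⟩
    omega
  set B := l.toFinset.toRight.filter fun e => e ∈ H ∧ x ∈ e ∧ ¬ e.erase x ⊆ Z with hB
  have hBc : B.card + 2 ≤ (a - 1).choose (r - 2) := by
    rcases Nat.eq_or_lt_of_le hr with h3 | h4
    · have := card_edges_through_le hl.toIsPathFromTo v (B := B) (by
        intro e he
        simp only [hB, Finset.mem_filter, Finset.mem_toRight, List.mem_toFinset] at he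
        refine ⟨(hu e he.2.1).trans h3.symm, he.1, he.2.2.1, ?_⟩
        obtain ⟨w, hw, hwZ⟩ := Finset.not_subset.1 he.2.2.2
        simp only [Finset.mem_erase] at hw
        refine ⟨w, hw.2, hw.1, fun hwl => ?_⟩
        by_contra hwv
        exact hwZ (by simp [hZ, hmP, hwl, hwv, hw.1]))
      have := eight_le_choose hr ha
      omega
    · have h1 : B.card ≤ m := hPc.2 ▸ Finset.card_filter_le _ _
      have := add_two_le_choose h4 ha
      omega
  have hxS : x ∈ S := (hK.vert_mem x (hl.inK _ hl.last_mem)).1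
  have hdeg := hD.le_degree hxS
  have hsub : (H.filter fun e => x ∈ e) ⊆
      {f} ∪ (B ∪ (F ∪ H.filter fun e => x ∈ e ∧ e.erase x ⊆ Z)) := by
    intro e he
    simp only [Finset.mem_filter] at he
    simp only [Finset.mem_union, Finset.mem_singleton, Finset.mem_filter, hB, Finset.mem_toRight,
      List.mem_toFinset]
    by_contra hne
    push Not at hne
    obtain ⟨h1, h2, h3, h4⟩ := hne
    have hel : .inr e ∉ l := fun hel => h4 he.1 he.2 (h2 hel he.1 he.2)
    refine h4 he.1 he.2 fun w hw => ?_
    simp only [Finset.mem_erase] at hw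
    have heK := hK.star x e (hl.inK _ hl.last_mem) he.1 he.2
    rcases hF.edge_sub e heK h3 w hw.2 with h | h
    · have hwl := hl.mem_of_edge hK he.1 he.2 hel h1 hw.2 h
      have hwv : w ≠ v := by
        rintro rfl
        exact hcon e he.1 hel h1 hw.2 he.2
      simp [hZ, hmP, hwl, hwv, hw.1]
    · exact Finset.mem_union_right _ h
  have hcard : (H.filter fun e => x ∈ e ∧ e.erase x ⊆ Z).card ≤ Z.card.choose (r - 1) :=
    card_le_choose_of_mem fun e he => by
      simp only [Finset.mem_filter] at he
      exact ⟨hu e he.1, he.2⟩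
  have h1 := Finset.card_le_card hsub
  have h2 := Finset.card_union_le {f} (B ∪ (F ∪ H.filter fun e => x ∈ e ∧ e.erase x ⊆ Z))
  have h3 := Finset.card_union_le B (F ∪ H.filter fun e => x ∈ e ∧ e.erase x ⊆ Z)
  have h4 := Finset.card_union_le F (H.filter fun e => x ∈ e ∧ e.erase x ⊆ Z)
  have h5 := Nat.choose_le_choose (r - 1) hZc
  have h6 := choose_sub_add_le (m := m - 1 + Y.card) (q := Q.card) hr ha (by omega)
    (by have := Finset.card_le_card hF.sub; omega)
  have h7 := choose_pred_add hr ha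
  have h8 := hF.card_le
  simp only [Finset.card_singleton] at h2
  omega

end LemmaL

section LemmaL

variable {V : Type*}

variable {H : Finset (Finset V)} {S X Y Q : Finset V} {F : Finset (Finset V)}
  {K : Finset (Node V)} {f : Finset V} {y x : V} {l : List (Node V)} {m r a : ℕ}

theorem LongestKPath.edge_sub_of_touch (hr : 3 ≤ r) (ha : r + 6 ≤ a) (hu : ∀ e ∈ H, e.card = r)
    (hD : DenseOn H S (a.choose (r - 1))) (hK : IsCluster H S X K) (hF : CoreBound K Y Q F)
    (hl : LongestKPath H K f y x l m) (hma : m + Y.card ≤ a) {e : Finset V} (he : e ∈ H)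
    (hef : e ≠ f) {w : V} (hwe : w ∈ e) (hwl : .inl w ∈ l) (hwy : w ≠ y) {z : V} (hz : z ∈ e)
    (hzK : .inl z ∈ K) : .inl z ∈ l := by
  have hlast : ∀ (l₁ l₂ : List (Node V)) (u w : V) (e : Finset V),
      l = l₁ ++ .inl u :: .inr e :: .inl w :: l₂ → .inl u ∈ l ∧ u ≠ x := by
    rintro l₁ l₂ u w e rfl
    refine ⟨by simp, ?_⟩
    rintro rfl
    have h1 := hl.last
    have h2 := hl.nodup
    rw [show l₁ ++ Sum.inl u :: Sum.inr e :: Sum.inl w :: l₂ =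
      (l₁ ++ [.inl u]) ++ (.inr e :: .inl w :: l₂) by simp] at h1 h2
    rw [List.getLast?_append_of_ne_nil _ (by simp)] at h1
    exact (List.nodup_append'.1 h2).2.2 (by simp) (List.mem_of_getLast? h1)
  by_cases hel : .inr e ∈ l
  · obtain ⟨l₁, l₂, u, w', hd, hue, hw'e⟩ := hl.edge_nbrs hel
    obtain ⟨hul, hux⟩ := hlast _ _ _ _ _ hd
    obtain ⟨g, hg, hgl, hgf, hug, hxg⟩ := hl.exists_edge hr ha hu hD hK hF hma hul hux
    obtain ⟨l', hl', h1, h2, -⟩ := hl.rotate hK hd hg hug hxg hgl hgf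
    exact (h1 z).1 (hl'.mem_of_edge hK he hw'e h2 hef hz hzK)
  · obtain ⟨l₁, l₂, u, e', hd⟩ := hl.pred_nbrs hwl hwy
    obtain ⟨hul, hux⟩ := hlast _ _ _ _ _ hd
    obtain ⟨g, hg, hgl, hgf, hug, hxg⟩ := hl.exists_edge hr ha hu hD hK hF hma hul hux
    obtain ⟨l', hl', h1, -, h2⟩ := hl.rotate hK hd hg hug hxg hgl hgf
    by_cases heg : e = g
    · subst heg
      exact hl.mem_of_edge hK he hxg hel hef hz hzK
    · exact (h1 z).1 (hl'.mem_of_edge hK he hwe (fun h => (h2 e h).elim heg hel) hef hz hzK)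

/-- In a cluster with a small core every vertex starts a long path, with one exception. -/
theorem exists_long_kPath (hr : 3 ≤ r) (ha : r + 6 ≤ a) (hu : ∀ e ∈ H, e.card = r)
    (hD : DenseOn H S (a.choose (r - 1))) (hK : IsCluster H S X K) (hYX : Y ⊆ X)
    (hF : CoreBound K Y Q F) (hY : Y.card + 1 ≤ a) (f : Finset V) (hy : .inl y ∈ K) :
    (∃ x l, KPath H K f y x l ∧ 2 * (a + 1 - Y.card) + 1 ≤ l.length) ∨
    (Y.card + 1 = a ∧ (∀ e, .inr e ∈ K → ∀ v ∈ e, .inl v ∈ K ∨ v ∈ Y) ∧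
      ∃ x, x ≠ y ∧ .inl x ∈ K ∧ ∀ e ∈ H, x ∈ e → e ≠ f → e ⊆ insert x (insert y Y)) := by
  obtain ⟨x, l, m, hl⟩ := exists_longestKPath (H := H) f hy
  by_cases hma : m + Y.card ≤ a
  swap
  · exact .inl ⟨x, l, hl.toKPath, by have := hl.len; omega⟩
  right
  set P := l.toFinset.toLeft with hP
  have hmP : ∀ w, w ∈ P ↔ .inl w ∈ l := by simp [hP]
  have hPc : P.card = m + 1 ∧ l.toFinset.toRight.card = m := hl.card_verts hl.len
  have hxl : .inl x ∈ l := hl.last_mem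
  have hyl : .inl y ∈ l := hl.head_mem
  have htouch := @LongestKPath.edge_sub_of_touch V H S X Y Q F K f y x l m r a hr ha hu hD hK hF hl
    hma
  have hKY : ∀ v, .inl v ∈ K → v ∉ Y := fun v hv hvY => (hK.vert_mem v hv).2 (hYX hvY)
  have hx : ∀ e ∈ H, x ∈ e → e ≠ f → ∀ z ∈ e, .inl z ∈ K → .inl z ∈ l := by
    intro e he hxe hef z hz hzK
    by_cases hel : .inr e ∈ l
    · have hxy : x ≠ y := by
        rintro rfl
        have h0 : m = 0 := by
          obtain ⟨t, ht⟩ := hl.eq_cons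
          have h1 := hl.last
          have h2 := hl.nodup
          rw [ht] at h1 h2
          rcases t with _ | ⟨b, t⟩
          · have := hl.len
            rw [ht] at this
            simpa using this
          · rw [List.getLast?_cons_cons] at h1
            exact absurd (List.mem_of_getLast? h1) (List.nodup_cons.1 h2).1
        rw [h0, Finset.card_eq_zero] at hPc
        have : e ∈ l.toFinset.toRight := by simpa using hel
        simp [hPc.2] at this
      exact htouch he hef hxe hxl hxy hz hzK
    · exact hl.mem_of_edge hK he hxe hel hef hz hzK
  have hxS : x ∈ S := (hK.vert_mem x (hl.inK _ hl.last_mem)).1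
  have hdeg := hD.le_degree hxS
  set Z := P.erase x ∪ (Y \ Q) with hZ
  have hQc := Finset.card_le_card hF.sub
  have hZc : Z.card ≤ (m + Y.card) - Q.card := by
    refine (Finset.card_union_le _ _).trans ?_
    rw [Finset.card_erase_of_mem (by simp [hmP, hl.last_mem]), hPc.1,
      Finset.card_sdiff_of_subset hF.sub]
    omega
  have hsub : (H.filter fun e => x ∈ e) ⊆
      {f} ∪ (F ∪ H.filter fun e => x ∈ e ∧ e.erase x ⊆ Z) := by
    intro e he
    simp only [Finset.mem_filter] at he
    simp only [Finset.mem_union, Finset.mem_singleton, Finset.mem_filter]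
    by_contra hne
    push Not at hne
    obtain ⟨h1, h3, h4⟩ := hne
    refine h4 he.1 he.2 fun w hw => ?_
    simp only [Finset.mem_erase] at hw
    have heK := hK.star x e (hl.inK _ hl.last_mem) he.1 he.2
    rcases hF.edge_sub e heK h3 w hw.2 with h | h
    · have hwl := hx e he.1 he.2 h1 w hw.2 h
      simp [hZ, hmP, hwl, hw.1]
    · exact Finset.mem_union_right _ h
  have hcard : (H.filter fun e => x ∈ e ∧ e.erase x ⊆ Z).card ≤ Z.card.choose (r - 1) :=
    card_le_choose_of_mem fun e he => by
      simp only [Finset.mem_filter] at he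
      exact ⟨hu e he.1, he.2⟩
  have h1 := Finset.card_le_card hsub
  have h2 := Finset.card_union_le {f} (F ∪ H.filter fun e => x ∈ e ∧ e.erase x ⊆ Z)
  have h4 := Finset.card_union_le F (H.filter fun e => x ∈ e ∧ e.erase x ⊆ Z)
  have h5 := Nat.choose_le_choose (r - 1) hZc
  have h7 := choose_pred_add hr ha
  have h8 := hF.card_le
  have h9 := eight_le_choose hr ha
  simp only [Finset.card_singleton] at h2
  have hQ0 : Q.card = 0 := by
    by_contra hq
    have h6 := choose_sub_add_le (m := a - 1) (q := Q.card - 1) hr ha le_rfl (by omega)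
    have h10 : ((m + Y.card) - Q.card).choose (r - 1) ≤
      (a - 1 - (Q.card - 1)).choose (r - 1) := Nat.choose_le_choose _ (by omega)
    omega
  have hma' : m + Y.card = a := by
    by_contra hne
    have h10 : ((m + Y.card) - Q.card).choose (r - 1) ≤ (a - 1).choose (r - 1) :=
      Nat.choose_le_choose _ (by omega)
    omega
  have hQ : Q = ∅ := Finset.card_eq_zero.1 hQ0
  have hF0 : F = ∅ := Finset.card_eq_zero.1 (by omega)
  subst hQ hF0
  have hKsub : ∀ e, .inr e ∈ K → ∀ v ∈ e, .inl v ∈ K ∨ v ∈ Y := by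
    intro e he v hv
    simpa using hF.edge_sub e he (by simp) v hv
  have hm1 : m = 1 := by
    by_contra hm1
    set W := P.erase y with hW
    have hWc : W.card = m := by
      rw [hW, Finset.card_erase_of_mem (by simpa [hmP] using hyl), hPc.1]; rfl
    have hd := hD W (fun w hw => (hK.vert_mem w (hl.inK _ (by
      simp only [hW, Finset.mem_erase, hmP] at hw
      exact hw.2))).1) (Finset.card_pos.1 (by omega))
    have hcnt := card_add_choose_le (F := (H.filter fun e => ∃ w ∈ W, w ∈ e).erase f) (r := r)
      (Z := P ∪ Y) (Z₀ := insert y Y) (by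
        intro z hz
        simp only [Finset.mem_insert] at hz
        rcases hz with rfl | hz
        · simp [hmP, hyl]
        · simp [hz]) (by
        intro e he
        simp only [Finset.mem_erase, Finset.mem_filter] at he
        obtain ⟨hef, heH, w, hwW, hwe⟩ := he
        simp only [hW, Finset.mem_erase, hmP] at hwW
        have hwK := hl.inK _ hwW.2
        refine ⟨hu e heH, fun z hz => ?_, fun hsub => ?_⟩
        · rcases hKsub e (hK.star w e hwK heH hwe) z hz with h | h
          · simp [hmP, htouch heH hef hwe hwW.2 hwW.1 hz h]
          · simp [h]
        · have := hsub hwe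
          simp only [Finset.mem_insert] at this
          exact this.elim hwW.1 (hKY w hwK))
    have hc1 : (P ∪ Y).card ≤ a + 1 := by
      have := Finset.card_union_le P Y
      omega
    have hc2 : (insert y Y).card = a + 1 - m := by
      rw [Finset.card_insert_of_notMem (hKY y hy)]
      omega
    have hc3 := Nat.choose_le_choose r hc1
    have hc4 := Finset.pred_card_le_card_erase (s := H.filter fun e => ∃ w ∈ W, w ∈ e) (a := f)
    have hc5 := choose_lt_of_two_le (l := m) hr ha (by omega) (by omega)
    rw [hc2] at hcnt
    rw [hWc] at hd
    omega
  have hxy : x ≠ y := by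
    rintro rfl
    have h11 := hl.len
    obtain ⟨t, ht⟩ := hl.eq_cons
    have h1 := hl.last
    have h2 := hl.nodup
    rw [ht] at h1 h2 h11
    rcases t with _ | ⟨b, t⟩
    · simp at h11; omega
    · rw [List.getLast?_cons_cons] at h1
      exact absurd (List.mem_of_getLast? h1) (List.nodup_cons.1 h2).1
  have hPxy : P = {x, y} := by
    refine (Finset.eq_of_subset_of_card_le (fun z hz => ?_) ?_).symm
    · simp only [Finset.mem_insert, Finset.mem_singleton] at hz
      rcases hz with rfl | rfl
      exacts [(hmP _).2 hxl, (hmP _).2 hyl]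
    · rw [Finset.card_pair hxy]; omega
  refine ⟨by omega, hKsub, x, hxy, hl.inK _ hxl, fun e he hxe hef z hz => ?_⟩
  rcases hKsub e (hK.star x e (hl.inK _ hxl) he hxe) z hz with h | h
  · have := (hmP z).2 (hx e he hxe hef z hz h)
    rw [hPxy] at this
    simp at this ⊢
    tauto
  · simp [h]

end LemmaL

section LemmaL

variable {V : Type*}

variable {H : Finset (Finset V)} {S X Y Q : Finset V} {F : Finset (Finset V)}
  {K : Finset (Node V)} {r a : ℕ}

theorem exists_mem_of_card {α : Type*} {s t : Finset α} {j : ℕ} (ht : t.card ≤ j)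
    (hs : j < s.card) : ∃ e ∈ s, e ∉ t :=
  Finset.not_subset.1 fun h => by have := Finset.card_le_card h; omega

/-- A vertex of the core of a cluster can be prolonged by a long path of the cluster. -/
theorem exists_long_kPath_of_hub (hr : 3 ≤ r) (ha : r + 6 ≤ a) (hu : ∀ e ∈ H, e.card = r)
    (hD : DenseOn H S (a.choose (r - 1))) (hK : IsCluster H S X K) (hYX : Y ⊆ X)
    (hF : CoreBound K Y Q F) (hY : Y.card + 1 ≤ a) {h : V} (hh : h ∈ Y) {e₀ : Finset V}
    (he₀ : .inr e₀ ∈ K) (hhe₀ : h ∈ e₀) :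
    ∃ f y x l, .inr f ∈ K ∧ h ∈ f ∧ y ∈ f ∧ KPath H K f y x l ∧
      2 * (a + 1 - Y.card) + 1 ≤ l.length := by
  obtain ⟨y, hye₀, hy⟩ := hK.exists_vert e₀ he₀
  rcases exists_long_kPath hr ha hu hD hK hYX hF hY e₀ hy with
    ⟨x, l, hl, hlen⟩ | ⟨hYa, hKsub, x, hxy, hx, hxsub⟩
  · exact ⟨e₀, y, x, l, he₀, hhe₀, hye₀, hl, hlen⟩
  have hKY : ∀ v, .inl v ∈ K → v ∉ Y := fun v hv hvY => (hK.vert_mem v hv).2 (hYX hvY)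
  have hdeg := hD.le_degree (hK.vert_mem x hx).1
  have h7 := choose_pred_add hr ha
  have h9 := eight_le_choose hr ha
  have hpred : a - 1 = Y.card := by omega
  obtain ⟨e₁, he₁, he₁'⟩ := exists_mem_of_card (j := (a - 1).choose (r - 1) + 1)
    (s := H.filter fun e => x ∈ e)
    (t := (H.filter fun e => x ∈ e ∧ e.erase x ⊆ insert y (Y.erase h)) ∪ {e₀}) (by
      refine (Finset.card_union_le _ _).trans ?_
      simp only [Finset.card_singleton, Nat.add_le_add_iff_right]
      refine (card_le_choose_of_mem (x := x) (Z := insert y (Y.erase h)) fun e he => by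
        simp only [Finset.mem_filter] at he
        exact ⟨hu e he.1, he.2⟩).trans (Nat.choose_le_choose _ ?_)
      have := Finset.card_insert_le y (Y.erase h)
      rw [Finset.card_erase_of_mem hh] at this
      omega) (by omega)
  simp only [Finset.mem_filter, Finset.mem_union, Finset.mem_singleton] at he₁ he₁'
  push Not at he₁'
  have hhe₁ : h ∈ e₁ := by
    by_contra hne
    refine he₁'.1 he₁.1 he₁.2 fun z hz => ?_
    simp only [Finset.mem_erase] at hz
    have := hxsub e₁ he₁.1 he₁.2 he₁'.2 hz.2
    simp only [Finset.mem_insert, Finset.mem_erase] at this ⊢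
    have : z ≠ h := by rintro rfl; exact hne hz.2
    tauto
  obtain ⟨e₂, he₂, he₂'⟩ := exists_mem_of_card (j := (a - 1).choose (r - 1) + 2)
    (s := H.filter fun e => x ∈ e)
    (t := (H.filter fun e => x ∈ e ∧ e.erase x ⊆ Y) ∪ {e₀, e₁}) (by
      refine (Finset.card_union_le _ _).trans (Nat.add_le_add ?_ Finset.card_le_two)
      rw [hpred]
      exact card_le_choose_of_mem fun e he => by
        simp only [Finset.mem_filter] at he
        exact ⟨hu e he.1, he.2⟩) (by omega)
  simp only [Finset.mem_filter, Finset.mem_union, Finset.mem_singleton, Finset.mem_insert]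
    at he₂ he₂'
  push Not at he₂'
  have hye₂ : y ∈ e₂ := by
    by_contra hne
    refine he₂'.1 he₂.1 he₂.2 fun z hz => ?_
    simp only [Finset.mem_erase] at hz
    have := hxsub e₂ he₂.1 he₂.2 he₂'.2.1 hz.2
    simp only [Finset.mem_insert] at this
    have : z ≠ y := by rintro rfl; exact hne hz.2
    tauto
  have hd := hD {x, y} (by
    intro z hz
    simp only [Finset.mem_insert, Finset.mem_singleton] at hz
    rcases hz with rfl | rfl
    exacts [(hK.vert_mem _ hx).1, (hK.vert_mem _ hy).1]) ⟨x, by simp⟩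
  rw [Finset.card_pair hxy] at hd
  have hc1 : (H.filter fun e => x ∈ e ∧ e.erase x ⊆ insert y Y).card ≤ a.choose (r - 1) :=
    (card_le_choose_of_mem (x := x) (Z := insert y Y) fun e he => by
      simp only [Finset.mem_filter] at he
      exact ⟨hu e he.1, he.2⟩).trans
      (Nat.choose_le_choose _ ((Finset.card_insert_le _ _).trans hYa.le))
  have hc2 : (H.filter fun e => y ∈ e ∧ e.erase y ⊆ Y).card ≤ (a - 1).choose (r - 1) := by
    rw [hpred]
    exact card_le_choose_of_mem fun e he => by
      simp only [Finset.mem_filter] at he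
      exact ⟨hu e he.1, he.2⟩
  obtain ⟨g, hg, hg'⟩ := exists_mem_of_card
    (s := H.filter fun e => ∃ w ∈ ({x, y} : Finset V), w ∈ e)
    (j := a.choose (r - 1) + (a - 1).choose (r - 1) + 1)
    (t := ((H.filter fun e => x ∈ e ∧ e.erase x ⊆ insert y Y) ∪
      H.filter fun e => y ∈ e ∧ e.erase y ⊆ Y) ∪ {e₀}) (by
      refine (Finset.card_union_le _ _).trans (Nat.add_le_add ?_ (by simp))
      exact (Finset.card_union_le _ _).trans (Nat.add_le_add hc1 hc2)) (by omega)
  simp only [Finset.mem_filter, Finset.mem_union, Finset.mem_singleton, Finset.mem_insert]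
    at hg hg'
  push Not at hg'
  obtain ⟨⟨hg1, hg2⟩, hg3⟩ := hg'
  obtain ⟨hgH, hgt⟩ := hg
  have hxg : x ∉ g := by
    intro hxg
    refine hg1 hgH hxg fun z hz => ?_
    simp only [Finset.mem_erase] at hz
    have := hxsub g hgH hxg hg3 hz.2
    simp only [Finset.mem_insert] at this ⊢
    tauto
  have hyg : y ∈ g := by
    obtain ⟨w, rfl | rfl, hw⟩ := hgt
    exacts [absurd hw hxg, hw]
  obtain ⟨w, hwg, hwY⟩ := Finset.not_subset.1 (hg2 hgH hyg)
  simp only [Finset.mem_erase] at hwg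
  have hgK := hK.star y g hy hgH hyg
  have hwK : .inl w ∈ K := (hKsub g hgK w hwg.2).resolve_right hwY
  have hxe : ∀ e, x ∈ e → e ≠ g := by
    rintro e he rfl
    exact hxg he
  have hwx : w ≠ x := by
    rintro rfl
    exact hxg hwg.2
  refine ⟨e₁, x, w, [.inl x, .inr e₂, .inl y, .inr g, .inl w], hK.star x e₁ hx he₁.1 he₁.2, hhe₁,
    he₁.2, ⟨⟨⟨?_, ?_⟩, rfl, rfl⟩, ?_, ?_⟩, ?_⟩
  · simp [he₂, hye₂, hgH, hyg, hwg]
  · simp [hxy, hxe e₂ he₂.2, hwg.1.symm, hwx.symm]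
  · simp [hx, hy, hwK, hgK, hK.star x e₂ hx he₂.1 he₂.2]
  · simp [he₂'.2.2.symm, hxe e₁ he₁.2]
  · simp; omega

end LemmaL

section HubPath

/-- Concatenation of two paths that share only the common end. -/
theorem IsPathFromTo.join {N : Type*} {adj : N → N → Prop} {a b c : N} {l₁ l₂ : List N}
    (h₁ : IsPathFromTo adj a b l₁) (h₂ : IsPathFromTo adj b c l₂)
    (hd : ∀ x ∈ l₁, x ∈ l₂ → x = b) :
    ∃ l, IsPathFromTo adj a c l ∧ l.length + 1 = l₁.length + l₂.length ∧
      ∀ x, x ∈ l ↔ x ∈ l₁ ∨ x ∈ l₂ := by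
  obtain ⟨t, rfl⟩ := h₂.eq_cons
  have hbt := List.nodup_cons.1 h₂.nodup
  refine ⟨l₁ ++ t, ⟨⟨?_, ?_⟩, ?_, ?_⟩, by simp; omega, ?_⟩
  · refine h₁.chain.append (List.IsChain.tail h₂.chain) fun x hx z hz => ?_
    rw [h₁.last, Option.mem_some_iff] at hx
    subst hx
    cases t with
    | nil => simp at hz
    | cons z' t =>
      simp at hz
      subst hz
      exact (List.isChain_cons_cons.1 h₂.chain).1
  · refine List.nodup_append'.2 ⟨h₁.nodup, hbt.2, fun x hx hx' => ?_⟩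
    have := hd x hx (by simp [hx'])
    subst this
    exact hbt.1 hx'
  · obtain ⟨s, rfl⟩ := h₁.eq_cons
    simp
  · have := h₂.last
    cases t with
    | nil => simp at this; subst this; simp [h₁.last]
    | cons z t => rw [List.getLast?_cons_cons] at this; simp [this]
  · intro x
    have := h₁.last_mem
    simp
    constructor
    · tauto
    · rintro (h | rfl | h)
      exacts [.inl h, .inl this, .inr h]

variable {V : Type*} {H : Finset (Finset V)}

/-- `h` and `h'` are joined by a path through `m` of Berge-length at least two. -/
structure IsMid (H : Finset (Finset V)) (h h' : V) (m : List (Node V)) : Prop where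
  path : IsPathList (Inc H) (.inl h :: (m ++ [.inl h']))
  len : 3 ≤ m.length

/-- Connections between `h` and `h'` exist robustly: any `M` nodes can be avoided. -/
def Strong (H : Finset (Finset V)) (M : ℕ) (h h' : V) : Prop :=
  ∀ Z : Finset (Node V), Z.card ≤ M → ∃ m, IsMid H h h' m ∧ ∀ n ∈ m, n ∉ Z

theorem Strong.symm {M : ℕ} {h h' : V} (hs : Strong H M h h') : Strong H M h' h := by
  intro Z hZ
  obtain ⟨m, hm, hmZ⟩ := hs Z hZ
  exact ⟨m.reverse, ⟨by simpa using hm.path.reverse (inc_symm H), by simpa using hm.len⟩,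
    by simpa using hmZ⟩

theorem Strong.exists_pendant {M : ℕ} {h h' : V} (hs : Strong H M h h') {Z : Finset (Node V)}
    (hZ : Z.card ≤ M) : ∃ e ∈ H, ∃ w ∈ e, h ∈ e ∧ .inr e ∉ Z ∧ .inl w ∉ Z := by
  obtain ⟨m, hm, hmZ⟩ := hs Z hZ
  have hc := hm.path.chain
  match m, hm.len with
  | n₁ :: n₂ :: n₃ :: t, _ =>
    simp only [List.cons_append, List.isChain_cons_cons] at hc
    rcases n₁ with v | e
    · simp at hc
    rcases n₂ with w | e'
    · simp at hc
      exact ⟨e, hc.1.1, w, hc.2.1.2, hc.1.2, hmZ _ (by simp), hmZ _ (by simp)⟩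
    · simp at hc

theorem exists_hub_path {L M : ℕ} (hL : ∀ l, IsPathList (Inc H) l → l.length ≤ L) :
    ∀ (hs : List V) (h₀ h' : V) (Z : Finset (Node V)), (h₀ :: hs).Nodup →
      (h₀ :: hs).getLast? = some h' → (∀ u ∈ h₀ :: hs, ∀ v ∈ h₀ :: hs, u ≠ v → Strong H M u v) →
      Z.card + (hs.length + 1) * (L + 1) ≤ M →
      ∃ l, IsPathFromTo (Inc H) (.inl h₀) (.inl h') l ∧ 4 * hs.length + 1 ≤ l.length ∧
        ∀ n ∈ l, n ∉ Z ∨ ∃ h ∈ h₀ :: hs, n = .inl h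
  | [], h₀, h', Z, _, hlast, _, _ => by
    simp at hlast
    subst hlast
    exact ⟨_, .singleton _ _, by simp, by simp⟩
  | h₁ :: t, h₀, h', Z, hnd, hlast, hst, hM => by
    rw [List.nodup_cons] at hnd
    have hcard := Finset.card_insert_le (Sum.inl h₀) Z
    simp only [List.length_cons, add_mul, one_mul] at hM
    obtain ⟨l, hl, hlen, hlZ⟩ := exists_hub_path hL t h₁ h' (insert (.inl h₀) Z) hnd.2
      (by rwa [List.getLast?_cons_cons] at hlast)
      (fun u hu v hv => hst u (List.mem_cons_of_mem _ hu) v (List.mem_cons_of_mem _ hv))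
      (by simp only [add_mul, one_mul]; omega)
    have hh₀ : .inl h₀ ∉ l := by
      intro h
      rcases hlZ _ h with h | ⟨u, hu, h⟩
      · simp at h
      · simp only [Sum.inl.injEq] at h
        subst h
        exact hnd.1 hu
    have hll := hL l hl.toIsPathList
    obtain ⟨m, hm, hmZ⟩ := hst h₀ (by simp) h₁ (by simp) (by rintro rfl; simp at hnd)
      (Z ∪ l.toFinset) (by
        have h1 := Finset.card_union_le Z l.toFinset
        have h2 := List.toFinset_card_le l
        omega)
    have hp : IsPathFromTo (Inc H) (.inl h₀) (.inl h₁) (.inl h₀ :: (m ++ [.inl h₁])) :=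
      ⟨hm.path, rfl, by rw [← List.cons_append, List.getLast?_concat]⟩
    obtain ⟨l', hl', hlen', hmem⟩ := hp.join hl (by
      intro n hn hnl
      simp only [List.mem_cons, List.mem_append, List.not_mem_nil, or_false] at hn
      rcases hn with rfl | hn | rfl
      · exact absurd hnl hh₀
      · exact absurd (by simp [hnl]) (hmZ n hn)
      · rfl)
    refine ⟨l', hl', ?_, fun n hn => ?_⟩
    · have := hm.len
      simp at hlen' ⊢
      omega
    · rcases (hmem n).1 hn with h | h
      · simp only [List.mem_cons, List.mem_append, List.not_mem_nil, or_false] at h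
        rcases h with rfl | h | rfl
        · exact .inr ⟨h₀, by simp, rfl⟩
        · exact .inl fun hZ => hmZ n h (by simp [hZ])
        · exact .inr ⟨h₁, by simp, rfl⟩
      · rcases hlZ n h with h | ⟨u, hu, h⟩
        · exact .inl fun hZ => h (by simp [hZ])
        · exact .inr ⟨u, List.mem_cons_of_mem _ hu, h⟩

/-- A path through all vertices of a robustly connected set `A`. -/
theorem exists_hub_path_finset {L M : ℕ} (hL : ∀ l, IsPathList (Inc H) l → l.length ≤ L)
    {A : Finset V} (hA : ∀ u ∈ A, ∀ v ∈ A, u ≠ v → Strong H M u v) {h h' : V} (hh : h ∈ A)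
    (hh' : h' ∈ A) (hne : h ≠ h' ∨ A = {h}) {Z : Finset (Node V)}
    (hM : Z.card + A.card * (L + 1) ≤ M) :
    ∃ l, IsPathFromTo (Inc H) (.inl h) (.inl h') l ∧ 4 * A.card ≤ l.length + 3 ∧
        ∀ n ∈ l, n ∉ Z ∨ ∃ u ∈ A, n = .inl u := by
  by_cases hhh : h = h'
  · subst hhh
    have hA1 : A = {h} := hne.resolve_left (by simp)
    subst hA1
    exact ⟨_, .singleton _ _, by simp, by simp⟩
  · have hmem : ∀ u, u ∈ h :: (((A.erase h).erase h').toList ++ [h']) ↔ u ∈ A := by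
      intro u
      simp only [List.mem_cons, List.mem_append, Finset.mem_toList, Finset.mem_erase,
        List.not_mem_nil, or_false]
      constructor
      · rintro (rfl | h | rfl)
        exacts [hh, h.2.2, hh']
      · tauto
    have hcard : ((A.erase h).erase h').toList.length + 2 = A.card := by
      rw [Finset.length_toList, Finset.card_erase_of_mem (by simp [hh', Ne.symm hhh]),
        Finset.card_erase_of_mem hh]
      have := Finset.one_lt_card.2 ⟨h, hh, h', hh', hhh⟩
      omega
    obtain ⟨l, hl, hlen, hlZ⟩ := exists_hub_path (M := M) hL
      (((A.erase h).erase h').toList ++ [h']) h h' Z (by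
        rw [List.nodup_cons, List.nodup_append']
        simp [hhh, Finset.nodup_toList]) (by
        rw [← List.cons_append, List.getLast?_concat]) (by
        intro u hu v hv
        exact hA u ((hmem u).1 hu) v ((hmem v).1 hv)) (by
        simp only [List.length_append, List.length_singleton]
        rw [show ((A.erase h).erase h').toList.length + 1 + 1 = A.card by omega]
        exact hM)
    refine ⟨l, hl, by simp only [List.length_append, List.length_singleton] at hlen; omega,
      fun n hn => (hlZ n hn).imp id ?_⟩
    rintro ⟨u, hu, rfl⟩
    exact ⟨u, (hmem u).1 hu, rfl⟩

end HubPath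

section Glue

variable {V : Type*} {H H' : Finset (Finset V)}

/-- Two paths ending in a robustly connected set `A` extend to a path through all of `A`. -/
theorem exists_glued_path {L M : ℕ} (hL : ∀ l, IsPathList (Inc H) l → l.length ≤ L)
    {A : Finset V} (hA : ∀ u ∈ A, ∀ v ∈ A, u ≠ v → Strong H M u v) {h₁ h₂ : V} (hh₁ : h₁ ∈ A)
    (hh₂ : h₂ ∈ A) (hne : h₁ ≠ h₂ ∨ A = {h₁}) (hM : (A.card + 2) * (L + 1) ≤ M)
    {n₁ n₂ : Node V} {t₁ t₂ : List (Node V)} (ht₁ : IsPathFromTo (Inc H) n₁ (.inl h₁) t₁)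
    (ht₂ : IsPathFromTo (Inc H) (.inl h₂) n₂ t₂) (hA₁ : ∀ u ∈ A, .inl u ∈ t₁ → u = h₁)
    (hA₂ : ∀ u ∈ A, .inl u ∈ t₂ → u = h₂)
    (hd : ∀ x ∈ t₁, x ∈ t₂ → x = .inl h₁ ∧ x = .inl h₂) :
    ∃ l, IsPathFromTo (Inc H) n₁ n₂ l ∧ t₁.length + t₂.length + 4 * A.card ≤ l.length + 5 := by
  obtain ⟨l, hl, hlen, hlZ⟩ := exists_hub_path_finset hL hA hh₁ hh₂ hne
    (Z := (t₁ ++ t₂).toFinset) (by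
      have h1 := List.toFinset_card_le (t₁ ++ t₂)
      have h2 := hL _ ht₁.toIsPathList
      have h3 := hL _ ht₂.toIsPathList
      simp only [List.length_append] at h1
      rw [add_mul] at hM
      omega)
  have hl₁ : ∀ x ∈ t₁, x ∈ l → x = .inl h₁ := by
    intro x hx hxl
    rcases hlZ x hxl with h | ⟨u, hu, rfl⟩
    · simp [hx] at h
    · rw [hA₁ u hu hx]
  have hl₂ : ∀ x ∈ l, x ∈ t₂ → x = .inl h₂ := by
    intro x hxl hx
    rcases hlZ x hxl with h | ⟨u, hu, rfl⟩
    · simp [hx] at h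
    · rw [hA₂ u hu hx]
  obtain ⟨l', hl', hlen', hmem'⟩ := ht₁.join hl hl₁
  obtain ⟨l'', hl'', hlen'', -⟩ := hl'.join ht₂ (by
    intro x hx hxt
    rcases (hmem' x).1 hx with h | h
    · exact (hd x h hxt).2
    · exact hl₂ x h hxt)
  exact ⟨l'', hl'', by omega⟩

theorem isPathFromTo_head_vertex {K : Finset (Node V)} {a b : Node V} {l : List (Node V)}
    (hl : IsPathFromTo (Inc H) a b l) (hK : ∀ e, .inr e ∈ K → ∀ v ∈ e, .inl v ∈ K) (ha : a ∈ K)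
    (hb : b ∉ K) (ht : ∀ x ∈ l.tail, x ∉ K) : ∃ y, a = .inl y := by
  rcases a with y | e
  · exact ⟨y, rfl⟩
  obtain ⟨t, rfl⟩ := hl.eq_cons
  match t with
  | [] =>
    have := hl.last
    simp at this
    subst this
    exact absurd ha hb
  | .inr f :: t' => simpa using hl.chain
  | .inl v :: t' =>
    have := hl.chain
    simp at this
    exact absurd (hK e ha v this.1.2) (ht _ (by simp))

variable {S X : Finset V} {K₁ K₂ : Finset (Node V)} {r a k : ℕ}

theorem false_of_isolated_clusters [Fintype V] (hr : 3 ≤ r) (ha : r + 6 ≤ a)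
    (hu : ∀ e ∈ H', e.card = r) (hD : DenseOn H' S (a.choose (r - 1))) (hsub : H' ⊆ H)
    (hconn : HConnected H) (hH : IsEmpty (BergePath H k)) (hk : k ≤ 2 * a + 2)
    (hK₁ : IsCluster H' S X K₁) (hK₂ : IsCluster H' S X K₂) (hd : Disjoint K₁ K₂)
    (h₁ : CoreBound K₁ ∅ ∅ ∅) (h₂ : CoreBound K₂ ∅ ∅ ∅) : False := by
  have hcl : ∀ {K : Finset (Node V)}, CoreBound K ∅ ∅ ∅ → ∀ e, .inr e ∈ K → ∀ v ∈ e,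
      .inl v ∈ K := by
    intro K h e he v hv
    simpa using h.edge_sub e he (by simp) v hv
  have htail : ∀ {K : Finset (Node V)} {y : V}, IsCluster H' S X K → CoreBound K ∅ ∅ ∅ →
      .inl y ∈ K → ∃ x l, IsPathFromTo (Inc H) (.inl y) (.inl x) l ∧ (∀ n ∈ l, n ∈ K) ∧
        2 * (a + 1) + 1 ≤ l.length := by
    intro K y hK h hy
    rcases exists_long_kPath hr ha hu hD hK (by simp) h (by simp; omega) ∅ hy with
      ⟨x, l, hl, hlen⟩ | h
    · exact ⟨x, l, hl.toIsPathFromTo.mono (Inc.mono hsub), hl.inK, by simpa using hlen⟩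
    · simp at h
      omega
  obtain ⟨v₁, hv₁⟩ := hK₁.nonempty
  obtain ⟨v₂, hv₂⟩ := hK₂.nonempty
  obtain ⟨l₀, hl₀⟩ := exists_path_of_hConnected hconn v₁ v₂
  obtain ⟨n₁, n₂, l, hl, hn₁, hn₂, ht, hd'⟩ :=
    exists_path_between (P := (· ∈ K₁)) (Q := (· ∈ K₂)) hl₀ hv₁ hv₂
  rw [Finset.disjoint_left] at hd
  obtain ⟨y₁, rfl⟩ := isPathFromTo_head_vertex hl (hcl h₁) hn₁ (fun h => hd h hn₂) ht
  obtain ⟨y₂, rfl⟩ := isPathFromTo_head_vertex (hl.reverse (inc_symm H)) (hcl h₂) hn₂ (hd hn₁)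
    (by rw [List.tail_reverse]; simpa using hd')
  obtain ⟨x₁, l₁, hl₁, hlK₁, hlen₁⟩ := htail hK₁ h₁ hn₁
  obtain ⟨x₂, l₂, hl₂, hlK₂, hlen₂⟩ := htail hK₂ h₂ hn₂
  obtain ⟨p, hp, hplen, hpmem⟩ := (hl₁.reverse (inc_symm H)).join hl (by
    intro x hx hxl
    obtain ⟨t, rfl⟩ := hl.eq_cons
    rw [List.mem_reverse] at hx
    rcases List.mem_cons.1 hxl with rfl | hxl
    · rfl
    · exact absurd (hlK₁ x hx) (ht x hxl))
  obtain ⟨q, hq, hqlen, -⟩ := hp.join hl₂ (by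
    intro x hx hxl
    rcases (hpmem x).1 hx with h | h
    · exact absurd (hlK₂ x hxl) (hd (hlK₁ x (by simpa using h)))
    · obtain ⟨t, rfl⟩ := hl.eq_concat
      rw [List.dropLast_concat] at hd'
      rcases List.mem_append.1 h with h | h
      · exact absurd (hlK₂ x hxl) (hd' x h)
      · exact List.mem_singleton.1 h)
  have h3 := path_length_le_of_head hH hq.toIsPathList hq.head
  have h4 : l.length ≠ 0 := by
    intro h
    rw [List.length_eq_zero_iff] at h
    subst h
    simpa using hl.head
  simp at hplen
  have h5 := hl.exists_length
  have h6 : l.length ≠ 1 := by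
    intro h
    obtain ⟨n, rfl⟩ := List.length_eq_one_iff.1 h
    have h1 := hl.head
    have h2 := hl.last
    simp at h1 h2
    exact hd hn₁ (by rw [← h2, h1] at hn₂; exact hn₂)
  omega

theorem false_of_common_hub {M : ℕ} {Y₁ Q₁ Y₂ Q₂ : Finset V} {F₁ F₂ : Finset (Finset V)}
    (hr : 3 ≤ r) (ha : r + 6 ≤ a)
    (hu : ∀ e ∈ H, e.card = r) (hD : DenseOn H S (a.choose (r - 1)))
    (hH : IsEmpty (BergePath H k)) (hk : k ≤ 2 * a + 2) (hM : (a + 2) * (2 * k + 2) ≤ M)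
    (hK₁ : IsCluster H S X K₁) (hK₂ : IsCluster H S X K₂) (hd : Disjoint K₁ K₂)
    (h₁ : CoreBound K₁ Y₁ Q₁ F₁) (h₂ : CoreBound K₂ Y₂ Q₂ F₂) (hYX₁ : Y₁ ⊆ X) (hYX₂ : Y₂ ⊆ X)
    (hY₁ : Y₁.card + 1 ≤ a) (hY₂ : Y₂.card + 1 ≤ a) (hle : Y₂.card ≤ Y₁.card)
    (ht₁ : ∀ u ∈ Y₁, ∃ e, .inr e ∈ K₁ ∧ u ∈ e) (ht₂ : ∀ u ∈ Y₂, ∃ e, .inr e ∈ K₂ ∧ u ∈ e)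
    (hst : ∀ u ∈ Y₁, ∀ v ∈ Y₁, u ≠ v → Strong H M u v) {h : V} (hh₁ : h ∈ Y₁) (hh₂ : h ∈ Y₂) :
    False := by
  obtain ⟨g, hg, hne⟩ : ∃ g ∈ Y₁, g ≠ h ∨ Y₁ = {g} := by
    by_cases hc : Y₁ = {h}
    · exact ⟨h, hh₁, .inr hc⟩
    · obtain ⟨g, hg⟩ : (Y₁.erase h).Nonempty := by
        rw [Finset.nonempty_iff_ne_empty]
        intro he
        rcases Finset.erase_eq_empty_iff _ _ |>.1 he with h | h
        · simp [h] at hh₁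
        · exact hc h
      rw [Finset.mem_erase] at hg
      exact ⟨g, hg.2, .inl hg.1⟩
  obtain ⟨e₁, he₁, hge₁⟩ := ht₁ g hg
  obtain ⟨e₂, he₂, hhe₂⟩ := ht₂ h hh₂
  obtain ⟨f₁, y₁, x₁, l₁, hf₁, hgf₁, hyf₁, hl₁, hlen₁⟩ :=
    exists_long_kPath_of_hub hr ha hu hD hK₁ hYX₁ h₁ hY₁ hg he₁ hge₁
  obtain ⟨f₂, y₂, x₂, l₂, hf₂, hhf₂, hyf₂, hl₂, hlen₂⟩ :=
    exists_long_kPath_of_hub hr ha hu hD hK₂ hYX₂ h₂ hY₂ hh₂ he₂ hhe₂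
  rw [Finset.disjoint_left] at hd
  have hX₁ : ∀ u ∈ X, .inl u ∉ l₁ := fun u hu hul => (hK₁.vert_mem u (hl₁.inK _ hul)).2 hu
  have hX₂ : ∀ u ∈ X, .inl u ∉ l₂ := fun u hu hul => (hK₂.vert_mem u (hl₂.inK _ hul)).2 hu
  have hstep : ∀ {u y x : V} {f : Finset V} {l : List (Node V)} {K : Finset (Node V)}, u ∈ X →
      u ∈ f → y ∈ f → f ∈ H → KPath H K f y x l → (.inl u ∉ l) →
      IsPathFromTo (Inc H) (.inl u) (.inl x) ([.inl u, .inr f] ++ l) := by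
    intro u y x f l K huX huf hyf hf hl hul
    have hfy : Inc H (.inr f) (.inl y) := ⟨hf, hyf⟩
    refine IsPathFromTo.append ⟨⟨by simp [hf, huf], by simp⟩, rfl, rfl⟩
      hl.toIsPathFromTo hfy ?_
    simpa using ⟨hul, hl.avoid⟩
  have hp₁ := hstep (hYX₁ hg) hgf₁ hyf₁ (hK₁.edge_mem _ hf₁) hl₁ (hX₁ g (hYX₁ hg))
  have hp₂ := hstep (hYX₁ hh₁) hhf₂ hyf₂ (hK₂.edge_mem _ hf₂) hl₂ (hX₂ h (hYX₁ hh₁))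
  obtain ⟨l, hl, hlen⟩ := exists_glued_path (fun l hl => path_length_le hH hl) hst hg hh₁ hne
    (le_trans (Nat.mul_le_mul_right _ (by omega)) hM) (hp₁.reverse (inc_symm H)) hp₂
    (by
      intro u hu hul
      simp at hul
      exact hul.resolve_left (hX₁ u (hYX₁ hu)))
    (by
      intro u hu hul
      simp at hul
      exact hul.resolve_right (hX₂ u (hYX₁ hu)))
    (by
      intro x hx hx'
      simp at hx hx'
      rcases hx' with rfl | rfl | hx'
      · rcases hx with hx | hx | hx
        · exact absurd hx (hX₁ h (hYX₁ hh₁))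
        · simp at hx
        · exact ⟨hx, rfl⟩
      · rcases hx with hx | hx | hx
        · exact absurd hf₂ (hd (hl₁.inK _ hx))
        · exact absurd hf₂ (hd (hx ▸ hf₁))
        · simp at hx
      · rcases hx with hx | rfl | rfl
        · exact absurd (hl₂.inK _ hx') (hd (hl₁.inK _ hx))
        · exact absurd (hl₂.inK _ hx') (hd hf₁)
        · exact absurd hx' (hX₂ g (hYX₁ hg)))
  have h3 := path_length_le_of_head hH hl.toIsPathList hl.head
  simp at hlen
  omega

end Glue

section Tails

variable {V : Type*} {H H' : Finset (Finset V)} {A : Finset V}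

theorem Strong.mono {M : ℕ} {h h' : V} (hs : Strong H' M h h') (hsub : H' ⊆ H) :
    Strong H M h h' := by
  intro Z hZ
  obtain ⟨m, hm, hmZ⟩ := hs Z hZ
  exact ⟨m, ⟨⟨hm.path.chain.imp (Inc.mono hsub), hm.path.nodup⟩, hm.len⟩, hmZ⟩

/-- No path of Berge-length three leaves `A`, and no two disjoint paths of Berge-length two do. -/
structure NoLongTail (H : Finset (Finset V)) (A : Finset V) : Prop where
  three : ∀ h y₁ y₂ y₃ e₁ e₂ e₃, h ∈ A → y₁ ∉ A → y₂ ∉ A → y₃ ∉ A → y₁ ≠ y₂ → y₁ ≠ y₃ →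
    y₂ ≠ y₃ → e₁ ∈ H → e₂ ∈ H → e₃ ∈ H → e₁ ≠ e₂ → e₁ ≠ e₃ → e₂ ≠ e₃ → h ∈ e₁ → y₁ ∈ e₁ →
    y₁ ∈ e₂ → y₂ ∈ e₂ → y₂ ∈ e₃ → y₃ ∈ e₃ → False
  pair : ∀ h y₁ y₂ e₁ e₂ h' z₁ z₂ f₁ f₂, h ∈ A → h' ∈ A → h ≠ h' → [y₁, y₂, z₁, z₂].Nodup →
    (∀ v ∈ [y₁, y₂, z₁, z₂], v ∉ A) → [e₁, e₂, f₁, f₂].Nodup → (∀ e ∈ [e₁, e₂, f₁, f₂], e ∈ H) →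
    h ∈ e₁ → y₁ ∈ e₁ → y₁ ∈ e₂ → y₂ ∈ e₂ → h' ∈ f₁ → z₁ ∈ f₁ → z₁ ∈ f₂ → z₂ ∈ f₂ → False

/-- No path of Berge-length two leaves `A`. -/
def NoTwoTail (H : Finset (Finset V)) (A : Finset V) : Prop :=
  ∀ h y₁ y₂ e₁ e₂, h ∈ A → y₁ ∉ A → y₂ ∉ A → y₁ ≠ y₂ → e₁ ∈ H → e₂ ∈ H → e₁ ≠ e₂ → h ∈ e₁ →
    y₁ ∈ e₁ → y₁ ∈ e₂ → y₂ ∈ e₂ → False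

variable {k M : ℕ}

theorem two_tails_length_le (hH : IsEmpty (BergePath H k))
    (hA : ∀ u ∈ A, ∀ v ∈ A, u ≠ v → Strong H M u v) (hM : (A.card + 2) * (2 * k + 2) ≤ M)
    {h₁ h₂ x₁ x₂ : V} (hh₁ : h₁ ∈ A) (hh₂ : h₂ ∈ A) (hne : h₁ ≠ h₂) {t₁ t₂ : List (Node V)}
    (ht₁ : IsPathFromTo (Inc H) (.inl h₁) (.inl x₁) t₁)
    (ht₂ : IsPathFromTo (Inc H) (.inl h₂) (.inl x₂) t₂) (hA₁ : ∀ u ∈ A, .inl u ∈ t₁ → u = h₁)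
    (hA₂ : ∀ u ∈ A, .inl u ∈ t₂ → u = h₂) (hd : ∀ x ∈ t₁, x ∉ t₂) :
    t₁.length + t₂.length + 4 * A.card ≤ 2 * k + 5 := by
  obtain ⟨l, hl, hlen⟩ := exists_glued_path (fun l hl => path_length_le hH hl) hA hh₁ hh₂
    (.inl hne) hM (ht₁.reverse (inc_symm H)) ht₂ (by simpa using hA₁) hA₂ (by
      intro x hx hx'
      exact absurd hx' (hd x (by simpa using hx)))
  have := path_length_le_of_head hH hl.toIsPathList hl.head
  simp at hlen
  omega

theorem tail_length_le (hH : IsEmpty (BergePath H k))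
    (hA : ∀ u ∈ A, ∀ v ∈ A, u ≠ v → Strong H M u v) (hM : (A.card + 2) * (2 * k + 2) ≤ M)
    (hA2 : 2 ≤ A.card) {h x : V} (hh : h ∈ A) {t : List (Node V)}
    (ht : IsPathFromTo (Inc H) (.inl h) (.inl x) t) (htA : ∀ u ∈ A, .inl u ∈ t → u = h) :
    t.length + 4 * A.card ≤ 2 * k + 2 := by
  obtain ⟨g, hg⟩ : (A.erase h).Nonempty := by
    rw [← Finset.card_pos, Finset.card_erase_of_mem hh]
    omega
  rw [Finset.mem_erase] at hg
  obtain ⟨e, he, w, hwe, hge, heZ, hwZ⟩ := (hA g hg.2 h hh hg.1).exists_pendant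
    (Z := t.toFinset ∪ A.image .inl) (by
      have h1 := List.toFinset_card_le t
      have h2 := path_length_le hH ht.toIsPathList
      have h3 := Finset.card_union_le t.toFinset (A.image .inl)
      have h4 := Finset.card_image_le (s := A) (f := (Sum.inl : V → Node V))
      nlinarith)
  simp at heZ hwZ
  have := two_tails_length_le hH hA hM hh hg.2 hg.1.symm ht
    (t₂ := [.inl g, .inr e, .inl w]) (x₂ := w)
    ⟨⟨by simp [he, hge, hwe], by simp; rintro rfl; exact hwZ.2 hg.2⟩, rfl, rfl⟩ htA (by
      intro u hu hul
      simp at hul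
      rcases hul with rfl | rfl
      · rfl
      · exact absurd hu hwZ.2) (by
      intro x hx hx'
      simp at hx'
      rcases hx' with rfl | rfl | rfl
      · exact hg.1 (htA g hg.2 hx)
      · exact heZ hx
      · exact hwZ.1 hx)
  simp at this
  omega

theorem noLongTail_of_strong (hH : IsEmpty (BergePath H k))
    (hA : ∀ u ∈ A, ∀ v ∈ A, u ≠ v → Strong H M u v) (hM : (A.card + 2) * (2 * k + 2) ≤ M)
    (hA2 : 2 ≤ A.card) (hk : k ≤ 2 * A.card + 2) : NoLongTail H A := by
  constructor
  · intro h y₁ y₂ y₃ e₁ e₂ e₃ hh hy₁ hy₂ hy₃ h12 h13 h23 he₁ he₂ he₃ he12 he13 he23 i1 i2 i3 i4 i5 i6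
    have hne : ∀ {y}, y ∉ A → h ≠ y := fun hy he => hy (he ▸ hh)
    have := tail_length_le hH hA hM hA2 hh
      (t := [.inl h, .inr e₁, .inl y₁, .inr e₂, .inl y₂, .inr e₃, .inl y₃]) (x := y₃)
      ⟨⟨by simp [*], by simp [*]⟩, rfl, rfl⟩ (by
        intro u hu hul
        simp at hul
        rcases hul with rfl | rfl | rfl | rfl
        · rfl
        all_goals contradiction)
    simp at this
    omega
  · intro h y₁ y₂ e₁ e₂ h' z₁ z₂ f₁ f₂ hh hh' hne hnd hyA hend heH i1 i2 i3 i4 j1 j2 j3 j4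
    have hne₁ : ∀ {y}, y ∉ A → h ≠ y := fun hy he => hy (he ▸ hh)
    have hne₂ : ∀ {y}, y ∉ A → h' ≠ y := fun hy he => hy (he ▸ hh')
    simp at hnd hyA hend heH
    have := two_tails_length_le hH hA hM hh hh' hne
      (t₁ := [.inl h, .inr e₁, .inl y₁, .inr e₂, .inl y₂]) (x₁ := y₂)
      (t₂ := [.inl h', .inr f₁, .inl z₁, .inr f₂, .inl z₂]) (x₂ := z₂)
      ⟨⟨by simp [*], by simp [*]⟩, rfl, rfl⟩ ⟨⟨by simp [*], by simp [*]⟩, rfl, rfl⟩ (by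
        intro u hu hul
        simp at hul
        rcases hul with rfl | rfl | rfl
        · rfl
        all_goals tauto) (by
        intro u hu hul
        simp at hul
        rcases hul with rfl | rfl | rfl
        · rfl
        all_goals tauto) (by
        simp [hne, hnd, hend, hne₁, Ne.symm (hne₂ hyA.1), Ne.symm (hne₂ hyA.2.1), hyA])
    simp at this
    omega

theorem noTwoTail_of_strong (hH : IsEmpty (BergePath H k))
    (hA : ∀ u ∈ A, ∀ v ∈ A, u ≠ v → Strong H M u v) (hM : (A.card + 2) * (2 * k + 2) ≤ M)
    (hA2 : 2 ≤ A.card) (hk : k ≤ 2 * A.card + 1) : NoTwoTail H A := by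
  intro h y₁ y₂ e₁ e₂ hh hy₁ hy₂ h12 he₁ he₂ he12 i1 i2 i3 i4
  have hne : ∀ {y}, y ∉ A → h ≠ y := fun hy he => hy (he ▸ hh)
  have := tail_length_le hH hA hM hA2 hh
    (t := [.inl h, .inr e₁, .inl y₁, .inr e₂, .inl y₂]) (x := y₂)
    ⟨⟨by simp [*], by simp [*]⟩, rfl, rfl⟩ (by
      intro u hu hul
      simp at hul
      rcases hul with rfl | rfl | rfl
      · rfl
      all_goals contradiction)
  simp at this
  omega

/-- Every vertex is close to `A`. -/
theorem NoLongTail.attach [Fintype V] (hT : NoLongTail H A) (hconn : HConnected H)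
    (hA : A.Nonempty) {y : V} (hy : y ∉ A) :
    (∃ h ∈ A, ∃ g ∈ H, h ∈ g ∧ y ∈ g) ∨
    ∃ h ∈ A, ∃ g ∈ H, ∃ w, w ∉ A ∧ w ≠ y ∧ ∃ f ∈ H, g ≠ f ∧ h ∈ g ∧ w ∈ g ∧ w ∈ f ∧ y ∈ f := by
  obtain ⟨u, hu⟩ := hA
  obtain ⟨l₀, hl₀⟩ := exists_path_of_hConnected hconn u y
  obtain ⟨n₁, n₂, l, hl, ⟨h, hh, rfl⟩, rfl, ht, -⟩ := exists_path_between
    (P := fun n => ∃ h ∈ A, n = .inl h) (Q := fun n => n = .inl y) hl₀ ⟨u, hu, rfl⟩ rfl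
  have hyh : y ≠ h := fun he => hy (he ▸ hh)
  have hc := hl.chain
  have hnd := hl.nodup
  have hlast := hl.last
  obtain ⟨t, rfl⟩ := hl.eq_cons
  simp only [List.tail_cons] at ht
  have htA : ∀ v, .inl v ∈ t → v ∉ A := fun v hv hvA => ht _ hv ⟨v, hvA, rfl⟩
  match t, hc, hnd, hlast, htA with
  | [], hc, hnd, hlast, htA => simp at hlast; exact absurd hlast.symm hyh
  | [.inr e₁], hc, hnd, hlast, htA => simp at hlast
  | .inl _ :: _, hc, hnd, hlast, htA => simp at hc
  | .inr _ :: .inr _ :: _, hc, hnd, hlast, htA => simp at hc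
  | [.inr e₁, .inl y₁], hc, hnd, hlast, htA =>
    simp at hlast hc
    subst hlast
    exact .inl ⟨h, hh, e₁, hc.1.1, hc.1.2, hc.2.2⟩
  | .inr e₁ :: .inl y₁ :: .inl _ :: _, hc, hnd, hlast, htA => simp at hc
  | [.inr e₁, .inl y₁, .inr e₂], hc, hnd, hlast, htA => simp at hlast
  | .inr e₁ :: .inl y₁ :: .inr e₂ :: .inr _ :: _, hc, hnd, hlast, htA => simp at hc
  | [.inr e₁, .inl y₁, .inr e₂, .inl y₂], hc, hnd, hlast, htA =>
    simp at hlast hc hnd htA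
    subst hlast
    exact .inr ⟨h, hh, e₁, hc.1.1, y₁, htA.1, hnd.2.2, e₂, hc.2.2.1.1,
      hnd.2.1, hc.1.2, hc.2.1.2, hc.2.2.1.2, hc.2.2.2.2⟩
  | .inr e₁ :: .inl y₁ :: .inr e₂ :: .inl y₂ :: .inl _ :: _, hc, hnd, hlast, htA => simp at hc
  | [.inr e₁, .inl y₁, .inr e₂, .inl y₂, .inr e₃], hc, hnd, hlast, htA => simp at hlast
  | .inr e₁ :: .inl y₁ :: .inr e₂ :: .inl y₂ :: .inr e₃ :: .inr _ :: _, hc, hnd, hlast, htA => simp at hc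
  | .inr e₁ :: .inl y₁ :: .inr e₂ :: .inl y₂ :: .inr e₃ :: .inl y₃ :: _, hc, hnd, hlast, htA =>
    simp at hc hnd
    have h1 := htA y₁ (by simp)
    have h2 := htA y₂ (by simp)
    have h3 := htA y₃ (by simp)
    refine (hT.three h y₁ y₂ y₃ e₁ e₂ e₃ hh h1 h2 h3 ?_ ?_ ?_ ?_ ?_ ?_ ?_ ?_ ?_ ?_ ?_ ?_ ?_
      ?_ ?_).elim
    all_goals tauto

end Tails

section Structure

variable {V : Type*} {H H' : Finset (Finset V)} {S A : Finset V} {r : ℕ}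

/-- The hypothesis on degrees and supports under which the structure around `A` is analysed. -/
structure RichOn (H : Finset (Finset V)) (S : Finset V) (r : ℕ) : Prop where
  three_le : 3 ≤ r
  uniform : ∀ e ∈ H, e.card = r
  sub : ∀ e ∈ H, e ⊆ S
  degree : ∀ v ∈ S, 8 ≤ (H.filter fun e => v ∈ e).card

theorem RichOn.exists_edge (hR : RichOn H S r) {v : V} (hv : v ∈ S) {E : Finset (Finset V)}
    (hE : E.card ≤ 7) : ∃ e ∈ H, v ∈ e ∧ e ∉ E := by
  obtain ⟨e, he, heE⟩ := exists_mem_of_card hE (hR.degree v hv)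
  rw [Finset.mem_filter] at he
  exact ⟨e, he.1, he.2, heE⟩

theorem RichOn.exists_vertex (hR : RichOn H S r) {e : Finset V} (he : e ∈ H) (y z : V) :
    ∃ x ∈ e, x ≠ y ∧ x ≠ z := by
  obtain ⟨x, hx, hxt⟩ := exists_mem_of_card (t := {y, z}) (s := e) Finset.card_le_two
    (by rw [hR.uniform e he]; exact hR.three_le)
  simp at hxt
  exact ⟨x, hx, hxt⟩

/-- A vertex lies in at most one hyperedge that avoids `A`. -/
theorem RichOn.eq_of_avoid [Fintype V] (hR : RichOn H' S r) (hsub : H' ⊆ H)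
    (hT : NoLongTail H A) (hconn : HConnected H) (hA : A.Nonempty) {y : V}
    {f₁ f₃ : Finset V} (hf₁ : f₁ ∈ H') (hf₃ : f₃ ∈ H') (hyf₁ : y ∈ f₁) (hyf₃ : y ∈ f₃)
    (hfA₁ : ∀ v ∈ f₁, v ∉ A) (hfA₃ : ∀ v ∈ f₃, v ∉ A) : f₁ = f₃ := by
  by_contra hne
  have hyA := hfA₁ y hyf₁
  rcases hT.attach hconn hA hyA with ⟨h, hh, g, hg, hhg, hyg⟩ |
    ⟨h, hh, g, hg, w, hwA, hwy, f, hf, hgf, hhg, hwg, hwf, hyf⟩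
  · have hg₁ : g ≠ f₁ := by rintro rfl; exact hfA₁ h hhg hh
    obtain ⟨x, hx, hxy, -⟩ := hR.exists_vertex hf₁ y y
    have hxA := hfA₁ x hx
    obtain ⟨f₂, hf₂, hxf₂, hf₂E⟩ := hR.exists_edge (hR.sub f₁ hf₁ hx) (E := {f₁, g, f₃})
      (Finset.card_le_three.trans (by norm_num))
    simp only [Finset.mem_insert, Finset.mem_singleton, not_or] at hf₂E
    by_cases hw : ∃ w ∈ f₂, w ∉ A ∧ w ≠ x ∧ w ≠ y
    · obtain ⟨w, hwf₂, hwA, hwx, hwy⟩ := hw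
      exact hT.three h y x w g f₁ f₂ hh hyA hxA hwA hxy.symm hwy.symm hwx.symm hg (hsub hf₁)
        (hsub hf₂) hg₁ (Ne.symm hf₂E.2.1) (Ne.symm hf₂E.1) hhg hyg hyf₁ hx hxf₂ hwf₂
    · push Not at hw
      obtain ⟨h', hh'f₂, hh'x, hh'y⟩ := hR.exists_vertex hf₂ x y
      have hh' : h' ∈ A := by
        by_contra hc
        exact hh'y (hw h' hh'f₂ hc hh'x)
      obtain ⟨z, hz, hzy, hzx⟩ := hR.exists_vertex hf₃ y x
      exact hT.three h' x y z f₂ f₁ f₃ hh' hxA hyA (hfA₃ z hz) hxy hzx.symm hzy.symm (hsub hf₂)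
        (hsub hf₁) (hsub hf₃) hf₂E.1 hf₂E.2.2 hne hh'f₂ hxf₂ hx hyf₁ hyf₃ hz
  · obtain ⟨f', hf', hyf', hfA', hff'⟩ : ∃ f' ∈ H', y ∈ f' ∧ (∀ v ∈ f', v ∉ A) ∧ f ≠ f' := by
      by_cases h : f = f₁
      · exact ⟨f₃, hf₃, hyf₃, hfA₃, h ▸ hne⟩
      · exact ⟨f₁, hf₁, hyf₁, hfA₁, h⟩
    have hgf' : g ≠ f' := by rintro rfl; exact hfA' h hhg hh
    obtain ⟨z, hz, hzy, hzw⟩ := hR.exists_vertex hf' y w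
    exact hT.three h w y z g f f' hh hwA hyA (hfA' z hz) hwy hzw.symm hzy.symm hg hf (hsub hf')
      hgf hgf' hff' hhg hwg hwf hyf hyf' hz

/-- Every vertex outside `A` lies in many hyperedges meeting `A`. -/
theorem RichOn.exists_edge_meeting [Fintype V] (hR : RichOn H' S r) (hsub : H' ⊆ H)
    (hT : NoLongTail H A) (hconn : HConnected H) (hA : A.Nonempty) {y : V} (hy : y ∈ S)
    {E : Finset (Finset V)} (hE : E.card ≤ 6) :
    ∃ e ∈ H', y ∈ e ∧ e ∉ E ∧ ∃ h ∈ A, h ∈ e := by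
  obtain ⟨e, he, hye, heE⟩ := hR.exists_edge hy (hE.trans (by norm_num))
  by_cases hm : ∃ h ∈ A, h ∈ e
  · exact ⟨e, he, hye, heE, hm⟩
  obtain ⟨f, hf, hyf, hfE⟩ := hR.exists_edge hy (E := insert e E)
    ((Finset.card_insert_le _ _).trans (by omega))
  simp only [Finset.mem_insert, not_or] at hfE
  refine ⟨f, hf, hyf, hfE.2, ?_⟩
  by_contra hm'
  push Not at hm hm'
  exact hfE.1 (hR.eq_of_avoid hsub hT hconn hA hf he hyf hye (fun v hv hvA => hm' v hvA hv)
    fun v hv hvA => hm v hvA hv)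

theorem RichOn.card_sdiff_le_one [Fintype V] (hR : RichOn H' S r) (hsub : H' ⊆ H)
    (hT : NoLongTail H A) (hT' : NoTwoTail H A) (hconn : HConnected H) (hA : A.Nonempty)
    {e : Finset V} (he : e ∈ H') : (e \ A).card ≤ 1 := by
  by_contra hc
  obtain ⟨x, hx, y, hy, hxy⟩ := Finset.one_lt_card.1 (not_le.1 hc)
  rw [Finset.mem_sdiff] at hx hy
  obtain ⟨g, hg, hyg, hge, h, hh, hhg⟩ := hR.exists_edge_meeting hsub hT hconn hA
    (hR.sub e he hy.1) (E := {e}) (by simp)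
  exact hT' h y x g e hh hy.2 hx.2 hxy.symm (hsub hg) (hsub he) (by simpa using hge) hhg hyg
    hy.1 hx.1

theorem RichOn.sdiff_eq_of_mem [Fintype V] (hR : RichOn H' S r) (hsub : H' ⊆ H)
    (hT : NoLongTail H A) (hconn : HConnected H) (hA : A.Nonempty) {e f : Finset V} (he : e ∈ H')
    (hf : f ∈ H') (hef : e ≠ f) (hec : 1 < (e \ A).card) (hfc : 1 < (f \ A).card) {y : V}
    (hye : y ∈ e) (hyf : y ∈ f) (hy : y ∉ A) : ∃ x, x ≠ y ∧ e \ A = {x, y} ∧ f \ A = {x, y} := by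
  have key : ∀ x ∈ e \ A, ∀ w ∈ f \ A, x ≠ y → w ≠ y → x = w := by
    intro x hx w hw hxy hwy
    by_contra hxw
    rw [Finset.mem_sdiff] at hx hw
    obtain ⟨g, hg, hxg, hgE, h, hh, hhg⟩ := hR.exists_edge_meeting hsub hT hconn hA
      (hR.sub e he hx.1) (E := {e, f}) (Finset.card_le_two.trans (by norm_num))
    simp only [Finset.mem_insert, Finset.mem_singleton, not_or] at hgE
    exact hT.three h x y w g e f hh hx.2 hy hw.2 hxy hxw hwy.symm (hsub hg) (hsub he) (hsub hf)
      hgE.1 hgE.2 hef hhg hxg hx.1 hye hyf hw.1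
  obtain ⟨x, hx, hxy⟩ := Finset.exists_mem_ne hec y
  obtain ⟨w, hw, hwy⟩ := Finset.exists_mem_ne hfc y
  have hxw := key x hx w hw hxy hwy
  subst hxw
  refine ⟨x, hxy, ?_, ?_⟩
  · ext v
    simp only [Finset.mem_insert, Finset.mem_singleton]
    constructor
    · intro hv
      by_cases hvy : v = y
      · exact .inr hvy
      · exact .inl (key v hv x hw hvy hwy)
    · rintro (rfl | rfl)
      exacts [hx, Finset.mem_sdiff.2 ⟨hye, hy⟩]
  · ext v
    simp only [Finset.mem_insert, Finset.mem_singleton]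
    constructor
    · intro hv
      by_cases hvy : v = y
      · exact .inr hvy
      · exact .inl (key x hx v hv hxy hvy).symm
    · rintro (rfl | rfl)
      exacts [hw, Finset.mem_sdiff.2 ⟨hyf, hy⟩]

theorem RichOn.sdiff_eq [Fintype V] (hR : RichOn H' S r) (hsub : H' ⊆ H)
    (hT : NoLongTail H A) (hconn : HConnected H) (hA : A.Nonempty) {e f : Finset V} (he : e ∈ H')
    (hf : f ∈ H') (hef : e ≠ f) (hec : 1 < (e \ A).card) (hfc : 1 < (f \ A).card) :
    ∃ x y, x ≠ y ∧ e \ A = {x, y} ∧ f \ A = {x, y} := by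
  by_cases hc : ∃ y ∈ e, y ∈ f ∧ y ∉ A
  · obtain ⟨y, hye, hyf, hy⟩ := hc
    obtain ⟨x, h⟩ := hR.sdiff_eq_of_mem hsub hT hconn hA he hf hef hec hfc hye hyf hy
    exact ⟨x, y, h⟩
  exfalso
  push Not at hc
  obtain ⟨x, hx, y, hy, hxy⟩ := Finset.one_lt_card.1 hec
  obtain ⟨z, hz, w, hw, hzw⟩ := Finset.one_lt_card.1 hfc
  rw [Finset.mem_sdiff] at hx hy hz hw
  have hdis : ∀ u v, u ∈ e → u ∉ A → v ∈ f → u ≠ v := by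
    rintro u _ hu huA hv rfl
    exact huA (hc u hu hv)
  obtain ⟨g, hg, hyg, hgE, h, hh, hhg⟩ := hR.exists_edge_meeting hsub hT hconn hA
    (hR.sub e he hy.1) (E := {e, f}) (Finset.card_le_two.trans (by norm_num))
  simp only [Finset.mem_insert, Finset.mem_singleton, not_or] at hgE
  have hstep : ∀ g' ∈ H', w ∈ g' → g' ∉ ({e, f, g} : Finset (Finset V)) →
      ∀ h' ∈ A, h' ∈ g' → h' = h := by
    intro g' hg' hwg' hgE' h' hh' hhg'
    by_contra hne
    simp only [Finset.mem_insert, Finset.mem_singleton, not_or] at hgE'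
    refine hT.pair h y x g e h' w z g' f hh hh' (Ne.symm hne) ?_ ?_ ?_ ?_ hhg hyg hy.1 hx.1 hhg'
      hwg' hw.1 hz.1
    · have h1 := hdis y w hy.1 hy.2 hw.1
      have h2 := hdis y z hy.1 hy.2 hz.1
      have h3 := hdis x w hx.1 hx.2 hw.1
      have h4 := hdis x z hx.1 hx.2 hz.1
      simp [hxy.symm, hzw.symm, *]
    · simp [*]
    · simp [hgE, hef, Ne.symm hgE'.1, Ne.symm hgE'.2.2, hgE'.2.1]
    · simp [hsub he, hsub hf, hsub hg, hsub hg']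
  obtain ⟨g₁, hg₁, hwg₁, hgE₁, h₁, hh₁, hhg₁⟩ := hR.exists_edge_meeting hsub hT hconn hA
    (hR.sub f hf hw.1) (E := {e, f, g}) (Finset.card_le_three.trans (by norm_num))
  obtain ⟨g₂, hg₂, hwg₂, hgE₂, h₂, hh₂, hhg₂⟩ := hR.exists_edge_meeting hsub hT hconn hA
    (hR.sub f hf hw.1) (E := insert g₁ {e, f, g}) ((Finset.card_insert_le _ _).trans
      ((Nat.succ_le_succ Finset.card_le_three).trans (by norm_num)))
  rw [Finset.mem_insert, not_or] at hgE₂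
  have hinter : ∀ g' ∈ H', w ∈ g' → g' ∉ ({e, f, g} : Finset (Finset V)) → ∀ h' ∈ A, h' ∈ g' →
      g' ∩ A = {h} ∧ 1 < (g' \ A).card := by
    intro g' hg' hwg' hgE' h' hh' hhg'
    have h1 : g' ∩ A = {h} := by
      ext v
      simp only [Finset.mem_inter, Finset.mem_singleton]
      constructor
      · rintro ⟨hv, hvA⟩
        exact hstep g' hg' hwg' hgE' v hvA hv
      · rintro rfl
        exact ⟨hstep g' hg' hwg' hgE' h' hh' hhg' ▸ hhg', hh⟩
    refine ⟨h1, ?_⟩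
    have h2 := Finset.card_sdiff_add_card_inter g' A
    rw [h1, hR.uniform g' hg'] at h2
    have := hR.three_le
    simp at h2
    omega
  have i₁ := hinter g₁ hg₁ hwg₁ hgE₁ h₁ hh₁ hhg₁
  have i₂ := hinter g₂ hg₂ hwg₂ hgE₂.2 h₂ hh₂ hhg₂
  obtain ⟨u, -, hu₁, hu₂⟩ := hR.sdiff_eq_of_mem hsub hT hconn hA hg₁ hg₂ (Ne.symm hgE₂.1) i₁.2
    i₂.2 hwg₁ hwg₂ hw.2
  apply hgE₂.1
  rw [← Finset.sdiff_union_inter g₁ A, ← Finset.sdiff_union_inter g₂ A, hu₁, hu₂, i₁.1, i₂.1]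

end Structure

section Count

variable {V : Type*} {H H' : Finset (Finset V)} {S A : Finset V} {r k : ℕ}

theorem card_hnkFamilyOdd_le (hr : 1 ≤ r) (hA : A ⊆ S) :
    (HnkFamilyOdd r S A).card ≤ A.card.choose (r - 1) * (S.card - A.card) + A.card.choose r := by
  have hsub : HnkFamilyOdd r S A ⊆ A.powersetCard r ∪
      (S \ A).biUnion fun v => (A.powersetCard (r - 1)).image (insert v) := by
    intro e he
    simp only [HnkFamilyOdd, Finset.mem_filter, Finset.mem_powerset] at he
    obtain ⟨heS, her, hec⟩ := he
    rw [Finset.mem_union]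
    rcases Nat.le_one_iff_eq_zero_or_eq_one.1 hec with h | h
    · left
      rw [Finset.card_eq_zero, Finset.sdiff_eq_empty_iff_subset] at h
      exact Finset.mem_powersetCard.2 ⟨h, her⟩
    · right
      obtain ⟨v, hv⟩ := Finset.card_eq_one.1 h
      have hvm : v ∈ e \ A := by simp [hv]
      rw [Finset.mem_sdiff] at hvm
      rw [Finset.mem_biUnion]
      refine ⟨v, Finset.mem_sdiff.2 ⟨heS hvm.1, hvm.2⟩, Finset.mem_image.2 ⟨e ∩ A, ?_, ?_⟩⟩
      · have := Finset.card_sdiff_add_card_inter e A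
        rw [Finset.mem_powersetCard]
        exact ⟨Finset.inter_subset_right, by omega⟩
      · rw [Finset.insert_eq, ← hv, Finset.sdiff_union_inter]
  refine (Finset.card_le_card hsub).trans ((Finset.card_union_le _ _).trans ?_)
  rw [Finset.card_powersetCard, add_comm]
  gcongr
  rw [mul_comm, ← Finset.card_sdiff_of_subset hA]
  exact Finset.card_biUnion_le_card_mul _ _ _ fun v _ =>
    Finset.card_image_le.trans (by rw [Finset.card_powersetCard])

theorem card_hnkFamilyEven_le (hr : 2 ≤ r) (hA : A ⊆ S) {b₁ b₂ : V} (hb : b₁ ≠ b₂) :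
    (HnkFamilyEven r S A b₁ b₂).card ≤ A.card.choose (r - 1) * (S.card - A.card) +
      A.card.choose r + A.card.choose (r - 2) := by
  have hsub : HnkFamilyEven r S A b₁ b₂ ⊆ HnkFamilyOdd r S A ∪
      (A.powersetCard (r - 2)).image ({b₁, b₂} ∪ ·) := by
    intro e he
    simp only [HnkFamilyEven, Finset.mem_filter, Finset.mem_powerset] at he
    obtain ⟨heS, her, h | h⟩ := he
    · exact Finset.mem_union_left _ (by simp [HnkFamilyOdd, heS, her, h])
    · refine Finset.mem_union_right _ (Finset.mem_image.2 ⟨e ∩ A, ?_, ?_⟩)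
      · have := Finset.card_sdiff_add_card_inter e A
        rw [h, Finset.card_pair hb] at this
        rw [Finset.mem_powersetCard]
        exact ⟨Finset.inter_subset_right, by omega⟩
      · rw [← h, Finset.sdiff_union_inter]
  refine (Finset.card_le_card hsub).trans ((Finset.card_union_le _ _).trans ?_)
  exact Nat.add_le_add (card_hnkFamilyOdd_le (by omega) hA)
    (Finset.card_image_le.trans (by rw [Finset.card_powersetCard]))

/-- A lower bound on the size of an induced subgraph and an upper bound of extremal type force
equality. -/
theorem restrictTo_eq_family [Fintype V] {D c a : ℕ} (hD : 1 ≤ D) (haS : a ≤ S.card)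
    (hcard : H.card = D * (Fintype.card V - a) + c)
    (hS : H.card ≤ (restrictTo H S).card + (D - 1) * (Fintype.card V - S.card))
    {F : Finset (Finset V)} (hF : restrictTo H S ⊆ F) (hFc : F.card ≤ D * (S.card - a) + c) :
    S = Finset.univ ∧ H = F := by
  have hSV : S.card ≤ Fintype.card V := Finset.card_le_univ S
  have h1 := Finset.card_le_card hF
  obtain ⟨d, hd⟩ : ∃ d, D = d + 1 := ⟨D - 1, by omega⟩
  obtain ⟨s, hs⟩ : ∃ s, S.card = a + s := ⟨S.card - a, by omega⟩
  obtain ⟨m, hm⟩ : ∃ m, Fintype.card V = S.card + m := ⟨Fintype.card V - S.card, by omega⟩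
  have hm0 : m = 0 := by
    rw [show Fintype.card V - a = s + m by omega] at hcard
    rw [show Fintype.card V - S.card = m by omega] at hS
    rw [show S.card - a = s by omega] at hFc
    subst hd
    simp only [Nat.add_sub_cancel] at hS
    nlinarith
  have hSu : S = Finset.univ := by
    rw [← Finset.card_eq_iff_eq_univ]
    omega
  refine ⟨hSu, ?_⟩
  have hres : restrictTo H S = H := by simp [restrictTo, hSu]
  rw [hres] at hF
  refine Finset.eq_of_subset_of_card_le hF ?_
  rw [hcard, show Fintype.card V = S.card by omega]
  exact hFc

theorem isHnkOn_of_strong [Fintype V] {M : ℕ} (hr : 3 ≤ r) (ha : r + 6 ≤ (k - 1) / 2)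
    (hu : ∀ e ∈ H, e.card = r) (hconn : HConnected H) (hH : IsEmpty (BergePath H k))
    (hcard : H.card = extremalCount r k (Fintype.card V))
    (hS : H.card ≤ (restrictTo H S).card +
      (((k - 1) / 2).choose (r - 1) - 1) * (Fintype.card V - S.card))
    (hD : DenseOn (restrictTo H S) S (((k - 1) / 2).choose (r - 1)))
    (hAS : A ⊆ S) (hAc : A.card = (k - 1) / 2)
    (hst : ∀ u ∈ A, ∀ v ∈ A, u ≠ v → Strong (restrictTo H S) M u v)
    (hM : ((k - 1) / 2 + 2) * (2 * k + 2) ≤ M) :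
    IsHnkOn r k (Finset.univ : Finset V) H := by
  have hsub : restrictTo H S ⊆ H := Finset.filter_subset _ _
  have hst' : ∀ u ∈ A, ∀ v ∈ A, u ≠ v → Strong H M u v :=
    fun u hu v hv huv => (hst u hu v hv huv).mono hsub
  have hM' : (A.card + 2) * (2 * k + 2) ≤ M := by rwa [hAc]
  have hA0 : A.Nonempty := by rw [← Finset.card_pos]; omega
  have hT : NoLongTail H A := noLongTail_of_strong hH hst' hM' (by omega) (by omega)
  have hDpos : (k - 1) / 2 ≤ ((k - 1) / 2).choose (r - 1) := le_choose (by omega) (by omega)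
  have hD2 : (k - 1) / 2 ≤ ((k - 1) / 2).choose (r - 2) := le_choose (by omega) (by omega)
  have hR : RichOn (restrictTo H S) S r :=
    ⟨hr, fun e he => hu e (hsub he), fun e he => (Finset.mem_filter.1 he).2, fun v hv =>
      le_trans (by omega) (hD.le_degree hv)⟩
  have hScard : (k - 1) / 2 ≤ S.card := hAc ▸ Finset.card_le_card hAS
  have hodd := card_hnkFamilyOdd_le (r := r) (by omega) hAS
  rw [hAc] at hodd
  have hmem : ∀ e ∈ restrictTo H S, e ⊆ S ∧ e.card = r := fun e he =>
    ⟨hR.sub e he, hR.uniform e he⟩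
  by_cases hk : Even k
  · have h2k : 2 ∣ k := hk.two_dvd
    have hcard' : H.card = ((k - 1) / 2).choose (r - 1) * (Fintype.card V - (k - 1) / 2) +
        (((k - 1) / 2).choose r + ((k - 1) / 2).choose (r - 2)) := by
      rw [hcard, extremalCount, if_pos h2k, add_assoc]
    by_cases hbad : ∃ e ∈ restrictTo H S, ∃ f ∈ restrictTo H S, e ≠ f ∧ 1 < (e \ A).card ∧
        1 < (f \ A).card
    · obtain ⟨e, he, f, hf, hef, hec, hfc⟩ := hbad
      obtain ⟨x, y, hxy, hex, hfx⟩ := hR.sdiff_eq hsub hT hconn hA0 he hf hef hec hfc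
      have hx : x ∈ e \ A := by simp [hex]
      have hy : y ∈ e \ A := by simp [hex]
      rw [Finset.mem_sdiff] at hx hy
      have hF : restrictTo H S ⊆ HnkFamilyEven r S A x y := by
        intro g hg
        simp only [HnkFamilyEven, Finset.mem_filter, Finset.mem_powerset]
        refine ⟨(hmem g hg).1, (hmem g hg).2, ?_⟩
        by_cases hgc : (g \ A).card ≤ 1
        · exact .inl hgc
        right
        by_cases hge : g = e
        · rw [hge, hex]
        · obtain ⟨x', y', -, h1, h2⟩ := hR.sdiff_eq hsub hT hconn hA0 hg he hge (by omega) hec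
          rw [h1, ← h2, hex]
      have hev := card_hnkFamilyEven_le (r := r) (by omega) hAS hxy
      rw [hAc] at hev
      obtain ⟨rfl, hHF⟩ := restrictTo_eq_family (by omega) hScard hcard' hS hF (by omega)
      exact ⟨A, hAS, hAc, .inr ⟨hk, x, by simp [hx.2], y, by simp [hy.2], hxy, hHF⟩⟩
    · exfalso
      push Not at hbad
      have hF : restrictTo H S ⊆ HnkFamilyOdd r S A ∪
          (restrictTo H S).filter (fun e => 1 < (e \ A).card) := by
        intro g hg
        rw [Finset.mem_union]
        by_cases hgc : (g \ A).card ≤ 1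
        · left
          simp only [HnkFamilyOdd, Finset.mem_filter, Finset.mem_powerset]
          exact ⟨(hmem g hg).1, (hmem g hg).2, hgc⟩
        · exact .inr (Finset.mem_filter.2 ⟨hg, by omega⟩)
      have hB : ((restrictTo H S).filter (fun e => 1 < (e \ A).card)).card ≤ 1 := by
        rw [Finset.card_le_one]
        intro e he f hf
        rw [Finset.mem_filter] at he hf
        by_contra hef
        have := hbad e he.1 f hf.1 hef he.2
        omega
      have hFc := Finset.card_union_le (HnkFamilyOdd r S A)
        ((restrictTo H S).filter (fun e => 1 < (e \ A).card))
      obtain ⟨rfl, hHF⟩ := restrictTo_eq_family (by omega) hScard hcard' hS hF (by omega)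
      rw [← hHF, hcard'] at hFc
      rw [Finset.card_univ] at hodd
      omega
  · have hk' : Odd k := Nat.not_even_iff_odd.1 hk
    have h2k : ¬ 2 ∣ k := fun h => hk (even_iff_two_dvd.2 h)
    have hT' : NoTwoTail H A := noTwoTail_of_strong hH hst' hM' (by omega) (by omega)
    have hF : restrictTo H S ⊆ HnkFamilyOdd r S A := by
      intro g hg
      simp only [HnkFamilyOdd, Finset.mem_filter, Finset.mem_powerset]
      exact ⟨(hmem g hg).1, (hmem g hg).2, hR.card_sdiff_le_one hsub hT hT' hconn hA0 hg⟩
    rw [extremalCount, if_neg h2k, add_zero] at hcard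
    obtain ⟨rfl, hHF⟩ := restrictTo_eq_family (by omega) hScard hcard hS hF hodd
    exact ⟨A, hAS, hAc, .inl ⟨hk', hHF⟩⟩

end Count

section Clusters

variable {V : Type*} {H : Finset (Finset V)} {S X : Finset V} {K : Finset (Node V)} {r k : ℕ}

/-- Deleting sparse sets of vertices as long as possible leaves a dense induced subgraph. -/
theorem exists_denseOn [Fintype V] (H : Finset (Finset V)) (D : ℕ) :
    ∃ S : Finset V, H.card ≤ (restrictTo H S).card + (D - 1) * (Fintype.card V - S.card) ∧
      DenseOn (restrictTo H S) S D := by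
  obtain ⟨S, hS, hmin⟩ := Finset.exists_min_image
    ((Finset.univ : Finset (Finset V)).filter fun S =>
      H.card ≤ (restrictTo H S).card + (D - 1) * (Fintype.card V - S.card)) Finset.card
    ⟨Finset.univ, Finset.mem_filter.2 ⟨Finset.mem_univ _, by simp [restrictTo]⟩⟩
  simp only [Finset.mem_filter, Finset.mem_univ, true_and] at hS hmin
  refine ⟨S, hS, fun W hW hW0 => ?_⟩
  have hpos := hW0.card_pos
  have hle := Finset.card_le_card hW
  have hn := Finset.card_le_univ S
  have hcard := Finset.card_sdiff_of_subset hW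
  have hsplit : (restrictTo H S).card = (restrictTo H (S \ W)).card +
      ((restrictTo H S).filter fun e => ∃ w ∈ W, w ∈ e).card := by
    rw [← Finset.card_filter_add_card_filter_not (s := restrictTo H S)
      (fun e => ∃ w ∈ W, w ∈ e), add_comm]
    congr 2
    ext e
    simp only [restrictTo, Finset.mem_filter, and_assoc, Finset.subset_sdiff,
      Finset.disjoint_left, not_exists, not_and]
    refine and_congr_right fun _ => and_congr_right fun _ => ?_
    exact ⟨fun h w hwe hwW => h w hwW hwe, fun h w hwW hwe => h hwe hwW⟩
  by_contra hc
  have := hmin (S \ W) (by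
    rw [hcard, show Fintype.card V - (S.card - W.card) = (Fintype.card V - S.card) + W.card by
      omega, mul_add]
    omega)
  omega

theorem card_filter_not_disjoint_le {N : Type*} {C : Finset (Finset N)} (Z : Finset N)
    (hC : ∀ K ∈ C, ∀ K' ∈ C, K ≠ K' → Disjoint K K') :
    (C.filter fun K => ¬ Disjoint K Z).card ≤ Z.card := by
  have h : ∀ K ∈ C.filter fun K => ¬ Disjoint K Z, ∃ z, z ∈ K ∧ z ∈ Z := by
    intro K hK
    simpa [Finset.not_disjoint_iff] using (Finset.mem_filter.1 hK).2
  rcases isEmpty_or_nonempty N with hN | hN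
  · refine (Finset.card_eq_zero.2 (Finset.eq_empty_of_forall_notMem fun K hK => ?_)).trans_le
      (Nat.zero_le _)
    exact hN.elim (h K hK).choose
  choose! f hf using h
  refine Finset.card_le_card_of_injOn f (fun K hK => (hf K hK).2) ?_
  intro K hK K' hK' hKK'
  by_contra hne
  exact Finset.disjoint_left.1 (hC K (Finset.mem_filter.1 hK).1 K' (Finset.mem_filter.1 hK').1 hne)
    (hf K hK).1 (hKK' ▸ (hf K' hK').1)

theorem exists_clusters (hu : ∀ e ∈ H, e.card = r) (hHS : ∀ e ∈ H, e ⊆ S)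
    (hH : IsEmpty (BergePath H k)) {T : ℕ}
    (hS : separatorBound (T + (2 ^ (2 * k + 1) + (2 * k + 1) * r)) (2 * k + 2) ≤ S.card) :
    ∃ X ⊆ S, X.card ≤ 2 * k + 1 ∧ ∃ C : Finset (Finset (Node V)), T ≤ C.card ∧
      (∀ K ∈ C, IsCluster H S X K) ∧ ∀ K ∈ C, ∀ K' ∈ C, K ≠ K' → Disjoint K K' := by
  obtain ⟨X₀, hX₀, hX₀c, hT⟩ := exists_separator (inc_symm H) (L := 2 * k + 1)
    (R := S.disjSum H) (fun l hl _ => path_length_le hH hl)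
    (hS.trans (by rw [Finset.card_disjSum]; omega))
  have hT' : T + (2 ^ (2 * k + 1) + (2 * k + 1) * r) ≤
      (comps (Inc H) (S.disjSum H \ X₀)).card := by
    convert hT
  have hsum := Finset.card_toLeft_add_card_toRight (u := X₀)
  set Z : Finset (Node V) := X₀.toLeft.powerset.image .inr ∪
    (X₀.toRight.biUnion id).image .inl with hZ
  have hZc : Z.card ≤ 2 ^ (2 * k + 1) + (2 * k + 1) * r := by
    refine (Finset.card_union_le _ _).trans (Nat.add_le_add ?_ ?_)
    · refine Finset.card_image_le.trans ?_
      rw [Finset.card_powerset]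
      exact Nat.pow_le_pow_right (by norm_num) (by omega)
    · refine Finset.card_image_le.trans ((Finset.card_biUnion_le_card_mul _ _ r ?_).trans
        (Nat.mul_le_mul_right _ (by omega)))
      intro e he
      have := hX₀ (Finset.mem_toRight.1 he)
      rw [Finset.inr_mem_disjSum] at this
      exact (hu e this).le
  have hdis : ∀ K ∈ comps (Inc H) (S.disjSum H \ X₀), ∀ K' ∈ comps (Inc H) (S.disjSum H \ X₀),
      K ≠ K' → Disjoint K K' := fun K hK K' hK' hne => comps_disjoint (inc_symm H) hK hK' hne
  have hbad : ((comps (Inc H) (S.disjSum H \ X₀)).filter fun K => ¬ Disjoint K Z).card ≤ Z.card := by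
    convert card_filter_not_disjoint_le Z hdis
  have hsplit : ((comps (Inc H) (S.disjSum H \ X₀)).filter fun K => Disjoint K Z).card +
      ((comps (Inc H) (S.disjSum H \ X₀)).filter fun K => ¬ Disjoint K Z).card =
        (comps (Inc H) (S.disjSum H \ X₀)).card := by
    convert Finset.card_filter_add_card_filter_not
      (s := comps (Inc H) (S.disjSum H \ X₀)) (fun K => Disjoint K Z)
  refine ⟨X₀.toLeft, ?_, by omega, (comps (Inc H) (S.disjSum H \ X₀)).filter
    (fun K => Disjoint K Z), by omega, ?_, fun K hK K' hK' => hdis K (Finset.mem_filter.1 hK).1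
      K' (Finset.mem_filter.1 hK').1⟩
  · intro v hv
    simpa using hX₀ (Finset.mem_toLeft.1 hv)
  intro K hK
  obtain ⟨hKC, hKZ⟩ := Finset.mem_filter.1 hK
  rw [Finset.disjoint_left] at hKZ
  have hKR : ∀ n ∈ K, n ∈ S.disjSum H ∧ n ∉ X₀ := fun n hn =>
    Finset.mem_sdiff.1 (comps_subset hKC hn)
  have hedge : ∀ e, .inr e ∈ K → e ∈ H := fun e he => by simpa using (hKR _ he).1
  have hsub : ∀ e v, .inr e ∈ K → v ∈ e → .inl v ∈ K ∨ v ∈ X₀.toLeft := by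
    intro e v he hv
    by_cases hvX : .inl v ∈ X₀
    · exact .inr (by simpa using hvX)
    · have hev : Inc H (.inr e) (.inl v) := ⟨hedge e he, hv⟩
      exact .inl (comps_closed hKC he (Finset.mem_sdiff.2
        ⟨by simpa using hHS e (hedge e he) hv, hvX⟩) hev)
  have hvert : ∀ e, .inr e ∈ K → ∃ v ∈ e, .inl v ∈ K := by
    intro e he
    by_contra hc
    push Not at hc
    refine hKZ he ?_
    rw [hZ]
    refine Finset.mem_union_left _ (Finset.mem_image_of_mem _ (Finset.mem_powerset.2 ?_))
    exact fun v hv => (hsub e v he hv).resolve_left (hc v hv)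
  refine ⟨fun x hx y hy => comps_connIn (inc_symm H) hKC hx hy, hedge, ?_, ?_, hsub, hvert, ?_⟩
  · intro v hv
    simpa using hKR _ hv
  · intro v e hv he hve
    have hadj : Inc H (.inl v) (.inr e) := ⟨he, hve⟩
    refine comps_closed hKC hv (Finset.mem_sdiff.2 ⟨by simpa using he, fun heX => ?_⟩) hadj
    refine hKZ hv (Finset.mem_union_right _ (Finset.mem_image_of_mem _ ?_))
    exact Finset.mem_biUnion.2 ⟨e, by simpa using heX, hve⟩
  · obtain ⟨n, hn⟩ := comps_nonempty hKC
    rcases n with v | e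
    · exact ⟨v, hn⟩
    · obtain ⟨v, -, hv⟩ := hvert e hn
      exact ⟨v, hv⟩

/-- Two vertices outside `K` lie in distinct hyperedges of `K`. -/
def Linked (K : Finset (Node V)) (h h' : V) : Prop :=
  ∃ e e', .inr e ∈ K ∧ .inr e' ∈ K ∧ h ∈ e ∧ h' ∈ e' ∧ e ≠ e'

theorem Linked.exists_isMid (hK : IsCluster H S X K) {h h' : V} (hX : h ∈ X) (hX' : h' ∈ X)
    (hne : h ≠ h') (hl : Linked K h h') : ∃ m, IsMid H h h' m ∧ ∀ n ∈ m, n ∈ K := by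
  obtain ⟨e, e', he, he', hhe, hhe', hee'⟩ := hl
  obtain ⟨m, hm, hmK⟩ := (hK.conn _ he _ he').exists_path he
  have hmem : Inc H (.inl h) (.inr e) := ⟨hK.edge_mem e he, hhe⟩
  have hmem' : Inc H (.inr e') (.inl h') := ⟨hK.edge_mem e' he', hhe'⟩
  have hnX : ∀ u ∈ X, .inl u ∉ m := fun u hu hum => (hK.vert_mem u (hmK _ hum)).2 hu
  have hp := (IsPathFromTo.singleton (Inc H) (.inl h)).append
    (hm.append (IsPathFromTo.singleton (Inc H) (.inl h')) hmem' (by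
      intro n hn hn'
      rw [List.mem_singleton] at hn'
      subst hn'
      exact hnX h' hX' hn)) hmem (by
      intro n hn hn'
      rw [List.mem_singleton] at hn
      subst hn
      rcases List.mem_append.1 hn' with h | h
      · exact hnX _ hX h
      · simp at h
        exact hne h)
  refine ⟨m, ⟨hp.toIsPathList, ?_⟩, hmK⟩
  have h1 := hm.head
  have h2 := hm.last
  have h3 := hm.chain
  match m, h1, h2, h3 with
  | [], h1, _, _ => simp at h1
  | [n], h1, h2, _ =>
    simp at h1 h2
    rw [h1] at h2
    exact absurd (by simpa using h2) hee'
  | [n₁, n₂], h1, h2, h3 =>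
    simp at h1 h2
    subst h1 h2
    simp at h3
  | _ :: _ :: _ :: _, _, _, _ => simp

theorem strong_of_linked {C : Finset (Finset (Node V))} (hC : ∀ K ∈ C, IsCluster H S X K)
    (hd : ∀ K ∈ C, ∀ K' ∈ C, K ≠ K' → Disjoint K K') {h h' : V} (hX : h ∈ X) (hX' : h' ∈ X)
    (hne : h ≠ h') {M : ℕ} (hM : M < (C.filter fun K => Linked K h h').card) :
    Strong H M h h' := by
  intro Z hZ
  obtain ⟨K, hK, hKZ⟩ := exists_mem_of_card
    ((card_filter_not_disjoint_le Z hd).trans hZ) hM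
  obtain ⟨hKC, hl⟩ := Finset.mem_filter.1 hK
  simp only [Finset.mem_filter, hKC, true_and, not_not] at hKZ
  obtain ⟨m, hm, hmK⟩ := hl.exists_isMid (hC K hKC) hX hX' hne
  exact ⟨m, hm, fun n hn => Finset.disjoint_left.1 hKZ (hmK n hn)⟩

theorem exists_strong_clusters {C : Finset (Finset (Node V))} (hC : ∀ K ∈ C, IsCluster H S X K)
    (hd : ∀ K ∈ C, ∀ K' ∈ C, K ≠ K' → Disjoint K K') {M T L : ℕ} (hX : X.card ≤ L)
    (hT : T + L * L * M ≤ C.card) :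
    ∃ C' ⊆ C, T ≤ C'.card ∧ ∀ K ∈ C', ∀ h ∈ X, ∀ h' ∈ X, h ≠ h' → Linked K h h' →
      Strong H M h h' := by
  refine ⟨C.filter fun K => ∀ h ∈ X, ∀ h' ∈ X, h ≠ h' → Linked K h h' → Strong H M h h',
    Finset.filter_subset _ _, ?_, fun K hK => (Finset.mem_filter.1 hK).2⟩
  have hsplit := Finset.card_filter_add_card_filter_not (s := C)
    (fun K => ∀ h ∈ X, ∀ h' ∈ X, h ≠ h' → Linked K h h' → Strong H M h h')
  have hsub : (C.filter fun K => ¬ ∀ h ∈ X, ∀ h' ∈ X, h ≠ h' → Linked K h h' →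
      Strong H M h h') ⊆ ((X ×ˢ X).filter fun p => p.1 ≠ p.2 ∧ ¬ Strong H M p.1 p.2).biUnion
        fun p => C.filter fun K => Linked K p.1 p.2 := by
    intro K hK
    rw [Finset.mem_filter] at hK
    obtain ⟨hKC, hK⟩ := hK
    push Not at hK
    obtain ⟨h, hh, h', hh', hne, hl, hs⟩ := hK
    exact Finset.mem_biUnion.2 ⟨(h, h'), by simp [hh, hh', hne, hs], by simp [hKC, hl]⟩
  have h1 := (Finset.card_le_card hsub).trans (Finset.card_biUnion_le_card_mul _ _ M (by
    rintro ⟨h, h'⟩ hp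
    simp only [Finset.mem_filter, Finset.mem_product] at hp
    by_contra hc
    exact hp.2.2 (strong_of_linked hC hd hp.1.1 hp.1.2 hp.2.1 (not_le.1 hc))))
  have h2 : ((X ×ˢ X).filter fun p => p.1 ≠ p.2 ∧ ¬ Strong H M p.1 p.2).card ≤ L * L :=
    (Finset.card_filter_le _ _).trans (by rw [Finset.card_product]; exact Nat.mul_le_mul hX hX)
  have h3 := Nat.mul_le_mul_right M h2
  omega

theorem IsCluster.exists_core (hK : IsCluster H S X K) :
    ∃ Y Q F, Y ⊆ X ∧ CoreBound K Y Q F ∧ (∀ u ∈ Y, ∃ e, .inr e ∈ K ∧ u ∈ e) ∧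
      ∀ u ∈ Y, ∀ v ∈ Y, u ≠ v → Linked K u v := by
  obtain ⟨Y, hY, hmax⟩ := Finset.exists_max_image (X.powerset.filter fun Y =>
    (∀ u ∈ Y, ∃ e, .inr e ∈ K ∧ u ∈ e) ∧ ∀ u ∈ Y, ∀ v ∈ Y, u ≠ v → Linked K u v) Finset.card
    ⟨∅, by simp⟩
  simp only [Finset.mem_filter, Finset.mem_powerset] at hY hmax
  obtain ⟨hYX, htouch, hlink⟩ := hY
  set Q := Y.filter fun q => (K.toRight.filter fun e => q ∈ e).card ≤ 1 with hQ
  refine ⟨Y, Q, K.toRight.filter fun e => ∃ q ∈ Q, q ∈ e, hYX,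
    ⟨Finset.filter_subset _ _, ?_, ?_⟩, htouch, hlink⟩
  · have hsub : (K.toRight.filter fun e => ∃ q ∈ Q, q ∈ e) ⊆
        Q.biUnion fun q => K.toRight.filter fun e => q ∈ e := by
      intro e he
      simp only [Finset.mem_filter, Finset.mem_biUnion] at he ⊢
      obtain ⟨heK, q, hq, hqe⟩ := he
      exact ⟨q, hq, heK, hqe⟩
    exact (Finset.card_le_card hsub).trans (by
      simpa using Finset.card_biUnion_le_card_mul Q (fun q => K.toRight.filter fun e => q ∈ e) 1
        fun q hq => (Finset.mem_filter.1 hq).2)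
  · intro e he heF v hv
    rcases hK.edge_sub e v he hv with h | hvX
    · exact .inl h
    right
    have hQe : ∀ q ∈ Q, q ∉ e := fun q hq hqe =>
      heF (Finset.mem_filter.2 ⟨by simpa using he, q, hq, hqe⟩)
    rw [Finset.mem_sdiff]
    refine ⟨?_, fun hvQ => hQe v hvQ hv⟩
    by_contra hvY
    obtain ⟨u, huY, huv⟩ : ∃ u ∈ Y, ¬ Linked K v u := by
      by_contra hc
      push Not at hc
      have := hmax (insert v Y) ⟨Finset.insert_subset hvX hYX, ?_, ?_⟩
      · rw [Finset.card_insert_of_notMem hvY] at this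
        omega
      · intro u hu
        rcases Finset.mem_insert.1 hu with rfl | hu
        · exact ⟨e, he, hv⟩
        · exact htouch u hu
      · have hsymm : ∀ u ∈ Y, Linked K u v := by
          intro u hu
          obtain ⟨f, f', hf, hf', hvf, huf, hff⟩ := hc u hu
          exact ⟨f', f, hf', hf, huf, hvf, hff.symm⟩
        intro u hu w hw huw
        rw [Finset.mem_insert] at hu hw
        rcases hu with rfl | hu <;> rcases hw with rfl | hw
        · exact absurd rfl huw
        · exact hc w hw
        · exact hsymm u hu
        · exact hlink u hu w hw huw
    have hall : ∀ f, .inr f ∈ K → u ∈ f → f = e := by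
      intro f hf huf
      by_contra hne
      exact huv ⟨e, f, he, hf, hv, huf, Ne.symm hne⟩
    obtain ⟨f, hf, huf⟩ := htouch u huY
    refine hQe u (Finset.mem_filter.2 ⟨huY, Finset.card_le_one.2 ?_⟩) (hall f hf huf ▸ huf)
    intro f₁ hf₁ f₂ hf₂
    simp only [Finset.mem_filter, Finset.mem_toRight] at hf₁ hf₂
    rw [hall f₁ hf₁.1 hf₁.2, hall f₂ hf₂.1 hf₂.2]

end Clusters

section Main

variable {V : Type*} {H : Finset (Finset V)} {S X : Finset V} {r k : ℕ}

/-- A large dense part of a path-free connected hypergraph contains `a` vertices that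
are pairwise strongly joined. -/
theorem exists_strong_set [Fintype V] {H' : Finset (Finset V)} {a M : ℕ} (hr : 3 ≤ r)
    (ha : r + 6 ≤ a) (hu : ∀ e ∈ H', e.card = r) (hHS : ∀ e ∈ H', e ⊆ S)
    (hD : DenseOn H' S (a.choose (r - 1))) (hsub : H' ⊆ H) (hconn : HConnected H)
    (hH : IsEmpty (BergePath H k)) (hk : k ≤ 2 * a + 2) (hM : (a + 2) * (2 * k + 2) ≤ M)
    (hS : separatorBound (2 * k + 4 + (2 * k + 1) * (2 * k + 1) * M +
      (2 ^ (2 * k + 1) + (2 * k + 1) * r)) (2 * k + 2) ≤ S.card) :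
    ∃ A ⊆ S, A.card = a ∧ ∀ u ∈ A, ∀ v ∈ A, u ≠ v → Strong H' M u v := by
  have hH' : IsEmpty (BergePath H' k) := ⟨fun p => hH.false
    ⟨p.verts, p.edges, p.verts_inj, p.edges_inj, fun i => hsub (p.edges_mem i), p.fst_mem,
      p.snd_mem⟩⟩
  obtain ⟨X, hXS, hXc, C₀, hC₀, hcl₀, hd₀⟩ := exists_clusters hu hHS hH' hS
  obtain ⟨C, hCC₀, hC, hst₀⟩ := exists_strong_clusters hcl₀ hd₀ hXc hC₀
  have hcl : ∀ K ∈ C, IsCluster H' S X K := fun K hK => hcl₀ K (hCC₀ hK)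
  have hd : ∀ K ∈ C, ∀ K' ∈ C, K ≠ K' → Disjoint K K' := fun K hK K' hK' =>
    hd₀ K (hCC₀ hK) K' (hCC₀ hK')
  choose! Y Q F hYX hcore htouch hlink using fun K (hK : K ∈ C) => (hcl K hK).exists_core
  have hst : ∀ K ∈ C, ∀ u ∈ Y K, ∀ v ∈ Y K, u ≠ v → Strong H' M u v :=
    fun K hK u hu v hv huv => hst₀ K hK u (hYX K hK hu) v (hYX K hK hv) huv
      (hlink K hK u hu v hv huv)
  by_cases hbig : ∃ K ∈ C, a ≤ (Y K).card
  · obtain ⟨K, hK, hKa⟩ := hbig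
    obtain ⟨A, hAY, hAc⟩ := Finset.exists_subset_card_eq hKa
    exact ⟨A, (hAY.trans (hYX K hK)).trans hXS, hAc,
      fun u hu v hv => hst K hK u (hAY hu) v (hAY hv)⟩
  push Not at hbig
  exfalso
  have hempty : (C.filter fun K => Y K = ∅).card ≤ 1 := by
    refine Finset.card_le_one.2 fun K₁ h₁ K₂ h₂ => ?_
    rw [Finset.mem_filter] at h₁ h₂
    by_contra hne
    have hcore' : ∀ K ∈ C, Y K = ∅ → CoreBound K ∅ ∅ ∅ := by
      intro K hK hY
      have h := hcore K hK
      have hQ : Q K = ∅ := Finset.subset_empty.1 (hY ▸ h.sub)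
      have hF : F K = ∅ := by simpa [hQ] using h.card_le
      rwa [hY, hQ, hF] at h
    exact false_of_isolated_clusters hr ha hu hD hsub hconn hH hk (hcl K₁ h₁.1) (hcl K₂ h₂.1)
      (hd K₁ h₁.1 K₂ h₂.1 hne) (hcore' K₁ h₁.1 h₁.2) (hcore' K₂ h₂.1 h₂.2)
  have hsplit := Finset.card_filter_add_card_filter_not (s := C) (fun K => Y K = ∅)
  have hhub : ∀ K ∈ C.filter fun K => ¬ Y K = ∅, ∃ h, h ∈ Y K := fun K hK =>
    Finset.nonempty_iff_ne_empty.2 (Finset.mem_filter.1 hK).2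
  have : Nonempty V := by
    obtain ⟨K, hK⟩ := Finset.card_pos.1 (show 0 < (C.filter fun K => ¬ Y K = ∅).card by omega)
    exact ⟨(hhub K hK).choose⟩
  choose! f hf using hhub
  obtain ⟨K₁, h₁, K₂, h₂, hne, heq⟩ := Finset.exists_ne_map_eq_of_card_lt_of_maps_to
    (t := X) (s := C.filter fun K => ¬ Y K = ∅) (f := f) (by omega)
    (fun K hK => hYX K (Finset.mem_filter.1 hK).1 (hf K hK))
  have hf₁ := hf K₁ h₁
  have hf₂ := hf K₂ h₂
  rw [Finset.mem_filter] at h₁ h₂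
  rcases le_total (Y K₂).card (Y K₁).card with hle | hle
  · exact false_of_common_hub hr ha hu hD hH' hk hM (hcl _ h₁.1) (hcl _ h₂.1)
      (hd _ h₁.1 _ h₂.1 hne) (hcore _ h₁.1) (hcore _ h₂.1) (hYX _ h₁.1) (hYX _ h₂.1)
      (hbig _ h₁.1) (hbig _ h₂.1) hle (htouch _ h₁.1) (htouch _ h₂.1) (hst _ h₁.1) hf₁
      (heq ▸ hf₂)
  · exact false_of_common_hub hr ha hu hD hH' hk hM (hcl _ h₂.1) (hcl _ h₁.1)
      (hd _ h₂.1 _ h₁.1 hne.symm) (hcore _ h₂.1) (hcore _ h₁.1) (hYX _ h₂.1) (hYX _ h₁.1)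
      (hbig _ h₂.1) (hbig _ h₁.1) hle (htouch _ h₂.1) (htouch _ h₁.1) (hst _ h₂.1) hf₂
      (heq ▸ hf₁)

/-- The dense part is large once the number of vertices is. -/
theorem lt_card_of_lt_card [Fintype V] {B D a : ℕ} (hDpos : 1 ≤ D)
    (hcard : D * (Fintype.card V - a) ≤ H.card)
    (hS : H.card ≤ (restrictTo H S).card + (D - 1) * (Fintype.card V - S.card))
    (hn : 2 ^ B + D * a < Fintype.card V) : B < S.card := by
  have hpow : (restrictTo H S).card ≤ 2 ^ S.card := by
    rw [← Finset.card_powerset]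
    exact Finset.card_le_card fun e he => Finset.mem_powerset.2 (Finset.mem_filter.1 he).2
  have h1 : (D - 1) * (Fintype.card V - S.card) ≤ (D - 1) * Fintype.card V :=
    Nat.mul_le_mul_left _ (Nat.sub_le _ _)
  have h2 : D * Fintype.card V = (D - 1) * Fintype.card V + Fintype.card V := by
    obtain ⟨D, rfl⟩ := Nat.exists_eq_add_of_le' hDpos
    simp [Nat.add_mul]
  rw [Nat.mul_sub] at hcard
  exact (Nat.pow_lt_pow_iff_right (by norm_num)).1 (show 2 ^ B < 2 ^ S.card by omega)

theorem restrictTo_subset : restrictTo H S ⊆ H := fun _ he => (Finset.mem_filter.1 he).1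

theorem subset_of_mem_restrictTo {e : Finset V} (he : e ∈ restrictTo H S) : e ⊆ S :=
  (Finset.mem_filter.1 he).2

end Main

/-- For `k ≥ 2r+13 ≥ 18` there is `N_{k,r}` such that for all `n > N_{k,r}`,
every connected `n`-vertex `r`-uniform hypergraph with no Berge-path of length `k` having
exactly the extremal number of hyperedges is (isomorphic to) the hypergraph `H_{n,k}`. -/
theorem uniqueness_of_extremal_hypergraph
    (r k : ℕ) (hk : 2 * r + 13 ≤ k) (hr : 18 ≤ 2 * r + 13) :
    ∃ N : ℕ, ∀ n : ℕ, N < n → ∀ H : Finset (Finset (Fin n)),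
      (∀ e ∈ H, e.card = r) → HConnected H → IsEmpty (BergePath H k) →
      H.card = extremalCount r k n →
      IsHnkOn r k (Finset.univ : Finset (Fin n)) H := by
  have hr3 : 3 ≤ r := by omega
  have ha : r + 6 ≤ (k - 1) / 2 := by omega
  refine ⟨2 ^ separatorBound (2 * k + 4 + (2 * k + 1) * (2 * k + 1) *
    (((k - 1) / 2 + 2) * (2 * k + 2)) + (2 ^ (2 * k + 1) + (2 * k + 1) * r)) (2 * k + 2) +
      ((k - 1) / 2).choose (r - 1) * ((k - 1) / 2), fun n hn H hu hconn hH hcard => ?_⟩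
  obtain ⟨S, hS, hD⟩ := exists_denseOn H (((k - 1) / 2).choose (r - 1))
  rw [← Fintype.card_fin n] at hn
  replace hcard : H.card = extremalCount r k (Fintype.card (Fin n)) := by
    rwa [Fintype.card_fin]
  have hB := lt_card_of_lt_card (Nat.choose_pos (by omega))
    (by rw [hcard, extremalCount, add_assoc]; exact Nat.le_add_right _ _) hS hn
  obtain ⟨A, hAS, hAc, hst⟩ := exists_strong_set hr3 ha
    (fun e he => hu e (restrictTo_subset he)) (fun e he => subset_of_mem_restrictTo he) hD
    restrictTo_subset hconn hH (by omega) le_rfl hB.le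
  exact isHnkOn_of_strong hr3 ha hu hconn hH hcard hS hD hAS hAc hst le_rfl
end

section
/- Under the standing assumptions (k ≥ 2r+13 ≥ 18; n > N_{k,r}; H a connected n-vertex r-graph with no Berge-path of length k and with at least C(⌊(k-1)/2⌋, r-1)·(n − ⌊(k-1)/2⌋) + C(⌊(k-1)/2⌋, r) + [k even]·C(⌊(k-1)/2⌋, r-2) hyperedges; H' the sub-hypergraph obtained from H by repeatedly deleting vertices of degree less than C(⌊(k-1)/2⌋, r-1) together with their incident hyperedges), the hypergraph H' is connected. -/
open scoped Classical

/-- A Berge-path of length `t` given by sequences indexed by `ℕ`, of which only the first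
`t + 1` vertices and the first `t` hyperedges matter. -/
structure IsBergeSeq {V : Type*} (H : Finset (Finset V)) (v : ℕ → V) (e : ℕ → Finset V)
    (t : ℕ) : Prop where
  v_inj : ∀ i j, i ≤ t → j ≤ t → v i = v j → i = j
  e_inj : ∀ i j, i < t → j < t → e i = e j → i = j
  mem : ∀ i, i < t → e i ∈ H
  fst : ∀ i, i < t → v i ∈ e i
  snd : ∀ i, i < t → v (i + 1) ∈ e i

/-- Two vertices lie in a common hyperedge. -/
def ShareEdge {V : Type*} (H : Finset (Finset V)) (a b : V) : Prop :=
  ∃ e ∈ H, a ∈ e ∧ b ∈ e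

/-- The first `t + 1` vertices of a sequence. -/
noncomputable def seqVerts {V : Type*} (v : ℕ → V) (t : ℕ) : Finset V :=
  (Finset.range (t + 1)).image v

section BergeSeq

variable {V : Type*} {H : Finset (Finset V)} {v : ℕ → V} {e : ℕ → Finset V} {t : ℕ}

lemma mem_seqVerts {x : V} : x ∈ seqVerts v t ↔ ∃ i, i ≤ t ∧ v i = x := by
  simp [seqVerts]

lemma IsBergeSeq.mono_length (h : IsBergeSeq H v e t) {s : ℕ} (hs : s ≤ t) :
    IsBergeSeq H v e s where
  v_inj i j hi hj := h.v_inj i j (hi.trans hs) (hj.trans hs)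
  e_inj i j hi hj := h.e_inj i j (hi.trans_le hs) (hj.trans_le hs)
  mem i hi := h.mem i (hi.trans_le hs)
  fst i hi := h.fst i (hi.trans_le hs)
  snd i hi := h.snd i (hi.trans_le hs)

lemma IsBergeSeq.mono {H' : Finset (Finset V)} (h : IsBergeSeq H v e t) (hH : H ⊆ H') :
    IsBergeSeq H' v e t :=
  ⟨h.v_inj, h.e_inj, fun i hi => hH (h.mem i hi), h.fst, h.snd⟩

lemma IsBergeSeq.zero (v : ℕ → V) (e : ℕ → Finset V) : IsBergeSeq H v e 0 := by
  constructor <;> grind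

lemma IsBergeSeq.shift {a b : ℕ} (h : IsBergeSeq H v e (a + b)) :
    IsBergeSeq H (fun i => v (a + i)) (fun i => e (a + i)) b where
  v_inj i j hi hj hij := by have := h.v_inj _ _ (by omega) (by omega) hij; omega
  e_inj i j hi hj hij := by have := h.e_inj _ _ (by omega) (by omega) hij; omega
  mem i hi := h.mem _ (by omega)
  fst i hi := h.fst _ (by omega)
  snd i hi := h.snd _ (by omega)

lemma IsBergeSeq.card_seqVerts (h : IsBergeSeq H v e t) : (seqVerts v t).card = t + 1 := by
  rw [seqVerts, Finset.card_image_of_injOn, Finset.card_range]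
  intro i hi j hj hij
  simp only [Finset.coe_range, Set.mem_Iio] at hi hj
  exact h.v_inj i j (by omega) (by omega) hij

lemma IsBergeSeq.reverse (h : IsBergeSeq H v e t) :
    IsBergeSeq H (fun i => v (t - i)) (fun i => e (t - 1 - i)) t where
  v_inj i j hi hj hij := by have := h.v_inj _ _ (by omega) (by omega) hij; omega
  e_inj i j hi hj hij := by have := h.e_inj _ _ (by omega) (by omega) hij; omega
  mem i hi := h.mem _ (by omega)
  fst i hi := by
    have := h.snd (t - 1 - i) (by omega)
    rwa [show t - 1 - i + 1 = t - i by omega] at this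
  snd i hi := by
    have := h.fst (t - 1 - i) (by omega)
    rwa [show t - 1 - i = t - (i + 1) by omega] at this ⊢

lemma IsBergeSeq.append {v' : ℕ → V} {e' : ℕ → Finset V} {a b : ℕ}
    (h : IsBergeSeq H v e a) (h' : IsBergeSeq H v' e' b) (hglue : v a = v' 0)
    (hv : ∀ i j, i ≤ a → j ≤ b → v i = v' j → j = 0)
    (he : ∀ i j, i < a → j < b → e i ≠ e' j) :
    IsBergeSeq H (fun i => if i ≤ a then v i else v' (i - a))
      (fun i => if i < a then e i else e' (i - a)) (a + b) where
  v_inj i j hi hj hij := by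
    have h1 := h.v_inj i j
    have h2 := h'.v_inj (i - a) (j - a)
    have h3 := hv i (j - a)
    have h4 := hv j (i - a)
    grind
  e_inj i j hi hj hij := by
    have h1 := h.e_inj i j
    have h2 := h'.e_inj (i - a) (j - a)
    have h3 := he i (j - a)
    have h4 := he j (i - a)
    grind
  mem i hi := by
    have h1 := h.mem i
    have h2 := h'.mem (i - a)
    grind
  fst i hi := by
    have h1 := h.fst i
    have h2 := h'.fst (i - a)
    grind
  snd i hi := by
    have h1 := h.snd i
    have h2 := h'.snd (i - a)
    have h3 : a ≤ i → i + 1 - a = i - a + 1 := by omega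
    grind

/-- A Berge-path can be prolonged at its end by an unused hyperedge towards a new vertex. -/
lemma IsBergeSeq.extend (h : IsBergeSeq H v e t) {f : Finset V} {w : V} (hf : f ∈ H)
    (htf : v t ∈ f) (hwf : w ∈ f) (hw : ∀ i, i ≤ t → v i ≠ w) (hfe : ∀ i, i < t → e i ≠ f) :
    IsBergeSeq H (fun i => if i ≤ t then v i else w) (fun i => if i < t then e i else f)
      (t + 1) where
  v_inj i j hi hj hij := by
    have h1 := h.v_inj i j
    grind
  e_inj i j hi hj hij := by
    have h1 := h.e_inj i j
    grind
  mem i hi := by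
    have h1 := h.mem i
    grind
  fst i hi := by
    have h1 := h.fst i
    grind
  snd i hi := by
    have h1 := h.snd i
    grind

/-- Rotating a Berge-path at its end: an unused hyperedge joining the last vertex to the
`i`-th one yields a Berge-path with the same vertices and the same start that ends in the
`(i+1)`-st vertex and does not use the `i`-th hyperedge. -/
lemma IsBergeSeq.rotate (h : IsBergeSeq H v e t) {i : ℕ} (hi : i < t) {f : Finset V}
    (hf : f ∈ H) (htf : v t ∈ f) (hif : v i ∈ f) (hfe : ∀ j, j < t → e j ≠ f) :
    ∃ v' e', IsBergeSeq H v' e' t ∧ v' 0 = v 0 ∧ v' t = v (i + 1) ∧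
      seqVerts v' t = seqVerts v t ∧ (∀ j, j < t → e' j ≠ e i) := by
  refine ⟨fun j => if j ≤ i then v j else v (t + i + 1 - j),
    fun j => if j < i then e j else if j = i then f else e (t + i - j), ?_, ?_, ?_, ?_, ?_⟩
  · constructor
    · intro a b ha hb hab
      have h1 := h.v_inj a b
      have h2 := h.v_inj a (t + i + 1 - b)
      have h3 := h.v_inj (t + i + 1 - a) b
      have h4 := h.v_inj (t + i + 1 - a) (t + i + 1 - b)
      grind
    · intro a b ha hb hab
      have h1 := h.e_inj a b
      have h2 := h.e_inj a (t + i - b)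
      have h3 := h.e_inj (t + i - a) b
      have h4 := h.e_inj (t + i - a) (t + i - b)
      grind
    · intro a ha
      have h1 := h.mem a
      have h2 := h.mem (t + i - a)
      grind
    · intro a ha
      have h1 := h.fst a
      have h2 := h.snd (t + i - a)
      have h3 : t + i - a + 1 = t + i + 1 - a := by omega
      grind
    · intro a ha
      have h1 := h.snd a
      have h2 := h.fst (t + i - a)
      have h3 : t + i + 1 - (a + 1) = t + i - a := by omega
      grind
  · simp
  · have : t + i + 1 - t = i + 1 := by omega
    grind
  · ext x
    rw [mem_seqVerts, mem_seqVerts]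
    constructor
    · rintro ⟨j, hj, rfl⟩
      by_cases hji : j ≤ i
      · exact ⟨j, hj, by simp [hji]⟩
      · exact ⟨t + i + 1 - j, by omega, by simp [hji]⟩
    · rintro ⟨j, hj, rfl⟩
      by_cases hji : j ≤ i
      · exact ⟨j, hj, by simp [hji]⟩
      · refine ⟨t + i + 1 - j, by omega, ?_⟩
        have h1 : ¬ t + i + 1 - j ≤ i := by omega
        have h2 : t + i + 1 - (t + i + 1 - j) = j := by omega
        simp [h1, h2]
  · intro j hj
    have h1 := h.e_inj j i
    have h2 := h.e_inj (t + i - j) i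
    grind

lemma IsBergeSeq.toBergePath (h : IsBergeSeq H v e t) :
    ∃ P : BergePath H t, P.verts 0 = v 0 ∧ P.verts (Fin.last t) = v t :=
  ⟨{ verts := fun i => v i
     edges := fun i => e i
     verts_inj := fun i j hij => Fin.ext (h.v_inj i j (by omega) (by omega) hij)
     edges_inj := fun i j hij => Fin.ext (h.e_inj i j i.2 j.2 hij)
     edges_mem := fun i => h.mem i i.2
     fst_mem := fun i => h.fst i i.2
     snd_mem := fun i => by simpa using h.snd i i.2 }, by simp, by simp⟩

lemma BergePath.exists_isBergeSeq (P : BergePath H t) :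
    ∃ v e, IsBergeSeq H v e t ∧ v 0 = P.verts 0 ∧ v t = P.verts (Fin.last t) := by
  refine ⟨fun i => if hi : i < t + 1 then P.verts ⟨i, hi⟩ else P.verts 0,
    fun i => if hi : i < t then P.edges ⟨i, hi⟩ else ∅, ?_, by simp, by simp; rfl⟩
  constructor
  · intro i j hi hj hij
    simp only [Nat.lt_succ_iff, hi, hj, dif_pos] at hij
    simpa using P.verts_inj hij
  · intro i j hi hj hij
    simp only [hi, hj, dif_pos] at hij
    simpa using P.edges_inj hij
  · intro i hi
    simpa [hi] using P.edges_mem ⟨i, hi⟩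
  · intro i hi
    simpa [hi, Nat.lt_succ_of_lt hi] using P.fst_mem ⟨i, hi⟩
  · intro i hi
    simpa [hi] using P.snd_mem ⟨i, hi⟩

lemma ShareEdge.symm {a b : V} (h : ShareEdge H a b) : ShareEdge H b a :=
  let ⟨e, he, ha, hb⟩ := h
  ⟨e, he, hb, ha⟩

lemma reflTransGen_shareEdge_symm {a b : V} (h : Relation.ReflTransGen (ShareEdge H) a b) :
    Relation.ReflTransGen (ShareEdge H) b a :=
  have : Std.Symm (ShareEdge H) := ⟨fun _ _ => ShareEdge.symm⟩
  Relation.ReflTransGen.stdSymm.symm _ _ h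

lemma IsBergeSeq.reflTransGen (h : IsBergeSeq H v e t) :
    ∀ i, i ≤ t → Relation.ReflTransGen (ShareEdge H) (v 0) (v i)
  | 0, _ => .refl
  | i + 1, hi =>
    (h.reflTransGen i (by omega)).tail ⟨e i, h.mem i hi, h.fst i hi, h.snd i hi⟩

lemma exists_isBergeSeq_of_reflTransGen {a b : V}
    (h : Relation.ReflTransGen (ShareEdge H) a b) :
    ∃ v e t, IsBergeSeq H v e t ∧ v 0 = a ∧ v t = b := by
  induction h with
  | refl => exact ⟨fun _ => a, fun _ => ∅, 0, .zero _ _, rfl, rfl⟩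
  | @tail b w _ hbw ih =>
    obtain ⟨v, e, t, hP, rfl, rfl⟩ := ih
    obtain ⟨f, hf, htf, hwf⟩ := hbw
    by_cases hw : ∃ i, i ≤ t ∧ v i = w
    · obtain ⟨i, hi, rfl⟩ := hw
      exact ⟨v, e, i, hP.mono_length hi, rfl, rfl⟩
    · push Not at hw
      by_cases hfe : ∃ j, j < t ∧ e j = f
      · obtain ⟨j, hj, rfl⟩ := hfe
        refine ⟨_, _, j + 1, (hP.mono_length hj.le).extend hf (hP.fst j hj) hwf
          (fun i hi => hw i (by omega)) (fun i hi heq => ?_), by simp, by simp⟩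
        have := hP.e_inj i j (by omega) hj heq
        omega
      · push Not at hfe
        exact ⟨_, _, t + 1, hP.extend hf htf hwf hw hfe, by simp, by simp⟩

end BergeSeq

section Degree

variable {V : Type*} {H : Finset (Finset V)} {r : ℕ}

/-- There are at most `C(|X| - 1, r - 1)` many `r`-subsets of `X` through a given vertex. -/
lemma card_le_choose_of_forall_subset {F : Finset (Finset V)} {X : Finset V} {y : V}
    (hy : y ∈ X) (hF : ∀ f ∈ F, f.card = r ∧ y ∈ f ∧ f ⊆ X) :
    F.card ≤ (X.card - 1).choose (r - 1) := by
  rw [← Finset.card_erase_of_mem hy, ← Finset.card_powersetCard]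
  refine Finset.card_le_card_of_injOn (fun f => f.erase y) ?_ ?_
  · intro f hf
    obtain ⟨h1, h2, h3⟩ := hF f hf
    exact Finset.mem_powersetCard.2 ⟨Finset.erase_subset_erase y h3, by rw [Finset.card_erase_of_mem h2, h1]⟩
  · intro f hf g hg hfg
    rw [← Finset.insert_erase (hF f hf).2.1, ← Finset.insert_erase (hF g hg).2.1]
    exact congrArg (insert y) hfg

lemma succ_lt_choose {m q : ℕ} (hq : 2 ≤ q) (hqm : q + 2 ≤ m) : m + 1 < m.choose q := by
  induction m generalizing q with
  | zero => omega
  | succ m ih =>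
    obtain ⟨q, rfl⟩ : ∃ p, q = p + 1 := ⟨q - 1, by omega⟩
    rw [Nat.choose_succ_succ']
    rcases (show 1 ≤ q by omega).eq_or_lt with rfl | hq'
    · have : 3 ≤ m.choose (1 + 1) := Nat.choose_le_choose 2 (show 3 ≤ m by omega)
      rw [Nat.choose_one_right]
      omega
    · have h1 := ih hq' (by omega)
      have h2 := Nat.choose_pos (show q + 1 ≤ m by omega)
      omega

/-- At most few hyperedges of a Berge-path contain its last vertex and either leave the path
or contain another given vertex of it. -/
lemma IsBergeSeq.card_filter_lt {v : ℕ → V} {e : ℕ → Finset V} {t s i : ℕ} (hr : 3 ≤ r)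
    (hs : r + 6 ≤ s) (huni : ∀ f ∈ H, f.card = r) (h : IsBergeSeq H v e t) (hts : t ≤ s)
    (hi : i < t) :
    ((Finset.range t).filter
      (fun j => v t ∈ e j ∧ (v i ∈ e j ∨ ¬ e j ⊆ seqVerts v t))).card <
        (s - 1).choose (r - 2) := by
  rcases hr.eq_or_lt with rfl | hr
  · have hsub : (Finset.range t).filter
        (fun j => v t ∈ e j ∧ (v i ∈ e j ∨ ¬ e j ⊆ seqVerts v t)) ⊆ {t - 1, i, i - 1} := by
      intro j hj
      simp only [Finset.mem_filter, Finset.mem_range] at hj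
      obtain ⟨hjt, htj, hij⟩ := hj
      simp only [Finset.mem_insert, Finset.mem_singleton]
      by_contra hne
      push Not at hne
      have h1 : v j ≠ v (j + 1) := fun hh => by
        have := h.v_inj _ _ (by omega) (by omega) hh; omega
      have h2 : v j ≠ v t := fun hh => by
        have := h.v_inj _ _ (by omega) (by omega) hh; omega
      have h3 : v (j + 1) ≠ v t := fun hh => by
        have := h.v_inj _ _ (by omega) (by omega) hh; omega
      have heq : {v j, v (j + 1), v t} = e j := by
        apply Finset.eq_of_subset_of_card_le
        · intro x hx
          simp only [Finset.mem_insert, Finset.mem_singleton] at hx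
          rcases hx with rfl | rfl | rfl
          exacts [h.fst j hjt, h.snd j hjt, htj]
        · rw [huni _ (h.mem j hjt), Finset.card_eq_three.2 ⟨_, _, _, h1, h2, h3, rfl⟩]
      rw [← heq] at hij
      rcases hij with hij | hij
      · simp only [Finset.mem_insert, Finset.mem_singleton] at hij
        rcases hij with hh | hh | hh
        all_goals have := h.v_inj _ _ (by omega) (by omega) hh; omega
      · apply hij
        intro x hx
        simp only [Finset.mem_insert, Finset.mem_singleton] at hx
        rw [mem_seqVerts]
        rcases hx with rfl | rfl | rfl
        exacts [⟨j, by omega, rfl⟩, ⟨j + 1, by omega, rfl⟩, ⟨t, le_rfl, rfl⟩]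
    have := (Finset.card_le_card hsub).trans Finset.card_le_three
    simp only [show 3 - 2 = 1 from rfl, Nat.choose_one_right]
    omega
  · refine (Finset.card_filter_le _ _).trans_lt ?_
    rw [Finset.card_range]
    have := succ_lt_choose (show 2 ≤ r - 2 by omega) (show r - 2 + 2 ≤ s - 1 by omega)
    omega

/-- If no unused hyperedge at the end of a short Berge-path leaves the path, then every other
vertex of the path is joined to the end by an unused hyperedge. -/
lemma IsBergeSeq.exists_unused_edge {v : ℕ → V} {e : ℕ → Finset V} {t s i : ℕ} (hr : 3 ≤ r)
    (hs : r + 6 ≤ s) (huni : ∀ f ∈ H, f.card = r) (h : IsBergeSeq H v e t) (hts : t ≤ s)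
    (hi : i < t) (hdeg : s.choose (r - 1) ≤ hdeg H (v t))
    (hend : ∀ f ∈ H, v t ∈ f → (∀ j, j < t → e j ≠ f) → f ⊆ seqVerts v t) :
    ∃ f ∈ H, v t ∈ f ∧ v i ∈ f ∧ ∀ j, j < t → e j ≠ f := by
  by_contra hno
  push Not at hno
  have hvt : v t ∈ (seqVerts v t).erase (v i) := by
    refine Finset.mem_erase.2 ⟨fun hh => ?_, mem_seqVerts.2 ⟨t, le_rfl, rfl⟩⟩
    have := h.v_inj _ _ le_rfl hi.le hh
    omega
  have hcover : H.filter (fun f => v t ∈ f) ⊆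
      H.filter (fun f => v t ∈ f ∧ f ⊆ (seqVerts v t).erase (v i)) ∪
      ((Finset.range t).filter
        (fun j => v t ∈ e j ∧ (v i ∈ e j ∨ ¬ e j ⊆ seqVerts v t))).image e := by
    intro f hf
    simp only [Finset.mem_filter, Finset.mem_union, Finset.mem_image, Finset.mem_range,
      Finset.subset_erase] at hf ⊢
    by_cases hif : v i ∈ f
    · obtain ⟨j, hj, rfl⟩ := hno f hf.1 hf.2 hif
      exact Or.inr ⟨j, ⟨hj, hf.2, Or.inl hif⟩, rfl⟩
    · by_cases hfX : f ⊆ seqVerts v t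
      · exact Or.inl ⟨hf.1, hf.2, hfX, hif⟩
      · have hused := mt (hend f hf.1 hf.2) hfX
        push Not at hused
        obtain ⟨j, hj, rfl⟩ := hused
        exact Or.inr ⟨j, ⟨hj, hf.2, Or.inr hfX⟩, rfl⟩
  have hcard := (Finset.card_le_card hcover).trans (Finset.card_union_le _ _)
  have h1 := card_le_choose_of_forall_subset (r := r)
    (F := H.filter (fun f => v t ∈ f ∧ f ⊆ (seqVerts v t).erase (v i))) hvt
    (fun f hf => ⟨huni f (Finset.mem_filter.1 hf).1, (Finset.mem_filter.1 hf).2⟩)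
  rw [Finset.card_erase_of_mem (mem_seqVerts.2 ⟨i, hi.le, rfl⟩), h.card_seqVerts] at h1
  have h2 := Finset.card_image_le (f := e) (s := (Finset.range t).filter
        (fun j => v t ∈ e j ∧ (v i ∈ e j ∨ ¬ e j ⊆ seqVerts v t)))
  have h3 := h.card_filter_lt hr hs huni hts hi
  have h4 : (t + 1 - 1 - 1).choose (r - 1) ≤ (s - 1).choose (r - 1) :=
    Nat.choose_le_choose _ (by omega)
  have h5 : s.choose (r - 1) = (s - 1).choose (r - 2) + (s - 1).choose (r - 1) := by
    obtain ⟨s, rfl⟩ : ∃ m, s = m + 1 := ⟨s - 1, by omega⟩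
    obtain ⟨r, rfl⟩ : ∃ m, r = m + 2 := ⟨r - 2, by omega⟩
    exact Nat.choose_succ_succ s r
  unfold _root_.hdeg at hdeg
  omega

/-- A Berge-path that cannot be replaced by a longer one with the same start covering its
vertices. -/
def IsCoverMaximal (H : Finset (Finset V)) (v : ℕ → V) (t : ℕ) : Prop :=
  ∀ v' e', IsBergeSeq H v' e' (t + 1) → v' 0 = v 0 → ¬ seqVerts v t ⊆ seqVerts v' (t + 1)

lemma IsBergeSeq.subset_of_isCoverMaximal {v : ℕ → V} {e : ℕ → Finset V} {t : ℕ}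
    (h : IsBergeSeq H v e t) (hmax : IsCoverMaximal H v t) {f : Finset V} (hf : f ∈ H)
    (htf : v t ∈ f) (hfe : ∀ j, j < t → e j ≠ f) : f ⊆ seqVerts v t := by
  intro w hw
  by_contra hwX
  refine hmax _ _ (h.extend hf htf hw (fun i hi hh => hwX (mem_seqVerts.2 ⟨i, hi, hh⟩)) hfe)
    (by simp) ?_
  intro x hx
  obtain ⟨i, hi, rfl⟩ := mem_seqVerts.1 hx
  exact mem_seqVerts.2 ⟨i, by omega, by simp [hi]⟩

variable {s : ℕ}

/-- All hyperedges at the end of a short cover-maximal Berge-path lie inside the path. -/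
lemma IsBergeSeq.end_edge_subset {v : ℕ → V} {e : ℕ → Finset V} {t : ℕ} (hr : 3 ≤ r)
    (hs : r + 6 ≤ s) (huni : ∀ f ∈ H, f.card = r)
    (hdeg : ∀ f ∈ H, ∀ x ∈ f, s.choose (r - 1) ≤ hdeg H x)
    (h : IsBergeSeq H v e t) (hts : t ≤ s) (hmax : IsCoverMaximal H v t)
    {f : Finset V} (hf : f ∈ H) (htf : v t ∈ f) : f ⊆ seqVerts v t := by
  by_cases hused : ∀ j, j < t → e j ≠ f
  · exact h.subset_of_isCoverMaximal hmax hf htf hused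
  · push Not at hused
    obtain ⟨j, hj, rfl⟩ := hused
    obtain ⟨g, hg, htg, hjg, hgu⟩ := h.exists_unused_edge hr hs huni hts hj (hdeg _ hf _ htf)
      (fun g hg htg => h.subset_of_isCoverMaximal hmax hg htg)
    obtain ⟨v', e', h', h0, hend, hX, hunused⟩ := h.rotate hj hg htg hjg hgu
    rw [← hX]
    refine h'.subset_of_isCoverMaximal ?_ hf (hend ▸ h.snd j hj) hunused
    intro w c hc hw
    rw [hX]
    exact hmax w c hc (hw.trans h0)

/-- In a short cover-maximal Berge-path of length `t`, every vertex other than the start has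
degree at most `C(t, r - 1)`. -/
lemma IsBergeSeq.hdeg_le {v : ℕ → V} {e : ℕ → Finset V} {t i : ℕ} (hr : 3 ≤ r)
    (hs : r + 6 ≤ s) (huni : ∀ f ∈ H, f.card = r)
    (hdeg : ∀ f ∈ H, ∀ x ∈ f, s.choose (r - 1) ≤ hdeg H x)
    (h : IsBergeSeq H v e t) (hts : t ≤ s) (hmax : IsCoverMaximal H v t) (hi : i < t) :
    _root_.hdeg H (v (i + 1)) ≤ t.choose (r - 1) := by
  obtain ⟨t, rfl⟩ : ∃ m, t = m + 1 := ⟨t - 1, by omega⟩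
  have hlast := h.mem t (by omega)
  obtain ⟨g, hg, htg, hjg, hgu⟩ := h.exists_unused_edge hr hs huni hts hi
    (hdeg _ hlast _ (h.snd t (by omega)))
    (fun g hg htg => h.subset_of_isCoverMaximal hmax hg htg)
  obtain ⟨v', e', h', h0, hend, hX, hunused⟩ := h.rotate hi hg htg hjg hgu
  have hmax' : IsCoverMaximal H v' (t + 1) := by
    intro w c hc hw
    rw [hX]
    exact hmax w c hc (hw.trans h0)
  have key := card_le_choose_of_forall_subset (r := r)
    (F := H.filter (fun f => v' (t + 1) ∈ f)) (X := seqVerts v' (t + 1))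
    (mem_seqVerts.2 ⟨_, le_rfl, rfl⟩) (fun f hf => by
      obtain ⟨hf, htf⟩ := Finset.mem_filter.1 hf
      exact ⟨huni f hf, htf, h'.end_edge_subset hr hs huni hdeg hts hmax' hf htf⟩)
  rw [h'.card_seqVerts, hend] at key
  exact key

lemma exists_and_not_succ_of_bounded {p : ℕ → Prop} {a B : ℕ} (ha : p a)
    (hB : ∀ t, p t → t < B) : ∃ t, p t ∧ ¬ p (t + 1) := by
  by_contra hno
  push Not at hno
  have : ∀ m, p (a + m) := fun m => by
    induction m with
    | zero => exact ha
    | succ m ih => exact hno _ ih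
  have := hB _ (this B)
  omega

/-- If no Berge-path from `u` has length `s + 1`, all other vertices of its component have
degree at most `C(s, r - 1)`. -/
lemma hdeg_le_of_no_long_path (hr : 3 ≤ r)
    (hs : r + 6 ≤ s) (huni : ∀ f ∈ H, f.card = r)
    (hdeg : ∀ f ∈ H, ∀ x ∈ f, s.choose (r - 1) ≤ hdeg H x) {u x : V} (hux : u ≠ x)
    (hreach : Relation.ReflTransGen (ShareEdge H) u x)
    (hno : ∀ v e, IsBergeSeq H v e (s + 1) → v 0 ≠ u) :
    _root_.hdeg H x ≤ s.choose (r - 1) := by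
  obtain ⟨v, e, t, hP, h0, htx⟩ := exists_isBergeSeq_of_reflTransGen hreach
  have hbound : ∀ t, (∃ v e, IsBergeSeq H v e t ∧ v 0 = u ∧ x ∈ seqVerts v t) → t < s + 1 := by
    rintro t ⟨v, e, hP, h0, -⟩
    by_contra ht
    exact hno v e (hP.mono_length (by omega)) h0
  obtain ⟨t, ht, hmax⟩ := exists_and_not_succ_of_bounded
    (p := fun t => ∃ v e, IsBergeSeq H v e t ∧ v 0 = u ∧ x ∈ seqVerts v t)
    ⟨v, e, hP, h0, mem_seqVerts.2 ⟨t, le_rfl, htx⟩⟩ hbound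
  have hts := hbound t ht
  obtain ⟨v, e, hP, h0, hx⟩ := ht
  obtain ⟨i, hi, rfl⟩ := mem_seqVerts.1 hx
  obtain ⟨i, rfl⟩ : ∃ m, i = m + 1 := by
    cases i with
    | zero => exact absurd h0.symm hux
    | succ i => exact ⟨i, rfl⟩
  refine (hP.hdeg_le hr hs huni hdeg (by omega) ?_ hi).trans (Nat.choose_le_choose _ (by omega))
  intro w c hc hw hsub
  exact hmax ⟨w, c, hc, hw.trans h0, hsub hx⟩

/-- Every vertex in a hyperedge starts a Berge-path of length `s`. -/
lemma exists_path_of_min_degree (hr : 3 ≤ r)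
    (hs : r + 6 ≤ s) (huni : ∀ f ∈ H, f.card = r)
    (hdeg : ∀ f ∈ H, ∀ x ∈ f, s.choose (r - 1) ≤ hdeg H x) {u : V} {f : Finset V} (hf : f ∈ H)
    (huf : u ∈ f) : ∃ v e, IsBergeSeq H v e s ∧ v 0 = u := by
  by_contra hno
  push Not at hno
  have hbound : ∀ t, (∃ v e, IsBergeSeq H v e t ∧ v 0 = u) → t < s := by
    rintro t ⟨v, e, hP, h0⟩
    by_contra ht
    exact hno v e (hP.mono_length (by omega)) h0
  obtain ⟨t, ht, hmax⟩ := exists_and_not_succ_of_bounded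
    (p := fun t => ∃ v e, IsBergeSeq H v e t ∧ v 0 = u)
    ⟨fun _ => u, fun _ => ∅, .zero _ _, rfl⟩ hbound
  have hts := hbound t ht
  obtain ⟨v, e, hP, h0⟩ := ht
  have hcm : IsCoverMaximal H v t := fun w c hc hw _ => hmax ⟨w, c, hc, hw.trans h0⟩
  cases t with
  | zero =>
    have hsub := hP.subset_of_isCoverMaximal hcm hf (h0 ▸ huf) (by omega)
    have := Finset.card_le_card hsub
    rw [hP.card_seqVerts, huni f hf] at this
    omega
  | succ t =>
    have h1 := hP.hdeg_le hr hs huni hdeg hts.le hcm (i := t) (by omega)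
    have h2 := hdeg _ (hP.mem t (by omega)) _ (hP.snd t (by omega))
    have h3 : (t + 1).choose (r - 1) < s.choose (r - 1) := by
      refine (Nat.choose_le_choose _ (show t + 1 ≤ s - 1 by omega)).trans_lt ?_
      obtain ⟨s, rfl⟩ : ∃ m, s = m + 1 := ⟨s - 1, by omega⟩
      obtain ⟨r, rfl⟩ : ∃ m, r = m + 2 := ⟨r - 2, by omega⟩
      have := Nat.choose_pos (show r ≤ s by omega)
      simp only [Nat.add_sub_cancel, show r + 2 - 1 = r + 1 from rfl, Nat.choose_succ_succ' s r]
      omega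
    omega

end Degree

section Deletion

variable {V : Type*} {H : Finset (Finset V)}

lemma mem_restrictTo {S : Finset V} {e : Finset V} : e ∈ restrictTo H S ↔ e ∈ H ∧ e ⊆ S := by
  simp [restrictTo]

lemma exists_edge_of_hdeg_pos {x : V} (h : 0 < hdeg H x) : ∃ e ∈ H, x ∈ e := by
  obtain ⟨e, he⟩ := Finset.card_pos.1 h
  exact ⟨e, Finset.mem_filter.1 he⟩

lemma restrictTo_card_le_erase (S : Finset V) (v : V) :
    (restrictTo H S).card ≤ (restrictTo H (S.erase v)).card + hdeg (restrictTo H S) v := by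
  have hsub : restrictTo H S ⊆
      restrictTo H (S.erase v) ∪ (restrictTo H S).filter (fun e => v ∈ e) := by
    intro e he
    simp only [mem_restrictTo, Finset.mem_union, Finset.mem_filter, Finset.subset_erase] at he ⊢
    tauto
  exact (Finset.card_le_card hsub).trans (Finset.card_union_le _ _)

/-- Every deleted vertex destroys fewer than `D` hyperedges. -/
lemma DelProcess.card_le {D : ℕ} {S T : Finset V} (h : DelProcess H D S T) :
    T ⊆ S ∧ (restrictTo H S).card + (S.card - T.card) ≤
      (restrictTo H T).card + D * (S.card - T.card) := by
  induction h with
  | refl S => simp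
  | step S T v hv hd _ ih =>
    obtain ⟨hTS, ih⟩ := ih
    refine ⟨hTS.trans (Finset.erase_subset v S), ?_⟩
    have h1 := restrictTo_card_le_erase (H := H) S v
    have h2 := Finset.card_le_card hTS
    have h3 := Finset.card_erase_add_one hv
    have h4 : S.card - T.card = (S.erase v).card - T.card + 1 := by omega
    rw [h4, mul_add]
    omega

/-- If the hypergraph has more than `D |S| / (r - 1)` hyperedges, then some hyperedge contains
two vertices of degree more than `D`. -/
lemma exists_edge_with_two_large_degrees {r D : ℕ} {S : Finset V} (huni : ∀ e ∈ H, e.card = r)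
    (hHS : ∀ e ∈ H, e ⊆ S) (hbig : D * S.card < (r - 1) * H.card) :
    ∃ e ∈ H, ∃ x ∈ e, ∃ y ∈ e, x ≠ y ∧ D < hdeg H x ∧ D < hdeg H y := by
  by_contra hno
  push Not at hno
  have hlow : ∀ e ∈ H, r - 1 ≤ (e.filter (fun x => hdeg H x ≤ D)).card := by
    intro e he
    have h1 : (e.filter (fun x => ¬ hdeg H x ≤ D)).card ≤ 1 := by
      rw [Finset.card_le_one]
      intro x hx y hy
      simp only [Finset.mem_filter, not_le] at hx hy
      by_contra hxy
      exact absurd (hno e he x hx.1 y hy.1 hxy hx.2) (by omega)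
    have h2 := Finset.card_filter_add_card_filter_not (s := e) (fun x => hdeg H x ≤ D)
    rw [huni e he] at h2
    omega
  have hcount : ∑ e ∈ H, (e.filter (fun x => hdeg H x ≤ D)).card =
      ∑ x ∈ S.filter (fun x => hdeg H x ≤ D), hdeg H x := by
    refine Eq.trans ?_ (Finset.sum_card_bipartiteAbove_eq_sum_card_bipartiteBelow
      (s := H) (t := S.filter (fun x => hdeg H x ≤ D)) (fun e x => x ∈ e))
    refine Finset.sum_congr rfl fun e he => congrArg Finset.card ?_
    ext x
    have := @hHS e he x
    simp only [Finset.bipartiteAbove, Finset.mem_filter]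
    tauto
  have h1 : H.card * (r - 1) ≤ ∑ e ∈ H, (e.filter (fun x => hdeg H x ≤ D)).card := by
    simpa using Finset.card_nsmul_le_sum H _ _ hlow
  have h2 : ∑ x ∈ S.filter (fun x => hdeg H x ≤ D), hdeg H x ≤ S.card * D := by
    refine (Finset.sum_le_card_nsmul _ _ D fun x hx => (Finset.mem_filter.1 hx).2).trans ?_
    exact Nat.mul_le_mul_right _ (Finset.card_filter_le _ _)
  rw [hcount] at h1
  rw [mul_comm D, mul_comm (r - 1)] at hbig
  omega

/-- In a connected hypergraph, a component of the sub-hypergraph induced by `S` can be joined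
to another one by a Berge-path that meets `S` only at its ends and avoids the induced
hyperedges. -/
lemma exists_connecting_path {S : Finset V} {x w : V}
    (hconn : HConnected H) (hw : w ∈ S)
    (hxw : ¬ Relation.ReflTransGen (ShareEdge (restrictTo H S)) x w) :
    ∃ v e t, IsBergeSeq H v e t ∧ 1 ≤ t ∧ v t ∈ S ∧
      Relation.ReflTransGen (ShareEdge (restrictTo H S)) x (v 0) ∧
      ¬ Relation.ReflTransGen (ShareEdge (restrictTo H S)) x (v t) ∧
      (∀ i, 0 < i → i < t → v i ∉ S) ∧ (∀ i, i < t → e i ∉ restrictTo H S) := by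
  obtain ⟨T, P, hP0, hPT⟩ := hconn x w (by rintro rfl; exact hxw .refl)
  obtain ⟨v, e, hP, h0, hT⟩ := P.exists_isBergeSeq
  rw [hP0] at h0
  rw [hPT] at hT
  set R := Relation.ReflTransGen (ShareEdge (restrictTo H S)) with hR
  obtain ⟨a, haR, haT, hamax⟩ : ∃ a, R x (v a) ∧ a < T ∧ ∀ j, a < j → j ≤ T → ¬ R x (v j) := by
    have hex : R x (v 0) := h0 ▸ .refl
    have hne : ¬ R x (v T) := hT ▸ hxw
    have hg := Nat.findGreatest_spec (P := fun j => R x (v j)) (Nat.zero_le T) hex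
    refine ⟨_, hg, lt_of_le_of_ne (Nat.findGreatest_le T) fun hh => hne (hh ▸ hg), ?_⟩
    exact fun j h1 h2 => Nat.findGreatest_is_greatest h1 h2
  have hexb : ∃ m, 1 ≤ m ∧ a + m ≤ T ∧ v (a + m) ∈ S :=
    ⟨T - a, by omega, by omega, by rw [show a + (T - a) = T by omega, hT]; exact hw⟩
  obtain ⟨hm1, hmT, hmS⟩ := Nat.find_spec hexb
  have hmmin := fun i => Nat.find_min hexb (m := i)
  set m := Nat.find hexb
  have hint : ∀ i, 0 < i → i < m → v (a + i) ∉ S := fun i h1 h2 h3 =>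
    hmmin i h2 ⟨h1, by omega, h3⟩
  refine ⟨fun i => v (a + i), fun i => e (a + i), m, (hP.mono_length hmT).shift, hm1, hmS, haR,
    hamax _ (by omega) hmT, hint, ?_⟩
  intro i hi hmem
  have hsub := (mem_restrictTo.1 hmem).2
  have hfst := hP.fst (a + i) (by omega)
  have hsnd := hP.snd (a + i) (by omega)
  have hi0 : i = 0 := by
    by_contra hne
    exact hint i (by omega) hi (hsub hfst)
  subst hi0
  exact hamax (a + 1) (by omega) (by omega) (haR.tail ⟨_, hmem, hfst, hsnd⟩)

end Deletion

/-- The hypergraph left by the deletion process has large average degree. -/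
lemma residual_card_lt {r k n : ℕ} (hr : 3 ≤ r) (hk : 2 * r + 13 ≤ k) (hn : Nkr r k < n)
    {H : Finset (Finset (Fin n))} (huni : ∀ e ∈ H, e.card = r)
    (hcard : extremalCount r k n ≤ H.card) {S : Finset (Fin n)}
    (hS : DelProcess H (((k - 1) / 2).choose (r - 1)) Finset.univ S) :
    ((k - 1) / 2).choose (r - 1) * S.card < (r - 1) * (restrictTo H S).card := by
  obtain ⟨-, hdel⟩ := hS.card_le
  have huniv : restrictTo H Finset.univ = H := by
    simp [restrictTo]
  rw [huniv, Finset.card_univ, Fintype.card_fin] at hdel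
  have hSn : S.card ≤ n := by simpa using S.card_le_univ
  have hDpos : 0 < ((k - 1) / 2).choose (r - 1) := Nat.choose_pos (by omega)
  have hR : 3 * (k - 1) ≤ r * (k - 1) := Nat.mul_le_mul_right _ hr
  have hle : (restrictTo H S).card ≤ S.card.choose r := by
    rw [← Finset.card_powersetCard]
    refine Finset.card_le_card fun e he => ?_
    obtain ⟨he, heS⟩ := mem_restrictTo.1 he
    exact Finset.mem_powersetCard.2 ⟨heS, huni e he⟩
  unfold extremalCount at hcard
  unfold Nkr at hn
  have hsk : 2 * ((k - 1) / 2) ≤ k - 1 := by omega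
  generalize ((k - 1) / 2).choose r = c at *
  generalize (if 2 ∣ k then ((k - 1) / 2).choose (r - 2) else 0) = c' at *
  generalize ((k - 1) / 2).choose (r - 1) = D at *
  generalize (k - 1) / 2 = s at *
  generalize (restrictTo H S).card = E at *
  obtain ⟨a, ha⟩ : ∃ a, n = S.card + a := ⟨n - S.card, by omega⟩
  obtain ⟨b, hb⟩ : ∃ b, n = s + b := ⟨n - s, by omega⟩
  rw [show n - S.card = a by omega] at hdel
  rw [show n - s = b by omega] at hcard
  have hab : D * S.card + D * a = D * s + D * b := by rw [← mul_add, ← mul_add]; congr 1; omega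
  have hSR : r * (k - 1) < S.card := by
    by_contra hSR
    have := Nat.choose_le_choose r (show S.card ≤ r * (k - 1) by omega)
    omega
  have h1 : D * S.card ≤ E + D * s := by omega
  have h2 : D * (6 * s) < D * S.card := Nat.mul_lt_mul_of_pos_left (by omega) hDpos
  have h3 : 2 * E ≤ (r - 1) * E := Nat.mul_le_mul_right _ (by omega)
  have h4 : D * (6 * s) = 6 * (D * s) := by ring
  omega

/-- Under the standing assumptions, the sub-hypergraph `H'` obtained from
`H` by repeatedly deleting vertices of degree less than `C(⌊(k-1)/2⌋, r-1)` together with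
their incident hyperedges is connected (on its vertex set `S`). -/
theorem residual_hypergraph_connected
    (r k n : ℕ) (hk : 2 * r + 13 ≤ k) (hr : 18 ≤ 2 * r + 13) (hn : Nkr r k < n)
    (H : Finset (Finset (Fin n))) (huni : ∀ e ∈ H, e.card = r)
    (hconn : HConnected H) (hpath : IsEmpty (BergePath H k))
    (hcard : extremalCount r k n ≤ H.card)
    (S : Finset (Fin n))
    (hS : DelProcess H (((k - 1) / 2).choose (r - 1)) Finset.univ S)
    (hterm : ∀ v ∈ S, ((k - 1) / 2).choose (r - 1) ≤ hdeg (restrictTo H S) v)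
    :
    ∀ u ∈ S, ∀ v ∈ S, u ≠ v → BergeReachable (restrictTo H S) u v := by
  have hr3 : 3 ≤ r := by omega
  set s := (k - 1) / 2 with hs
  have hsr : r + 6 ≤ s := by omega
  set G := restrictTo H S with hG
  have hGH : G ⊆ H := fun e he => (mem_restrictTo.1 he).1
  have hGS : ∀ e ∈ G, e ⊆ S := fun e he => (mem_restrictTo.1 he).2
  have hGuni : ∀ e ∈ G, e.card = r := fun e he => huni e (hGH he)
  have hGdeg : ∀ f ∈ G, ∀ x ∈ f, s.choose (r - 1) ≤ hdeg G x :=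
    fun f hf x hx => hterm x (hGS f hf hx)
  have hDpos : 0 < s.choose (r - 1) := Nat.choose_pos (by omega)
  have hbig : s.choose (r - 1) * S.card < (r - 1) * G.card :=
    residual_card_lt hr3 hk hn huni hcard hS
  obtain ⟨g, hg, x, hxg, y, hyg, hxy, hdx, hdy⟩ :=
    exists_edge_with_two_large_degrees hGuni hGS hbig
  intro u hu v hv _
  have hRsymm := fun a b => reflTransGen_shareEdge_symm (H := G) (a := a) (b := b)
  suffices hreach : Relation.ReflTransGen (ShareEdge G) u v by
    obtain ⟨p, e, t, hP, rfl, rfl⟩ := exists_isBergeSeq_of_reflTransGen hreach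
    exact ⟨t, hP.toBergePath⟩
  by_contra huv
  obtain ⟨w, hw, hxw⟩ : ∃ w ∈ S, ¬ Relation.ReflTransGen (ShareEdge G) x w := by
    by_contra hall
    push Not at hall
    exact huv ((hRsymm _ _ (hall u hu)).trans (hall v hv))
  obtain ⟨p, e, t, hP, ht, hptS, hp0, hpt, hpS, heG⟩ :=
    exists_connecting_path hconn hw hxw
  obtain ⟨p₁, e₁, hP₁, hstart₁⟩ : ∃ v e, IsBergeSeq G v e (s + 1) ∧ v 0 = p 0 := by
    by_contra hno
    push Not at hno
    by_cases h0 : p 0 = x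
    · have hreach : Relation.ReflTransGen (ShareEdge G) (p 0) y :=
        (hRsymm _ _ hp0).tail ⟨g, hg, hxg, hyg⟩
      exact absurd (hdeg_le_of_no_long_path hr3 hsr hGuni hGdeg (h0 ▸ hxy) hreach hno) (by omega)
    · exact absurd (hdeg_le_of_no_long_path hr3 hsr hGuni hGdeg h0 (hRsymm _ _ hp0) hno)
        (by omega)
  obtain ⟨p₂, e₂, hP₂, hstart₂⟩ : ∃ v e, IsBergeSeq G v e s ∧ v 0 = p t := by
    obtain ⟨f, hf, hptf⟩ := exists_edge_of_hdeg_pos (hDpos.trans_le (hterm _ hptS))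
    exact exists_path_of_min_degree hr3 hsr hGuni hGdeg hf hptf
  have hreach₁ : ∀ i, i ≤ s + 1 → Relation.ReflTransGen (ShareEdge G) x (p₁ i) := fun i hi =>
    hp0.trans (hstart₁ ▸ hP₁.reflTransGen i hi)
  have hreach₂ : ∀ i, i ≤ s → ¬ Relation.ReflTransGen (ShareEdge G) x (p₂ i) := fun i hi hx =>
    hpt (hx.trans (hRsymm _ _ (hstart₂ ▸ hP₂.reflTransGen i hi)))
  have hS₁ : ∀ i, i ≤ s + 1 → p₁ i ∈ S := fun i hi => by
    rcases i with _ | i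
    · exact hGS _ (hP₁.mem 0 (by omega)) (hP₁.fst 0 (by omega))
    · exact hGS _ (hP₁.mem i hi) (hP₁.snd i hi)
  have hS₂ : ∀ i, i ≤ s → p₂ i ∈ S := fun i hi => by
    rcases i with _ | i
    · exact hstart₂ ▸ hptS
    · exact hGS _ (hP₂.mem i hi) (hP₂.snd i hi)
  have hQ := (hP.append (hP₂.mono hGH) hstart₂.symm (fun i j hi hj hij => by
      have hiS : p i ∈ S := hij ▸ hS₂ j hj
      have hi' : i = t := by
        by_contra hne
        rcases Nat.eq_zero_or_pos i with rfl | hpos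
        · exact hreach₂ j hj (hij ▸ hp0)
        · exact hpS i hpos (by omega) hiS
      rw [hi', ← hstart₂] at hij
      exact (hP₂.v_inj 0 j (by omega) hj hij).symm)
    (fun i j hi hj hij => heG i hi (hij ▸ hP₂.mem j hj)))
  have hfull := (hP₁.mono hGH).reverse.append hQ (by simp [hstart₁]) (fun i j hi hj hij => by
      have hi' : s + 1 - i ≤ s + 1 := by omega
      by_cases hjt : j ≤ t
      · simp only [hjt, if_true] at hij
        by_contra hj0
        rcases hjt.eq_or_lt with rfl | hlt
        · exact hpt (hij ▸ hreach₁ _ hi')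
        · exact hpS j (by omega) hlt (hij ▸ hS₁ _ hi')
      · simp only [hjt, if_false] at hij
        exact absurd (hij ▸ hreach₁ _ hi') (hreach₂ (j - t) (by omega)))
    (fun i j hi hj hij => by
      have hmem := hP₁.mem (s + 1 - 1 - i) (by omega)
      by_cases hjt : j < t
      · simp only [hjt, if_true] at hij
        exact heG j hjt (hij ▸ hmem)
      · simp only [hjt, if_false] at hij
        have h1 := hP₁.fst (s + 1 - 1 - i) (by omega)
        have h2 := hP₂.fst (j - t) (by omega)
        exact hreach₂ (j - t) (by omega)
          ((hreach₁ (s + 1 - 1 - i) (by omega)).tail ⟨_, hmem, h1, hij ▸ h2⟩))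
  obtain ⟨P, -⟩ := (hfull.mono_length (show k ≤ s + 1 + (t + s) by omega)).toBergePath
  exact hpath.false P
end
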